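/- Let $P = \Delta^2 + \frac{1}{2}\Delta - \frac{15}{16}$ be the Paneitz operator on the standard $S^3$. For every $\varepsilon > 0$ small, the infimum $-s_\varepsilon = \inf\{\|\varphi^{-1}\|_{L^6}^2 (E(\varphi) + \varepsilon\|\varphi\|_{L^2}^2) : \varphi \in H^2(S^3), \varphi > 0\}$ is attained by some positive function $u \in C^\infty(S^3)$, and after normalizing $\|u^{-1}\|_{L^6} = 1$, $u$ satisfies the Euler–Lagrange equation $Pu + \varepsilon u = -s_\varepsilon u^{-7}$ on $S^3$. -/

import Mathlib

open MeasureTheory Metric Set Real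
open scoped RealInnerProductSpace

noncomputable section

/-- The ambient Euclidean space `ℝ⁴`. -/
abbrev E4 := EuclideanSpace ℝ (Fin 4)

/-- The standard round sphere `S³ ⊂ ℝ⁴`. -/
def S3 : Set E4 := sphere (0 : E4) 1

/-- The standard (3-dimensional Hausdorff) measure on `S³`. -/
def muS : Measure E4 := μH[(3 : ℝ)].restrict S3

/-- Degree-zero homogeneous extension of a function on `S³` to `ℝ⁴ \ {0}`. -/
def ext0 (f : E4 → ℝ) : E4 → ℝ := fun x => f (‖x‖⁻¹ • x)

/-- The Laplace–Beltrami operator of the round `S³`, computed as the Euclidean Laplacian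
of the degree-zero homogeneous extension (these agree on the sphere). -/
def sLap (f : E4 → ℝ) : E4 → ℝ := fun x =>
  ∑ i : Fin 4, fderiv ℝ (fun y => fderiv ℝ (ext0 f) y (EuclideanSpace.single i 1)) x
    (EuclideanSpace.single i 1)

/-- The (tangential) gradient on `S³`, computed as the Euclidean gradient of the
degree-zero homogeneous extension. -/
def sGrad (f : E4 → ℝ) : E4 → E4 := fun x => gradient (ext0 f) x

/-- The Paneitz operator `P = Δ² + (1/2)Δ - 15/16` on the standard `S³`. -/
def Pan (f : E4 → ℝ) : E4 → ℝ := fun x =>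
  sLap (sLap f) x + (1 / 2) * sLap f x - (15 / 16) * f x

/-- The Paneitz energy `E(φ) = ∫_{S³} [(Δφ)² - (1/2)|∇φ|² - (15/16)φ²] dμ`. -/
def Efun (f : E4 → ℝ) : ℝ :=
  ∫ x, ((sLap f x) ^ 2 - (1 / 2) * ‖sGrad f x‖ ^ 2 - (15 / 16) * (f x) ^ 2) ∂muS

/-- Smoothness of a function on `S³` (smoothness of its homogeneous extension). -/
def SmoothS3 (f : E4 → ℝ) : Prop := ContDiffOn ℝ (⊤ : ℕ∞) (ext0 f) {0}ᶜ

/-- Membership surrogate for `H²(S³)`: the homogeneous extension is `C²` away from the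
origin. -/
def H2S3 (f : E4 → ℝ) : Prop := ContDiffOn ℝ 2 (ext0 f) {0}ᶜ

/-- `‖φ⁻¹‖_{L⁶(S³)}²`. -/
def invL6sq (f : E4 → ℝ) : ℝ := (∫ x, ((f x)⁻¹) ^ 6 ∂muS) ^ ((1 : ℝ) / 3)


/-- The unit sphere of `ℝ⁴` as a type. -/
abbrev Sph : Type := sphere (0 : E4) 1

/-- The intrinsic three-dimensional Hausdorff measure on the sphere. -/
def nuS : Measure Sph := μH[(3 : ℝ)]

theorem map_val_nuS : Measure.map (Subtype.val : Sph → E4) nuS = muS := by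
  have := (isometry_subtype_coe (s := sphere (0 : E4) 1)).map_hausdorffMeasure (d := 3)
    (Or.inl (by norm_num))
  rw [Subtype.range_coe] at this
  exact this

theorem integral_muS (F : E4 → ℝ) : ∫ x, F x ∂muS = ∫ x : Sph, F x ∂nuS := by
  rw [← map_val_nuS]
  exact (MeasurableEmbedding.subtype_coe isClosed_sphere.measurableSet).integral_map F

theorem integral_comp_isometry (e : Sph ≃ᵢ Sph) (f : Sph → ℝ) :
    ∫ x, f (e x) ∂nuS = ∫ x, f x ∂nuS :=
  (e.measurePreserving_hausdorffMeasure 3).integral_comp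
    e.toHomeomorph.measurableEmbedding f

instance : NullSingletonClass nuS :=
  Measure.nullSingletonClass_hausdorff Sph (by norm_num)

/-- The map `(a, b, c) ↦ (cos a e^{ib}, sin a e^{ic})`, which parametrizes the sphere. -/
def hopfParam (p : Fin 3 → ℝ) : E4 :=
  !₂[cos (p 0) * cos (p 1), cos (p 0) * sin (p 1), sin (p 0) * cos (p 2), sin (p 0) * sin (p 2)]

theorem contDiff_hopfParam : ContDiff ℝ 1 hopfParam := by
  rw [contDiff_euclidean]
  intro i
  have h : ∀ j : Fin 3, ContDiff ℝ 1 fun p : Fin 3 → ℝ => p j := fun j => contDiff_apply ℝ ℝ j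
  fin_cases i <;> simp [hopfParam] <;>
    exact ContDiff.mul
      (by first | exact Real.contDiff_cos.comp (h _) | exact Real.contDiff_sin.comp (h _))
      (by first | exact Real.contDiff_cos.comp (h _) | exact Real.contDiff_sin.comp (h _))

theorem sphere_subset_hopfParam :
    sphere (0 : E4) 1 ⊆ hopfParam '' (Icc (fun _ => -π) fun _ => π) := by
  intro x hx
  have hx1 : x 0 ^ 2 + x 1 ^ 2 + x 2 ^ 2 + x 3 ^ 2 = 1 := by
    have : ‖x‖ ^ 2 = 1 := by rw [mem_sphere_zero_iff_norm.1 hx]; norm_num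
    rwa [EuclideanSpace.real_norm_sq_eq, Fin.sum_univ_four] at this
  set z : ℂ := ⟨x 0, x 1⟩
  set w : ℂ := ⟨x 2, x 3⟩
  set v : ℂ := ⟨‖z‖, ‖w‖⟩
  have hz : ‖z‖ ^ 2 = x 0 ^ 2 + x 1 ^ 2 := by rw [Complex.sq_norm, Complex.normSq_mk]; ring
  have hw : ‖w‖ ^ 2 = x 2 ^ 2 + x 3 ^ 2 := by rw [Complex.sq_norm, Complex.normSq_mk]; ring
  have hv : ‖v‖ = 1 := by
    have : ‖v‖ ^ 2 = 1 := by rw [Complex.sq_norm, Complex.normSq_mk]; nlinarith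
    nlinarith [norm_nonneg v]
  refine ⟨![v.arg, z.arg, w.arg], ⟨fun i => ?_, fun i => ?_⟩, ?_⟩
  · fin_cases i <;> exact (Complex.neg_pi_lt_arg _).le
  · fin_cases i <;> exact Complex.arg_le_pi _
  · have h1 : cos v.arg = ‖z‖ := by
      have := Complex.norm_mul_cos_arg v; rwa [hv, one_mul] at this
    have h2 : sin v.arg = ‖w‖ := by
      have := Complex.norm_mul_sin_arg v; rwa [hv, one_mul] at this
    ext i
    fin_cases i <;> simp [hopfParam, h1, h2, Complex.norm_mul_cos_arg,
      Complex.norm_mul_sin_arg, z, w]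

theorem hausdorffMeasure_sphere_lt_top : (μH[(3 : ℝ)] : Measure E4) (sphere 0 1) < ⊤ := by
  set K : Set (Fin 3 → ℝ) := Icc (fun _ => -π) fun _ => π
  have hK : IsCompact K := isCompact_Icc
  obtain ⟨C, hC⟩ := (contDiff_hopfParam.locallyLipschitz.locallyLipschitzOn
    (s := K)).exists_lipschitzOnWith_of_compact hK
  refine (measure_mono sphere_subset_hopfParam).trans_lt ?_
  refine (hC.hausdorffMeasure_image_le (by norm_num : (0 : ℝ) ≤ 3)).trans_lt ?_
  refine ENNReal.mul_lt_top (by simp) ?_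
  have : (μH[(3 : ℝ)] : Measure (Fin 3 → ℝ)) = volume := by
    have := hausdorffMeasure_pi_real (ι := Fin 3)
    simpa using this
  rw [this]
  exact hK.measure_lt_top

theorem hausdorffMeasure_sphere_pos : 0 < (μH[(3 : ℝ)] : Measure E4) (sphere 0 1) := by
  set proj : E4 → (Fin 3 → ℝ) := fun x i => x i.castSucc
  have hproj : LipschitzWith 1 proj := by
    refine LipschitzWith.of_dist_le_mul fun x y => ?_
    rw [NNReal.coe_one, one_mul, dist_pi_le_iff dist_nonneg]
    intro i
    have := PiLp.norm_apply_le (x - y) i.castSucc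
    simpa [proj, dist_eq_norm] using this
  have hsub : Metric.ball (0 : Fin 3 → ℝ) (1 / 2) ⊆ proj '' sphere (0 : E4) 1 := by
    intro p hp
    have hp' : ∀ i, |p i| < 1 / 2 := fun i => by
      have := (norm_le_pi_norm p i).trans_lt (mem_ball_zero_iff.1 hp)
      simpa using this
    have hs : ∀ i, p i ^ 2 ≤ 1 / 4 := fun i => by
      have := abs_lt.1 (hp' i); nlinarith
    have h0 : 0 ≤ 1 - (p 0 ^ 2 + p 1 ^ 2 + p 2 ^ 2) := by linarith [hs 0, hs 1, hs 2]
    refine ⟨!₂[p 0, p 1, p 2, √(1 - (p 0 ^ 2 + p 1 ^ 2 + p 2 ^ 2))], ?_, ?_⟩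
    · rw [mem_sphere_zero_iff_norm, EuclideanSpace.norm_eq, Fin.sum_univ_four]
      simp [Real.sq_sqrt h0]
    · funext i; fin_cases i <;> rfl
  have h1 : (μH[(3 : ℝ)] : Measure (Fin 3 → ℝ)) = volume := by
    have := hausdorffMeasure_pi_real (ι := Fin 3)
    simpa using this
  have h2 := hproj.hausdorffMeasure_image_le (by norm_num : (0 : ℝ) ≤ 3) (sphere (0 : E4) 1)
  have h3 : 0 < (volume : Measure (Fin 3 → ℝ)) (Metric.ball 0 (1 / 2)) :=
    Metric.measure_ball_pos _ _ (by norm_num)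
  rw [h1] at h2
  simpa using h3.trans_le ((measure_mono hsub).trans h2)

theorem nuS_univ : nuS univ = (μH[(3 : ℝ)] : Measure E4) (sphere 0 1) := by
  have : muS univ = nuS univ := by
    rw [← map_val_nuS, Measure.map_apply measurable_subtype_coe MeasurableSet.univ, preimage_univ]
  rw [← this, muS, Measure.restrict_apply_univ, S3]

instance : IsFiniteMeasure nuS := ⟨by rw [nuS_univ]; exact hausdorffMeasure_sphere_lt_top⟩

/-- The volume of the unit three-sphere. -/
def volS : ℝ := nuS.real univ

theorem volS_pos : 0 < volS := by
  refine ENNReal.toReal_pos ?_ (measure_ne_top _ _)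
  rw [nuS_univ]; exact hausdorffMeasure_sphere_pos.ne'

theorem integral_const_nuS (c : ℝ) : ∫ _ : Sph, c ∂nuS = volS * c := by
  simp [volS]

theorem Sph.sum_sq (x : Sph) : x.1 0 ^ 2 + x.1 1 ^ 2 + x.1 2 ^ 2 + x.1 3 ^ 2 = 1 := by
  have : ‖x.1‖ ^ 2 = 1 := by rw [mem_sphere_zero_iff_norm.1 x.2]; norm_num
  rwa [EuclideanSpace.real_norm_sq_eq, Fin.sum_univ_four] at this

theorem mem_sphere_of_sum_sq {x : E4} (h : x 0 ^ 2 + x 1 ^ 2 + x 2 ^ 2 + x 3 ^ 2 = 1) :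
    x ∈ sphere (0 : E4) 1 := by
  rw [mem_sphere_zero_iff_norm, ← sq_eq_sq₀ (norm_nonneg _) zero_le_one,
    EuclideanSpace.real_norm_sq_eq, Fin.sum_univ_four, h, one_pow]

/-- Quaternion multiplication in coordinates. -/
def qmul (x q : E4) : E4 :=
  !₂[x 0 * q 0 - x 1 * q 1 - x 2 * q 2 - x 3 * q 3,
    x 0 * q 1 + x 1 * q 0 + x 2 * q 3 - x 3 * q 2,
    x 0 * q 2 - x 1 * q 3 + x 2 * q 0 + x 3 * q 1,
    x 0 * q 3 + x 1 * q 2 - x 2 * q 1 + x 3 * q 0]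

@[simp] theorem qmul_zero' (x q : E4) :
    qmul x q 0 = x 0 * q 0 - x 1 * q 1 - x 2 * q 2 - x 3 * q 3 := rfl
@[simp] theorem qmul_one' (x q : E4) :
    qmul x q 1 = x 0 * q 1 + x 1 * q 0 + x 2 * q 3 - x 3 * q 2 := rfl
@[simp] theorem qmul_two' (x q : E4) :
    qmul x q 2 = x 0 * q 2 - x 1 * q 3 + x 2 * q 0 + x 3 * q 1 := rfl
@[simp] theorem qmul_three' (x q : E4) :
    qmul x q 3 = x 0 * q 3 + x 1 * q 2 - x 2 * q 1 + x 3 * q 0 := rfl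

theorem E4.ext {x y : E4} (h0 : x 0 = y 0) (h1 : x 1 = y 1) (h2 : x 2 = y 2) (h3 : x 3 = y 3) :
    x = y := by
  ext i; fin_cases i <;> assumption

/-- Multiplication of unit quaternions. -/
def qm (x q : Sph) : Sph :=
  ⟨qmul x.1 q.1, mem_sphere_of_sum_sq (by
    have hx := x.sum_sq
    have hq := q.sum_sq
    simp only [qmul_zero', qmul_one', qmul_two', qmul_three']
    linear_combination (x.1 0 ^ 2 + x.1 1 ^ 2 + x.1 2 ^ 2 + x.1 3 ^ 2) * hq + hx)⟩

@[simp] theorem qm_val (x q : Sph) : (qm x q).1 = qmul x.1 q.1 := rfl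

theorem qm_assoc (x p q : Sph) : qm (qm x p) q = qm x (qm p q) := by
  apply Subtype.ext
  apply E4.ext <;> simp <;> ring

/-- The unit quaternion with coordinates summing to one in squares. -/
def qmk (a b c d : ℝ) (h : a ^ 2 + b ^ 2 + c ^ 2 + d ^ 2 = 1) : Sph :=
  ⟨!₂[a, b, c, d], mem_sphere_of_sum_sq (by simpa using h)⟩

@[simp] theorem qmk_val (a b c d : ℝ) (h) : (qmk a b c d h).1 = !₂[a, b, c, d] := rfl

/-- Conjugation of unit quaternions. -/
def qconj (x : Sph) : Sph :=
  qmk (x.1 0) (-x.1 1) (-x.1 2) (-x.1 3) (by have := x.sum_sq; linear_combination this)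

theorem qm_qconj_cancel (x q : Sph) : qm (qm x q) (qconj q) = x := by
  have h := q.sum_sq
  apply Subtype.ext
  apply E4.ext <;> simp [qconj]
  · linear_combination x.1 0 * h
  · linear_combination x.1 1 * h
  · linear_combination x.1 2 * h
  · linear_combination x.1 3 * h

theorem qconj_qconj (q : Sph) : qconj (qconj q) = q := by
  apply Subtype.ext
  apply E4.ext <;> simp [qconj]

theorem qconj_qm_cancel (x q : Sph) : qm (qm x (qconj q)) q = x := by
  simpa [qconj_qconj] using qm_qconj_cancel x (qconj q)

theorem qm_left_cancel (x q : Sph) : qm x (qm (qconj x) q) = q := by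
  have h := x.sum_sq
  apply Subtype.ext
  apply E4.ext <;> simp [qconj]
  · linear_combination q.1 0 * h
  · linear_combination q.1 1 * h
  · linear_combination q.1 2 * h
  · linear_combination q.1 3 * h

theorem Sph.dist_eq (x y : Sph) : dist x y = sqrt ((x.1 0 - y.1 0) ^ 2 + (x.1 1 - y.1 1) ^ 2 +
    (x.1 2 - y.1 2) ^ 2 + (x.1 3 - y.1 3) ^ 2) := by
  rw [Subtype.dist_eq, EuclideanSpace.dist_eq, Fin.sum_univ_four]
  simp [Real.dist_eq, sq_abs]

theorem isometry_qm_right (q : Sph) : Isometry fun x => qm x q := by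
  refine Isometry.of_dist_eq fun x y => ?_
  have h := q.sum_sq
  rw [Sph.dist_eq, Sph.dist_eq]
  congr 1
  simp
  linear_combination ((x.1 0 - y.1 0) ^ 2 + (x.1 1 - y.1 1) ^ 2 +
    (x.1 2 - y.1 2) ^ 2 + (x.1 3 - y.1 3) ^ 2) * h

theorem isometry_qm_left (x : Sph) : Isometry fun q => qm x q := by
  refine Isometry.of_dist_eq fun p q => ?_
  have h := x.sum_sq
  rw [Sph.dist_eq, Sph.dist_eq]
  congr 1
  simp
  linear_combination ((p.1 0 - q.1 0) ^ 2 + (p.1 1 - q.1 1) ^ 2 +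
    (p.1 2 - q.1 2) ^ 2 + (p.1 3 - q.1 3) ^ 2) * h

/-- Right translation as an isometry. -/
def rightIso (q : Sph) : Sph ≃ᵢ Sph :=
  IsometryEquiv.mk' (fun x => qm x q) (fun x => qm x (qconj q)) (fun x => qconj_qm_cancel x q)
    (isometry_qm_right q)

/-- Left translation as an isometry. -/
def leftIso (x : Sph) : Sph ≃ᵢ Sph :=
  IsometryEquiv.mk' (fun q => qm x q) (fun q => qm (qconj x) q) (fun q => qm_left_cancel x q)
    (isometry_qm_left x)

theorem integral_qm_right (q : Sph) (f : Sph → ℝ) :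
    ∫ x, f (qm x q) ∂nuS = ∫ x, f x ∂nuS := integral_comp_isometry (rightIso q) f

theorem integral_qm_left (x : Sph) (f : Sph → ℝ) :
    ∫ q, f (qm x q) ∂nuS = ∫ q, f q ∂nuS := integral_comp_isometry (leftIso x) f

theorem continuous_coord (i : Fin 4) : Continuous fun x : Sph => x.1 i := by
  fun_prop

theorem continuous_sph {α : Type*} [TopologicalSpace α] {f : α → Sph}
    (h : ∀ i, Continuous fun a => (f a).1 i) : Continuous f := by
  refine Continuous.subtype_mk (f := fun a => (f a).1) ?_ _
  exact (PiLp.continuous_toLp 2 _).comp (continuous_pi h)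

theorem continuous_qm : Continuous fun p : Sph × Sph => qm p.1 p.2 := by
  refine continuous_sph fun i => ?_
  fin_cases i <;> simp <;> fun_prop

/-- Unit imaginary quaternions. -/
abbrev U2 : Type := {n : Fin 3 → ℝ // n 0 ^ 2 + n 1 ^ 2 + n 2 ^ 2 = 1}

/-- The one-parameter group `s ↦ cos s + sin s • n`. -/
def qexp (n : U2) (s : ℝ) : Sph :=
  qmk (cos s) (sin s * n.1 0) (sin s * n.1 1) (sin s * n.1 2) (by
    have h1 := n.2
    have h2 := Real.sin_sq_add_cos_sq s
    linear_combination sin s ^ 2 * h1 + h2)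

theorem qexp_val (n : U2) (s : ℝ) : (qexp n s).1 =
    !₂[cos s, sin s * n.1 0, sin s * n.1 1, sin s * n.1 2] := rfl

theorem qexp_add (n : U2) (s t : ℝ) : qm (qexp n s) (qexp n t) = qexp n (s + t) := by
  have h := n.2
  apply Subtype.ext
  apply E4.ext <;> simp [qexp_val, Real.cos_add, Real.sin_add]
  · linear_combination -(sin s * sin t) * h
  all_goals ring

theorem qm_qexp_zero (n : U2) (x : Sph) : qm x (qexp n 0) = x := by
  apply Subtype.ext
  apply E4.ext <;> simp [qexp_val]

theorem qm_qexp_qexp (n : U2) (x : Sph) (s t : ℝ) :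
    qm (qm x (qexp n s)) (qexp n t) = qm x (qexp n (s + t)) := by
  rw [qm_assoc, qexp_add]

theorem Continuous.integrable_nuS {f : Sph → ℝ} (hf : Continuous f) : Integrable f nuS :=
  hf.integrable_of_hasCompactSupport (HasCompactSupport.of_compactSpace f)

theorem integral_add_sph {f g : Sph → ℝ} (hf : Continuous f) (hg : Continuous g) :
    ∫ x, (f x + g x) ∂nuS = ∫ x, f x ∂nuS + ∫ x, g x ∂nuS :=
  integral_add hf.integrable_nuS hg.integrable_nuS

theorem integral_sub_sph {f g : Sph → ℝ} (hf : Continuous f) (hg : Continuous g) :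
    ∫ x, (f x - g x) ∂nuS = ∫ x, f x ∂nuS - ∫ x, g x ∂nuS :=
  integral_sub hf.integrable_nuS hg.integrable_nuS

theorem integral_sum_sph {ι : Type*} (s : Finset ι) {f : ι → Sph → ℝ}
    (hf : ∀ i ∈ s, Continuous (f i)) :
    ∫ x, ∑ i ∈ s, f i x ∂nuS = ∑ i ∈ s, ∫ x, f i x ∂nuS :=
  integral_finsetSum s fun i hi => (hf i hi).integrable_nuS

theorem integral_mono_sph {f g : Sph → ℝ} (hf : Continuous f) (hg : Continuous g)
    (h : ∀ x, f x ≤ g x) : ∫ x, f x ∂nuS ≤ ∫ x, g x ∂nuS :=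
  integral_mono hf.integrable_nuS hg.integrable_nuS h

theorem exists_bound_sph {f : Sph → ℝ} (hf : Continuous f) : ∃ C, 0 ≤ C ∧ ∀ x, |f x| ≤ C := by
  obtain ⟨C, hC⟩ := isCompact_univ.exists_bound_of_continuousOn hf.continuousOn
  exact ⟨max C 0, le_max_right _ _, fun x => (hC x (mem_univ x)).trans (le_max_left _ _)⟩

/-- `F'` is the derivative of `F` along the left invariant field generated by `n`. -/
def FlowDeriv (n : U2) (F F' : Sph → ℝ) : Prop :=
  ∀ x, HasDerivAt (fun s => F (qm x (qexp n s))) (F' x) 0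

theorem FlowDeriv.hasDerivAt {n : U2} {F F' : Sph → ℝ} (h : FlowDeriv n F F') (x : Sph) (s : ℝ) :
    HasDerivAt (fun s => F (qm x (qexp n s))) (F' (qm x (qexp n s))) s := by
  have h1 := h (qm x (qexp n s))
  simp only [qm_qexp_qexp] at h1
  have h2 : HasDerivAt (fun r : ℝ => r - s) 1 s := (hasDerivAt_id s).sub_const s
  have h1' : HasDerivAt (fun r => F (qm x (qexp n (s + r)))) (F' (qm x (qexp n s))) (s - s) := by
    rwa [sub_self]
  have := HasDerivAt.comp (h₂ := fun r => F (qm x (qexp n (s + r)))) (h := fun r => r - s) s h1' h2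
  simpa [Function.comp_def] using this

/-- Derivative of the correlation function along a flow. -/
theorem FlowDeriv.hasDerivAt_integral {n : U2} {F F' u : Sph → ℝ} (h : FlowDeriv n F F')
    (hF : Continuous F) (hF' : Continuous F') (hu : Continuous u) (s : ℝ) :
    HasDerivAt (fun s => ∫ x, F (qm x (qexp n s)) * u x ∂nuS)
      (∫ x, F' (qm x (qexp n s)) * u x ∂nuS) s := by
  obtain ⟨C, hC0, hC⟩ := exists_bound_sph hF'
  obtain ⟨D, hD0, hD⟩ := exists_bound_sph hu
  have hc : ∀ s, Continuous fun x => qm x (qexp n s) := fun s => (isometry_qm_right _).continuous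
  refine (hasDerivAt_integral_of_dominated_loc_of_deriv_le (𝕜 := ℝ) (μ := nuS)
    (F := fun s x => F (qm x (qexp n s)) * u x) (F' := fun s x => F' (qm x (qexp n s)) * u x)
    (x₀ := s) (bound := fun _ => C * D)
    (s := univ) Filter.univ_mem (Filter.Eventually.of_forall fun s => ?_) ?_ ?_ ?_ ?_ ?_).2
  · exact ((hF.comp (hc s)).mul hu).aestronglyMeasurable
  · exact ((hF.comp (hc s)).mul hu).integrable_nuS
  · exact ((hF'.comp (hc s)).mul hu).aestronglyMeasurable
  · refine Filter.Eventually.of_forall fun x r _ => ?_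
    rw [norm_mul]
    exact mul_le_mul (hC _) (hD _) (norm_nonneg _) hC0
  · exact integrable_const _
  · exact Filter.Eventually.of_forall fun x r _ => (h.hasDerivAt x r).mul_const _

theorem FlowDeriv.integral_eq_zero {n : U2} {F F' : Sph → ℝ} (h : FlowDeriv n F F')
    (hF : Continuous F) (hF' : Continuous F') : ∫ x, F' x ∂nuS = 0 := by
  have h1 := h.hasDerivAt_integral hF hF' (u := fun _ => 1) continuous_const 0
  simp only [mul_one, qm_qexp_zero, integral_qm_right] at h1
  exact h1.unique (hasDerivAt_const 0 _)

theorem FlowDeriv.mul {n : U2} {F F' G G' : Sph → ℝ} (h : FlowDeriv n F F')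
    (hG : FlowDeriv n G G') : FlowDeriv n (fun x => F x * G x) fun x => F' x * G x + F x * G' x :=
  fun x => by
    have := HasDerivAt.fun_mul (h x) (hG x)
    simpa only [qm_qexp_zero] using this

theorem FlowDeriv.add {n : U2} {F F' G G' : Sph → ℝ} (h : FlowDeriv n F F')
    (hG : FlowDeriv n G G') : FlowDeriv n (fun x => F x + G x) fun x => F' x + G' x :=
  fun x => (h x).add (hG x)

theorem FlowDeriv.const_mul {n : U2} {F F' : Sph → ℝ} (h : FlowDeriv n F F') (c : ℝ) :
    FlowDeriv n (fun x => c * F x) fun x => c * F' x :=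
  fun x => (h x).const_mul c

theorem FlowDeriv.integral_mul_add {n : U2} {F F' G G' : Sph → ℝ} (h : FlowDeriv n F F')
    (hG : FlowDeriv n G G') (hF : Continuous F) (hF' : Continuous F') (hG1 : Continuous G)
    (hG' : Continuous G') : ∫ x, F' x * G x ∂nuS = - ∫ x, F x * G' x ∂nuS := by
  have := (h.mul hG).integral_eq_zero (by fun_prop) (by fun_prop)
  rw [integral_add_sph (by fun_prop) (by fun_prop)] at this
  linarith

/-- The Euclidean inner product of two points of the sphere. -/
def dot (x y : Sph) : ℝ := x.1 0 * y.1 0 + x.1 1 * y.1 1 + x.1 2 * y.1 2 + x.1 3 * y.1 3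

theorem dot_comm (x y : Sph) : dot x y = dot y x := by unfold dot; ring

theorem dot_self (x : Sph) : dot x x = 1 := by
  have := x.sum_sq
  unfold dot; linear_combination this

theorem dist_sq (x y : Sph) : dist x y ^ 2 = 2 - 2 * dot x y := by
  have h1 := x.sum_sq
  have h2 := y.sum_sq
  rw [Sph.dist_eq, Real.sq_sqrt (by positivity)]
  unfold dot
  linear_combination h1 + h2

theorem dot_le_one (x y : Sph) : dot x y ≤ 1 := by
  nlinarith [dist_sq x y, sq_nonneg (dist x y)]

theorem continuous_dot : Continuous fun p : Sph × Sph => dot p.1 p.2 := by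
  unfold dot; fun_prop

/-- The derivatives of `dot · y` along the three basic left invariant fields. -/
def dj (a : Fin 3) (x y : Sph) : ℝ :=
  ![-x.1 1 * y.1 0 + x.1 0 * y.1 1 + x.1 3 * y.1 2 - x.1 2 * y.1 3,
    -x.1 2 * y.1 0 - x.1 3 * y.1 1 + x.1 0 * y.1 2 + x.1 1 * y.1 3,
    -x.1 3 * y.1 0 + x.1 2 * y.1 1 - x.1 1 * y.1 2 + x.1 0 * y.1 3] a

theorem sum_dj_sq (x y : Sph) : ∑ a, dj a x y ^ 2 = 1 - dot x y ^ 2 := by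
  have h1 := x.sum_sq
  have h2 := y.sum_sq
  simp only [Fin.sum_univ_three, dj, dot]
  simp
  linear_combination (y.1 0 ^ 2 + y.1 1 ^ 2 + y.1 2 ^ 2 + y.1 3 ^ 2) * h1 + h2

theorem continuous_dj (a : Fin 3) : Continuous fun p : Sph × Sph => dj a p.1 p.2 := by
  fin_cases a <;> simp [dj] <;> fun_prop

theorem neg_one_le_dot (x y : Sph) : -1 ≤ dot x y := by
  nlinarith [sum_dj_sq x y, Finset.sum_nonneg fun a (_ : a ∈ Finset.univ) => sq_nonneg (dj a x y)]

/-- The three basic imaginary units. -/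
def ub (a : Fin 3) : U2 := ⟨Pi.single a 1, by fin_cases a <;> simp⟩

theorem dot_flow (n : U2) (x y : Sph) (s : ℝ) :
    dot (qm x (qexp n s)) y = cos s * dot x y + sin s * ∑ a, n.1 a * dj a x y := by
  simp only [dot, qm_val, qmul_zero', qmul_one', qmul_two', qmul_three', dj, Fin.sum_univ_three,
    qexp_val]
  simp
  ring

theorem flowDeriv_dot (n : U2) (y : Sph) :
    FlowDeriv n (fun x => dot x y) fun x => ∑ a, n.1 a * dj a x y := fun x => by
  simp only [dot_flow]
  have := ((hasDerivAt_cos 0).mul_const (dot x y)).fun_add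
    ((hasDerivAt_sin 0).mul_const (∑ a, n.1 a * dj a x y))
  simpa using this

theorem flowDeriv_ub {a : Fin 3} {F : Sph → ℝ} {G : Fin 3 → Sph → ℝ}
    (h : FlowDeriv (ub a) F fun x => ∑ b, (ub a).1 b * G b x) : FlowDeriv (ub a) F (G a) := by
  simpa [ub, Pi.single_apply] using h

theorem dj_flow (a : Fin 3) (x y : Sph) (s : ℝ) :
    dj a (qm x (qexp (ub a) s)) y = cos s * dj a x y - sin s * dot x y := by
  fin_cases a <;>
    simp [dot, dj, ub, qexp_val] <;>
    ring

theorem flowDeriv_dj (a : Fin 3) (y : Sph) :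
    FlowDeriv (ub a) (fun x => dj a x y) fun x => -dot x y := fun x => by
  simp only [dj_flow]
  have := ((hasDerivAt_cos 0).mul_const (dj a x y)).fun_sub
    ((hasDerivAt_sin 0).mul_const (dot x y))
  simpa using this

theorem FlowDeriv.congr {n : U2} {F F' G G' : Sph → ℝ} (h : FlowDeriv n F F')
    (h1 : ∀ x, G x = F x) (h2 : ∀ x, G' x = F' x) : FlowDeriv n G G' := by
  rwa [show G = F from funext h1, show G' = F' from funext h2]

theorem FlowDeriv.mul_const {n : U2} {F F' : Sph → ℝ} (h : FlowDeriv n F F') (c : ℝ) :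
    FlowDeriv n (fun x => F x * c) fun x => F' x * c :=
  fun x => HasDerivAt.mul_const (h x) c

theorem continuous_slice {k : Sph → Sph → ℝ} (hk : Continuous fun p : Sph × Sph => k p.1 p.2)
    (x : Sph) : Continuous fun y => k x y :=
  hk.comp (by fun_prop : Continuous fun y : Sph => (x, y))

theorem FlowDeriv.comp {n : U2} {F F' : Sph → ℝ} (h : FlowDeriv n F F') {g g' : ℝ → ℝ}
    (hg : ∀ x, HasDerivAt g (g' (F x)) (F x)) :
    FlowDeriv n (fun x => g (F x)) fun x => g' (F x) * F' x := fun x => by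
  have h1 : HasDerivAt g (g' (F x)) (F (qm x (qexp n 0))) := by
    rw [qm_qexp_zero]; exact hg x
  exact HasDerivAt.comp (h₂ := g) (h := fun s => F (qm x (qexp n s))) 0 h1 (h x)

theorem continuous_integral_kernel {k : Sph → Sph → ℝ}
    (hk : Continuous fun p : Sph × Sph => k p.1 p.2) :
    Continuous fun x => ∫ y, k x y ∂nuS := by
  obtain ⟨C, hC⟩ := isCompact_univ.exists_bound_of_continuousOn hk.continuousOn
  refine continuous_of_dominated (bound := fun _ => C) (fun x => ?_) (fun x => ?_)
    (integrable_const C) ?_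
  · exact (hk.comp (by fun_prop : Continuous fun y => (x, y))).aestronglyMeasurable
  · exact Filter.Eventually.of_forall fun y => hC (x, y) (mem_univ _)
  · exact Filter.Eventually.of_forall fun y => hk.comp (by fun_prop : Continuous fun x => (x, y))

theorem FlowDeriv.integral_kernel {n : U2} {k k' : Sph → Sph → ℝ}
    (hk : Continuous fun p : Sph × Sph => k p.1 p.2)
    (hk' : Continuous fun p : Sph × Sph => k' p.1 p.2)
    (h : ∀ y, FlowDeriv n (fun x => k x y) fun x => k' x y) :
    FlowDeriv n (fun x => ∫ y, k x y ∂nuS) fun x => ∫ y, k' x y ∂nuS := fun x => by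
  obtain ⟨C, hC⟩ := isCompact_univ.exists_bound_of_continuousOn hk'.continuousOn
  have hc : ∀ x : Sph, Continuous fun y : Sph => (x, y) := fun x => by fun_prop
  have := (hasDerivAt_integral_of_dominated_loc_of_deriv_le (𝕜 := ℝ) (μ := nuS)
    (F := fun s y => k (qm x (qexp n s)) y) (F' := fun s y => k' (qm x (qexp n s)) y)
    (x₀ := 0) (bound := fun _ => C) (s := univ) Filter.univ_mem
    (Filter.Eventually.of_forall fun s => (hk.comp (hc _)).aestronglyMeasurable)
    (hk.comp (hc _)).integrable_nuS (hk'.comp (hc _)).aestronglyMeasurable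
    (Filter.Eventually.of_forall fun y s _ => hC (_, y) (mem_univ _)) (integrable_const _)
    (Filter.Eventually.of_forall fun y s _ => (h y).hasDerivAt x s)).2
  simpa only [qm_qexp_zero] using this

/-- `F` is twice continuously differentiable along the flows, with gradient `G` and
Laplacian `L`. -/
structure IsC2 (F : Sph → ℝ) (G : Fin 3 → Sph → ℝ) (L : Sph → ℝ) : Prop where
  cont : Continuous F
  contG : ∀ a, Continuous (G a)
  contL : Continuous L
  grad : ∀ n : U2, FlowDeriv n F fun x => ∑ a, n.1 a * G a x
  lap : ∃ H : Fin 3 → Sph → ℝ, (∀ a, Continuous (H a)) ∧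
    (∀ a, FlowDeriv (ub a) (G a) (H a)) ∧ ∀ x, L x = ∑ a, H a x

theorem IsC2.add {F₁ F₂ L₁ L₂ : Sph → ℝ} {G₁ G₂ : Fin 3 → Sph → ℝ} (h₁ : IsC2 F₁ G₁ L₁)
    (h₂ : IsC2 F₂ G₂ L₂) :
    IsC2 (fun x => F₁ x + F₂ x) (fun a x => G₁ a x + G₂ a x) fun x => L₁ x + L₂ x := by
  obtain ⟨H₁, a₁, b₁, c₁⟩ := h₁.lap
  obtain ⟨H₂, a₂, b₂, c₂⟩ := h₂.lap
  refine ⟨h₁.cont.add h₂.cont, fun a => (h₁.contG a).add (h₂.contG a), h₁.contL.add h₂.contL,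
    fun n => ?_, fun a x => H₁ a x + H₂ a x, fun a => (a₁ a).add (a₂ a),
    fun a => (b₁ a).add (b₂ a), fun x => ?_⟩
  · simpa only [mul_add, Finset.sum_add_distrib] using (h₁.grad n).add (h₂.grad n)
  · rw [c₁, c₂, Finset.sum_add_distrib]

theorem IsC2.const_mul {F L : Sph → ℝ} {G : Fin 3 → Sph → ℝ} (h : IsC2 F G L) (c : ℝ) :
    IsC2 (fun x => c * F x) (fun a x => c * G a x) fun x => c * L x := by
  obtain ⟨H₁, a₁, b₁, c₁⟩ := h.lap
  refine ⟨h.cont.const_mul c, fun a => (h.contG a).const_mul c, h.contL.const_mul c,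
    fun n => ?_, fun a x => c * H₁ a x, fun a => (a₁ a).const_mul c,
    fun a => (b₁ a).const_mul c, fun x => ?_⟩
  · simpa only [mul_left_comm, Finset.mul_sum] using (h.grad n).const_mul c
  · rw [c₁, Finset.mul_sum]

theorem IsC2.integral_lap_mul {F L u Lu : Sph → ℝ} {G Gu : Fin 3 → Sph → ℝ} (h : IsC2 F G L)
    (hu : IsC2 u Gu Lu) : ∫ x, L x * u x ∂nuS = - ∫ x, ∑ a, G a x * Gu a x ∂nuS := by
  obtain ⟨H, hH, hd, hs⟩ := h.lap
  have hG := h.contG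
  have hGu := hu.contG
  have hcu := hu.cont
  simp only [hs, Finset.sum_mul]
  rw [integral_sum_sph _ fun a _ => by have := hH a; fun_prop,
    integral_sum_sph _ fun a _ => by have := hG a; have := hGu a; fun_prop,
    ← Finset.sum_neg_distrib]
  exact Finset.sum_congr rfl fun a _ =>
    (hd a).integral_mul_add (flowDeriv_ub (hu.grad (ub a))) (hG a) (hH a) hcu (hGu a)

theorem IsC2.integral_lap_mul_comm {F L u Lu : Sph → ℝ} {G Gu : Fin 3 → Sph → ℝ} (h : IsC2 F G L)
    (hu : IsC2 u Gu Lu) : ∫ x, L x * u x ∂nuS = ∫ x, F x * Lu x ∂nuS := by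
  have h1 := h.integral_lap_mul hu
  have h2 := hu.integral_lap_mul h
  simp only [mul_comm] at h1 h2 ⊢
  rw [h1, h2]

/-- The potential of `f` with kernel `(T - 2 x ⬝ y) ^ a`. -/
def psi (T a : ℝ) (f : Sph → ℝ) (x : Sph) : ℝ := ∫ y, (T - 2 * dot x y) ^ a * f y ∂nuS

theorem kernel_pos {T : ℝ} (hT : 2 < T) (x y : Sph) : 0 < T - 2 * dot x y := by
  linarith [dot_le_one x y]

theorem continuous_kernel {T : ℝ} (hT : 2 < T) (a : ℝ) :
    Continuous fun p : Sph × Sph => (T - 2 * dot p.1 p.2) ^ a :=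
  (continuous_const.sub (continuous_dot.const_mul 2)).rpow_const
    fun p => Or.inl (kernel_pos hT p.1 p.2).ne'

theorem continuous_psi {T : ℝ} (hT : 2 < T) (a : ℝ) {f : Sph → ℝ} (hf : Continuous f) :
    Continuous (psi T a f) :=
  continuous_integral_kernel ((continuous_kernel hT a).mul (hf.comp continuous_snd))

theorem isC2_psi {T : ℝ} (hT : 2 < T) (a : ℝ) {f : Sph → ℝ} (hf : Continuous f) :
    IsC2 (psi T a f)
      (fun b x => ∫ y, -2 * a * (T - 2 * dot x y) ^ (a - 1) * dj b x y * f y ∂nuS)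
      fun x => -a * (a + 2) * psi T a f x + a * (2 * a + 1) * T * psi T (a - 1) f x
        - a * (a - 1) * (T ^ 2 - 4) * psi T (a - 2) f x := by
  have hfs : Continuous fun p : Sph × Sph => f p.2 := hf.comp continuous_snd
  have hk := fun a => continuous_kernel hT a
  have hdj := continuous_dj
  have hdot := continuous_dot
  have hkd : ∀ a (n : U2) y, FlowDeriv n (fun x => (T - 2 * dot x y) ^ a)
      fun x => -2 * a * (T - 2 * dot x y) ^ (a - 1) * ∑ b, n.1 b * dj b x y := by
    intro a n y
    refine (flowDeriv_dot n y).comp (g := fun t => (T - 2 * t) ^ a)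
      (g' := fun t => -2 * a * (T - 2 * t) ^ (a - 1)) fun x => ?_
    have h1 : HasDerivAt (fun t : ℝ => T - 2 * t) (-2) (dot x y) := by
      simpa using ((hasDerivAt_id (dot x y)).const_mul 2).const_sub T
    convert h1.rpow_const (p := a) (Or.inl (kernel_pos hT x y).ne') using 1
  have hG : ∀ b, Continuous fun p : Sph × Sph =>
      -2 * a * (T - 2 * dot p.1 p.2) ^ (a - 1) * dj b p.1 p.2 * f p.2 := fun b => by
    have := hk (a - 1); have := hdj b; fun_prop
  have hH : ∀ b, Continuous fun p : Sph × Sph =>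
      (4 * a * (a - 1) * (T - 2 * dot p.1 p.2) ^ (a - 2) * dj b p.1 p.2 ^ 2 +
        2 * a * (T - 2 * dot p.1 p.2) ^ (a - 1) * dot p.1 p.2) * f p.2 := fun b => by
    have := hk (a - 1); have := hk (a - 2); have := hdj b; fun_prop
  refine ⟨continuous_psi hT a hf, fun b => continuous_integral_kernel (hG b), ?_, fun n => ?_,
    fun b x => ∫ y, (4 * a * (a - 1) * (T - 2 * dot x y) ^ (a - 2) * dj b x y ^ 2 +
        2 * a * (T - 2 * dot x y) ^ (a - 1) * dot x y) * f y ∂nuS,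
    fun b => continuous_integral_kernel (hH b), fun b => ?_, fun x => ?_⟩
  · have := continuous_psi hT a hf
    have := continuous_psi hT (a - 1) hf
    have := continuous_psi hT (a - 2) hf
    fun_prop
  · have h1 := FlowDeriv.integral_kernel (n := n) (k := fun x y => (T - 2 * dot x y) ^ a * f y)
      (k' := fun x y => ∑ b, n.1 b * (-2 * a * (T - 2 * dot x y) ^ (a - 1) * dj b x y * f y))
      (by have := hk a; fun_prop)
      (continuous_finsetSum _ fun b _ => (hG b).const_mul _)
      (fun y => ((hkd a n y).mul_const (f y)).congr (fun _ => rfl) fun x => by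
        rw [Finset.mul_sum, Finset.sum_mul]
        exact Finset.sum_congr rfl fun b _ => by ring)
    refine h1.congr (fun _ => rfl) fun x => ?_
    rw [integral_sum_sph _ fun b _ => (continuous_slice (k := fun x y =>
      -2 * a * (T - 2 * dot x y) ^ (a - 1) * dj b x y * f y) (hG b) x).const_mul _]
    exact Finset.sum_congr rfl fun b _ => (integral_const_mul _ _).symm
  · refine FlowDeriv.integral_kernel (hG b) (hH b) fun y => ?_
    have h1 := flowDeriv_ub
      (G := fun b x => -2 * (a - 1) * (T - 2 * dot x y) ^ (a - 1 - 1) * dj b x y)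
      (a := b) (by simpa only [Finset.mul_sum, mul_left_comm] using hkd (a - 1) (ub b) y)
    have h2 := ((h1.mul (flowDeriv_dj b y)).const_mul (-2 * a))
    refine (h2.mul_const (f y)).congr (fun x => by ring) fun x => ?_
    rw [show a - 1 - 1 = a - 2 by ring]; ring
  · simp only [psi]
    rw [← integral_sum_sph _ fun b _ => continuous_slice (k := fun x y =>
      (4 * a * (a - 1) * (T - 2 * dot x y) ^ (a - 2) * dj b x y ^ 2 +
        2 * a * (T - 2 * dot x y) ^ (a - 1) * dot x y) * f y) (hH b) x]
    have hk' : ∀ e : ℝ, Continuous fun y => (T - 2 * dot x y) ^ e * f y :=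
      fun e => continuous_slice (k := fun x y => (T - 2 * dot x y) ^ e * f y) ((hk e).mul hfs) x
    have h1 := (hk' a).const_mul (-a * (a + 2))
    have h2 := (hk' (a - 1)).const_mul (a * (2 * a + 1) * T)
    have h3 := (hk' (a - 2)).const_mul (a * (a - 1) * (T ^ 2 - 4))
    have key : ∀ y, (-a * (a + 2) * ((T - 2 * dot x y) ^ a * f y) +
        a * (2 * a + 1) * T * ((T - 2 * dot x y) ^ (a - 1) * f y)) -
        a * (a - 1) * (T ^ 2 - 4) * ((T - 2 * dot x y) ^ (a - 2) * f y) =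
        ∑ b, (4 * a * (a - 1) * (T - 2 * dot x y) ^ (a - 2) * dj b x y ^ 2 +
        2 * a * (T - 2 * dot x y) ^ (a - 1) * dot x y) * f y := by
      intro y
      have hp := kernel_pos hT x y
      have e1 : (T - 2 * dot x y) ^ (a - 1) = (T - 2 * dot x y) ^ (a - 2) * (T - 2 * dot x y) := by
        rw [← Real.rpow_add_one hp.ne']; congr 1; ring
      have e2 : (T - 2 * dot x y) ^ a = (T - 2 * dot x y) ^ (a - 2) * (T - 2 * dot x y) ^ 2 := by
        rw [← Real.rpow_natCast, ← Real.rpow_add hp]; congr 1; push_cast; ring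
      have e3 : dj 0 x y ^ 2 + dj 1 x y ^ 2 + dj 2 x y ^ 2 = 1 - dot x y ^ 2 := by
        rw [← sum_dj_sq, Fin.sum_univ_three]
      simp only [Fin.sum_univ_three]
      rw [e1, e2]
      linear_combination -(4 * a * (a - 1) * (T - 2 * dot x y) ^ (a - 2) * f y) * e3
    rw [← integral_congr_ae (Filter.Eventually.of_forall key), integral_sub_sph (h1.fun_add h2) h3,
      integral_add_sph h1 h2, integral_const_mul, integral_const_mul, integral_const_mul]

@[fun_prop]
theorem Continuous.qm {α : Type*} [TopologicalSpace α] {f g : α → Sph} (hf : Continuous f)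
    (hg : Continuous g) : Continuous fun a => qm (f a) (g a) :=
  continuous_qm.comp (hf.prodMk hg)

@[fun_prop]
theorem Continuous.dot {α : Type*} [TopologicalSpace α] {f g : α → Sph} (hf : Continuous f)
    (hg : Continuous g) : Continuous fun a => dot (f a) (g a) :=
  continuous_dot.comp (hf.prodMk hg)

theorem integrable_prod_sph {k : Sph × Sph → ℝ} (hk : Continuous k) :
    Integrable k (nuS.prod nuS) :=
  hk.integrable_of_hasCompactSupport (HasCompactSupport.of_compactSpace k)

theorem integral_swap_sph {k : Sph → Sph → ℝ} (hk : Continuous fun p : Sph × Sph => k p.1 p.2) :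
    ∫ x, ∫ y, k x y ∂nuS ∂nuS = ∫ y, ∫ x, k x y ∂nuS ∂nuS :=
  integral_integral_swap (integrable_prod_sph (k := Function.uncurry k) hk)

theorem FlowDeriv.integral_mul_self {n : U2} {F F' : Sph → ℝ} (h : FlowDeriv n F F')
    (hF : Continuous F) (hF' : Continuous F') : ∫ x, F' x * F x ∂nuS = 0 := by
  have h1 := h.integral_mul_add h hF hF' hF hF'
  have h2 : ∫ x, F x * F' x ∂nuS = ∫ x, F' x * F x ∂nuS := by simp only [mul_comm]
  linarith

/-- Lower bound for the autocorrelation of a function along a flow. -/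
theorem FlowDeriv.le_correlation {n : U2} {F F' : Sph → ℝ} (h : FlowDeriv n F F')
    (hF : Continuous F) (hF' : Continuous F') {s : ℝ} (hs : 0 ≤ s) :
    ∫ x, F x ^ 2 ∂nuS - s ^ 2 / 2 * ∫ x, F' x ^ 2 ∂nuS ≤
      ∫ x, F (qm x (qexp n s)) * F x ∂nuS := by
  set b := ∫ x, F' x ^ 2 ∂nuS with hb
  set g := fun s => ∫ x, F (qm x (qexp n s)) * F x ∂nuS with hg
  set g1 := fun s => ∫ x, F' (qm x (qexp n s)) * F x ∂nuS with hg1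
  set g2 := fun s => ∫ x, F' (qm x (qexp n (-s))) * F' x ∂nuS with hg2
  have d1 : ∀ s, HasDerivAt g (g1 s) s := fun s => h.hasDerivAt_integral hF hF' hF s
  have e1 : ∀ s, g1 s = ∫ x, F (qm x (qexp n (-s))) * F' x ∂nuS := by
    intro s
    simp only [hg1]
    rw [← integral_qm_right (qexp n (-s))]
    refine integral_congr_ae (Filter.Eventually.of_forall fun x => ?_)
    simp only [qm_qexp_qexp]
    rw [neg_add_cancel, qm_qexp_zero, mul_comm]
  have d2 : ∀ s, HasDerivAt g1 (-g2 s) s := by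
    intro s
    have h1 := h.hasDerivAt_integral hF hF' hF' (-s)
    have h2 : HasDerivAt (fun r : ℝ => -r) (-1) s := (hasDerivAt_id s).neg
    have := HasDerivAt.comp (h₂ := fun s => ∫ x, F (qm x (qexp n s)) * F' x ∂nuS)
      (h := fun r : ℝ => -r) s h1 h2
    rw [show g1 = _ from funext e1]
    simpa [Function.comp_def] using this
  have b2 : ∀ s, g2 s ≤ b := by
    intro s
    have h1 : g2 s ≤ ∫ x, (1 / 2 * F' (qm x (qexp n (-s))) ^ 2 + 1 / 2 * F' x ^ 2) ∂nuS :=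
      integral_mono_sph (by fun_prop) (by fun_prop) fun x => by
        nlinarith [sq_nonneg (F' (qm x (qexp n (-s))) - F' x)]
    rw [integral_add_sph (by fun_prop) (by fun_prop), integral_const_mul, integral_const_mul,
      integral_qm_right _ fun x => F' x ^ 2] at h1
    linarith
  have m1 : Monotone fun s => g1 s + b * s := by
    have hd : ∀ s, HasDerivAt (fun s => g1 s + b * s) (-g2 s + b) s := fun s => by
      simpa using (d2 s).fun_add ((hasDerivAt_id s).const_mul b)
    refine monotone_of_deriv_nonneg (fun s => (hd s).differentiableAt) fun s => ?_
    rw [(hd s).deriv]; linarith [b2 s]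
  have z1 : g1 0 = 0 := by
    simp only [hg1, qm_qexp_zero]
    exact h.integral_mul_self hF hF'
  have hd : ∀ s, HasDerivAt (fun s => g s + b * s ^ 2 / 2) (g1 s + b * s) s := fun s => by
    have h2 : HasDerivAt (fun s : ℝ => b * s ^ 2 / 2) (b * s) s := by
      refine (((hasDerivAt_pow 2 s).const_mul b).div_const 2).congr_deriv ?_
      push_cast; ring
    exact (d1 s).fun_add h2
  have m2 : MonotoneOn (fun s => g s + b * s ^ 2 / 2) (Ici 0) := by
    refine monotoneOn_of_deriv_nonneg (convex_Ici 0)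
      (fun s _ => (hd s).continuousAt.continuousWithinAt)
      (fun s _ => (hd s).differentiableAt.differentiableWithinAt) fun s hs => ?_
    rw [(hd s).deriv]
    rw [interior_Ici] at hs
    have := m1 (le_of_lt hs : (0 : ℝ) ≤ s)
    simp only [z1] at this
    linarith
  have := m2 (mem_Ici.2 le_rfl) (mem_Ici.2 hs) hs
  have z2 : g 0 = ∫ x, F x ^ 2 ∂nuS := by
    simp only [hg, qm_qexp_zero]
    exact integral_congr_ae (Filter.Eventually.of_forall fun x => by ring)
  simp only [z2] at this
  linarith

/-- Conjugation by a unit quaternion preserves integrals. -/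
theorem integral_qm_conj (p : Sph) (f : Sph → ℝ) :
    ∫ q, f (qm (qm p q) (qconj p)) ∂nuS = ∫ q, f q ∂nuS := by
  rw [integral_qm_left p fun q => f (qm q (qconj p)), integral_qm_right]

theorem integral_coord_sq (i : Fin 4) : ∫ q : Sph, q.1 i ^ 2 ∂nuS = volS / 4 := by
  have e1 : ∫ q : Sph, q.1 1 ^ 2 ∂nuS = ∫ q : Sph, q.1 0 ^ 2 ∂nuS := by
    rw [← integral_qm_right (qmk 0 1 0 0 (by norm_num)) fun q => q.1 0 ^ 2]; simp
  have e2 : ∫ q : Sph, q.1 2 ^ 2 ∂nuS = ∫ q : Sph, q.1 0 ^ 2 ∂nuS := by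
    rw [← integral_qm_right (qmk 0 0 1 0 (by norm_num)) fun q => q.1 0 ^ 2]; simp
  have e3 : ∫ q : Sph, q.1 3 ^ 2 ∂nuS = ∫ q : Sph, q.1 0 ^ 2 ∂nuS := by
    rw [← integral_qm_right (qmk 0 0 0 1 (by norm_num)) fun q => q.1 0 ^ 2]; simp
  have hs : ∫ q : Sph, (q.1 0 ^ 2 + q.1 1 ^ 2 + q.1 2 ^ 2 + q.1 3 ^ 2) ∂nuS = volS := by
    simp only [Sph.sum_sq, integral_const_nuS, mul_one]
  rw [integral_add_sph (by fun_prop) (by fun_prop), integral_add_sph (by fun_prop) (by fun_prop),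
    integral_add_sph (by fun_prop) (by fun_prop), e1, e2, e3] at hs
  fin_cases i <;> simp <;> linarith

theorem abs_arcsin_le {t : ℝ} (h1 : -1 ≤ t) (h2 : t ≤ 1) : |arcsin t| ≤ π / 2 * |t| := by
  have h3 : sin |arcsin t| = |t| := by
    rcases le_total 0 t with h | h
    · rw [abs_of_nonneg h, abs_of_nonneg (arcsin_nonneg.2 h), sin_arcsin h1 h2]
    · rw [abs_of_nonpos h, abs_of_nonpos (arcsin_nonpos.2 h), sin_neg, sin_arcsin h1 h2]
  have h4 := Real.mul_le_sin (abs_nonneg (arcsin t))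
    (abs_le.2 ⟨neg_pi_div_two_le_arcsin t, arcsin_le_pi_div_two t⟩)
  rw [h3] at h4
  have hp := Real.pi_pos
  calc |arcsin t| = π / 2 * (2 / π * |arcsin t|) := by field_simp
    _ ≤ _ := by gcongr

theorem Sph.coord_mem (q : Sph) (i : Fin 4) : -1 ≤ q.1 i ∧ q.1 i ≤ 1 := by
  have h := q.sum_sq
  rw [← Fin.sum_univ_four fun i => q.1 i ^ 2] at h
  rw [← abs_le, ← sq_le_one_iff_abs_le_one]
  refine le_trans ?_ h.le
  exact Finset.single_le_sum (f := fun i => q.1 i ^ 2) (fun _ _ => sq_nonneg _) (Finset.mem_univ i)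

theorem integral_arccos_sq_le :
    ∫ q : Sph, arccos (q.1 0) ^ 2 ∂nuS ≤ 5 * π ^ 2 / 16 * volS := by
  have hc : Continuous fun q : Sph => arccos (q.1 0) := continuous_arccos.comp (continuous_coord 0)
  have e1 : ∫ q : Sph, (π - arccos (q.1 0)) ^ 2 ∂nuS = ∫ q : Sph, arccos (q.1 0) ^ 2 ∂nuS := by
    rw [← integral_qm_right (qmk (-1) 0 0 0 (by norm_num)) fun q => arccos (q.1 0) ^ 2]
    simp [arccos_neg]
  have e2 : ∫ q : Sph, (arccos (q.1 0) ^ 2 + (π - arccos (q.1 0)) ^ 2) ∂nuS ≤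
      ∫ q : Sph, (π ^ 2 / 2 + π ^ 2 / 2 * q.1 0 ^ 2) ∂nuS := by
    refine integral_mono_sph (by fun_prop) (by fun_prop) fun q => ?_
    obtain ⟨h1, h2⟩ := q.coord_mem 0
    have h3 := abs_arcsin_le h1 h2
    have h4 : arcsin (q.1 0) ^ 2 ≤ (π / 2 * |q.1 0|) ^ 2 := by
      rw [← sq_abs]; gcongr
    rw [mul_pow, sq_abs] at h4
    rw [arccos]
    nlinarith
  rw [integral_add_sph (by fun_prop) (by fun_prop), e1,
    integral_add_sph (by fun_prop) (by fun_prop),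
    integral_const_mul, integral_coord_sq, integral_const_nuS] at e2
  linarith

/-- The tensor `θ² n ⊗ n` in terms of `q = cos θ + sin θ n`. -/
def angTensor (a b : Fin 3) (q : Sph) : ℝ :=
  arccos (q.1 0) ^ 2 / (1 - q.1 0 ^ 2) * (q.1 a.succ * q.1 b.succ)

theorem sum_succ_sq (q : Sph) : ∑ a : Fin 3, q.1 a.succ ^ 2 = 1 - q.1 0 ^ 2 := by
  have := q.sum_sq
  rw [Fin.sum_univ_three]
  simp [Fin.succ_zero_eq_one, Fin.succ_one_eq_two]
  linarith

theorem integrable_angTensor (a b : Fin 3) : Integrable (angTensor a b) nuS := by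
  have hm : Measurable (angTensor a b) := by
    unfold angTensor
    have : ∀ i, Measurable fun q : Sph => q.1 i := fun i => (continuous_coord i).measurable
    have h0 := this 0
    have h1 := this a.succ
    have h2 := this b.succ
    have h3 : Measurable fun q : Sph => arccos (q.1 0) :=
      (continuous_arccos.comp (continuous_coord 0)).measurable
    fun_prop
  refine Integrable.of_bound hm.aestronglyMeasurable (π ^ 2)
    (Filter.Eventually.of_forall fun q => ?_)
  have hs := sum_succ_sq q
  have hle : ∀ a : Fin 3, q.1 a.succ ^ 2 ≤ 1 - q.1 0 ^ 2 := fun a => by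
    rw [← hs]
    exact Finset.single_le_sum (f := fun a : Fin 3 => q.1 a.succ ^ 2) (fun _ _ => sq_nonneg _)
      (Finset.mem_univ a)
  have h0 : 0 ≤ 1 - q.1 0 ^ 2 := (sq_nonneg _).trans (hle 0)
  have hab : |q.1 a.succ * q.1 b.succ| ≤ 1 - q.1 0 ^ 2 := by
    rw [abs_mul]
    nlinarith [hle a, hle b, sq_abs (q.1 a.succ), sq_abs (q.1 b.succ),
      sq_nonneg (|q.1 a.succ| - |q.1 b.succ|)]
  rw [angTensor, Real.norm_eq_abs, abs_mul, abs_of_nonneg (by positivity)]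
  have ht : arccos (q.1 0) ^ 2 ≤ π ^ 2 := by
    have := arccos_le_pi (q.1 0); have := arccos_nonneg (q.1 0); gcongr
  rcases h0.eq_or_lt with h | h
  · rw [← h]; simp; positivity
  · calc _ ≤ arccos (q.1 0) ^ 2 / (1 - q.1 0 ^ 2) * (1 - q.1 0 ^ 2) := by gcongr
      _ = arccos (q.1 0) ^ 2 := by field_simp
      _ ≤ _ := ht

theorem ae_sq_lt_one : ∀ᵐ q ∂nuS, 0 < 1 - q.1 0 ^ 2 := by
  have h : ∀ᵐ q ∂nuS, q ∉ ({qmk 1 0 0 0 (by norm_num), qmk (-1) 0 0 0 (by norm_num)} : Set Sph) :=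
    measure_eq_zero_iff_ae_notMem.1 ((Set.toFinite _).measure_zero nuS)
  filter_upwards [h] with q hq
  have hs := sum_succ_sq q
  refine lt_of_le_of_ne (hs ▸ Finset.sum_nonneg fun _ _ => sq_nonneg _) fun h0 => hq ?_
  rw [← h0, Finset.sum_eq_zero_iff_of_nonneg fun _ _ => sq_nonneg _] at hs
  have h1 : q.1 1 = 0 := by simpa using hs 0 (Finset.mem_univ _)
  have h2 : q.1 2 = 0 := by simpa using hs 1 (Finset.mem_univ _)
  have h3 : q.1 3 = 0 := by simpa using hs 2 (Finset.mem_univ _)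
  have h4 : q.1 0 ^ 2 = 1 := by linarith
  rcases mul_eq_zero.1 (show (q.1 0 - 1) * (q.1 0 + 1) = 0 by linear_combination h4) with h | h
  · left; apply Subtype.ext; apply E4.ext <;> simp [h1, h2, h3, sub_eq_zero.1 h]
  · right; apply Subtype.ext; apply E4.ext <;> simp [h1, h2, h3, eq_neg_of_add_eq_zero_left h]

theorem integral_angTensor_of_ne {a b : Fin 3} (hab : a ≠ b) :
    ∫ q, angTensor a b q ∂nuS = 0 := by
  have key : ∀ p : Sph, (∀ q, angTensor a b (qm (qm p q) (qconj p)) = -angTensor a b q) →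
      ∫ q, angTensor a b q ∂nuS = 0 := fun p hp => by
    have h := integral_qm_conj p (angTensor a b)
    simp only [hp, integral_neg] at h
    linarith
  by_cases h : a = 0 ∨ b = 0
  · refine key (qmk 0 1 0 0 (by norm_num)) fun q => ?_
    fin_cases a <;> fin_cases b <;> simp [angTensor, qconj] at hab h ⊢
  · refine key (qmk 0 0 1 0 (by norm_num)) fun q => ?_
    fin_cases a <;> fin_cases b <;> simp [angTensor, qconj] at hab h ⊢

theorem integral_angTensor_self (a : Fin 3) :
    ∫ q, angTensor a a q ∂nuS = (∫ q : Sph, arccos (q.1 0) ^ 2 ∂nuS) / 3 := by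
  have e0 : ∀ q : Sph, (qm (qm (qmk (1/2) (1/2) (1/2) (1/2) (by norm_num)) q)
      (qconj (qmk (1/2) (1/2) (1/2) (1/2) (by norm_num)))).1 = !₂[q.1 0, q.1 3, q.1 1, q.1 2] := by
    intro q
    apply E4.ext <;> simp [qconj] <;> ring
  have e1 : ∫ q, angTensor 0 0 q ∂nuS = ∫ q, angTensor 2 2 q ∂nuS := by
    rw [← integral_qm_conj (qmk (1/2) (1/2) (1/2) (1/2) (by norm_num))]
    simp only [angTensor, e0]; rfl
  have e2 : ∫ q, angTensor 1 1 q ∂nuS = ∫ q, angTensor 0 0 q ∂nuS := by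
    rw [← integral_qm_conj (qmk (1/2) (1/2) (1/2) (1/2) (by norm_num))]
    simp only [angTensor, e0]; rfl
  have e3 : ∫ q, ∑ a, angTensor a a q ∂nuS = ∫ q : Sph, arccos (q.1 0) ^ 2 ∂nuS := by
    refine integral_congr_ae ?_
    filter_upwards [ae_sq_lt_one] with q hq
    simp only [angTensor]
    rw [← Finset.mul_sum]
    simp only [← pow_two]
    rw [sum_succ_sq]
    field_simp
  rw [integral_finsetSum _ fun a _ => integrable_angTensor a a, Fin.sum_univ_three] at e3
  fin_cases a <;> simp <;> linarith

theorem exists_qexp {q : Sph} (hq : 0 < 1 - q.1 0 ^ 2) :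
    ∃ n : U2, qexp n (arccos (q.1 0)) = q ∧ ∀ a, n.1 a = q.1 a.succ / sqrt (1 - q.1 0 ^ 2) := by
  have hs := sum_succ_sq q
  have hr : 0 < sqrt (1 - q.1 0 ^ 2) := Real.sqrt_pos.2 hq
  rw [Fin.sum_univ_three] at hs
  refine ⟨⟨fun a => q.1 a.succ / sqrt (1 - q.1 0 ^ 2), ?_⟩, ?_, fun a => rfl⟩
  · simp only [div_pow, Real.sq_sqrt hq.le]
    rw [← add_div, ← add_div, hs, div_self hq.ne']
  · obtain ⟨h1, h2⟩ := q.coord_mem 0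
    apply Subtype.ext
    apply E4.ext <;> simp only [qexp_val, sin_arccos]
    · simp [cos_arccos h1 h2]
    · simp; field_simp
    · simp; field_simp
    · simp; field_simp

/-- A Poincaré inequality on the sphere (the optimal constant would be `3`). -/
theorem poincare {F : Sph → ℝ} {G : Fin 3 → Sph → ℝ} (hF : Continuous F)
    (hG : ∀ a, Continuous (G a)) (h : ∀ n : U2, FlowDeriv n F fun x => ∑ a, n.1 a * G a x)
    (h0 : ∫ x, F x ∂nuS = 0) :
    5 / 4 * ∫ x, F x ^ 2 ∂nuS ≤ ∫ x, ∑ a, G a x ^ 2 ∂nuS := by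
  set A := ∫ x, F x ^ 2 ∂nuS
  set B : Fin 3 → Fin 3 → ℝ := fun a b => ∫ x, G a x * G b x ∂nuS with hB
  have hpt : ∀ᵐ q ∂nuS, A - 1 / 2 * ∑ a, ∑ b, B a b * angTensor a b q ≤
      ∫ x, F (qm x q) * F x ∂nuS := by
    filter_upwards [ae_sq_lt_one] with q hq
    obtain ⟨n, hn, hna⟩ := exists_qexp hq
    have h1 := (h n).le_correlation hF (by fun_prop) (arccos_nonneg (q.1 0))
    rw [hn] at h1
    refine le_trans (le_of_eq ?_) h1
    have h2 : ∫ x, (∑ a, n.1 a * G a x) ^ 2 ∂nuS = ∑ a, ∑ b, n.1 a * n.1 b * B a b := by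
      simp only [sq, Finset.sum_mul_sum]
      rw [integral_sum_sph _ fun a _ => by fun_prop]
      refine Finset.sum_congr rfl fun a _ => ?_
      rw [integral_sum_sph _ fun b _ => by fun_prop]
      refine Finset.sum_congr rfl fun b _ => ?_
      rw [hB, ← integral_const_mul]
      exact integral_congr_ae (Filter.Eventually.of_forall fun x => by ring)
    have h3 : ∑ a, ∑ b, B a b * angTensor a b q =
        arccos (q.1 0) ^ 2 * ∑ a, ∑ b, n.1 a * n.1 b * B a b := by
      rw [Finset.mul_sum]
      refine Finset.sum_congr rfl fun a _ => ?_
      rw [Finset.mul_sum]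
      refine Finset.sum_congr rfl fun b _ => ?_
      rw [hna, hna, div_mul_div_comm, Real.mul_self_sqrt hq.le, angTensor]
      ring
    rw [h2, h3]
    ring
  have hcorr : ∫ q, ∫ x, F (qm x q) * F x ∂nuS ∂nuS = 0 := by
    rw [integral_swap_sph (k := fun q x => F (qm x q) * F x) (by fun_prop)]
    simp only [integral_mul_const]
    simp only [integral_qm_left, h0, zero_mul, integral_zero]
  have hInt : Integrable (fun q => A - 1 / 2 * ∑ a, ∑ b, B a b * angTensor a b q) nuS := by
    refine (integrable_const A).sub (Integrable.const_mul ?_ _)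
    exact integrable_finsetSum _ fun a _ => integrable_finsetSum _ fun b _ =>
      (integrable_angTensor a b).const_mul _
  have hmain := integral_mono_ae hInt
    (continuous_integral_kernel (k := fun q x => F (qm x q) * F x) (by fun_prop)).integrable_nuS hpt
  rw [hcorr, integral_sub (integrable_const A) (Integrable.const_mul
    (integrable_finsetSum _ fun a _ => integrable_finsetSum _ fun b _ =>
      (integrable_angTensor a b).const_mul _) _), integral_const_mul, integral_const_nuS,
    integral_finsetSum _ fun a _ => integrable_finsetSum _ fun b _ =>
      (integrable_angTensor a b).const_mul _] at hmain
  have hsum : ∀ a, ∫ q, ∑ b, B a b * angTensor a b q ∂nuS =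
      B a a * ((∫ q : Sph, arccos (q.1 0) ^ 2 ∂nuS) / 3) := by
    intro a
    rw [integral_finsetSum _ fun b _ => (integrable_angTensor a b).const_mul _,
      Finset.sum_eq_single a]
    · rw [integral_const_mul, integral_angTensor_self]
    · intro b _ hb
      rw [integral_const_mul, integral_angTensor_of_ne hb.symm, mul_zero]
    · simp
  simp only [hsum] at hmain
  rw [← Finset.sum_mul] at hmain
  have hBs : ∫ x, ∑ a, G a x ^ 2 ∂nuS = ∑ a, B a a := by
    rw [integral_sum_sph _ fun a _ => by fun_prop]
    simp only [hB, sq]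
  rw [← hBs] at hmain
  set b := ∫ x, ∑ a, G a x ^ 2 ∂nuS
  have hb : 0 ≤ b := integral_nonneg fun x => Finset.sum_nonneg fun a _ => sq_nonneg _
  have h1 : b * ((∫ q : Sph, arccos (q.1 0) ^ 2 ∂nuS) / 3) ≤ b * (5 * π ^ 2 / 16 * volS / 3) :=
    mul_le_mul_of_nonneg_left (by linarith [integral_arccos_sq_le]) hb
  have hpi : π ^ 2 ≤ 10 := by nlinarith [Real.pi_lt_d2, Real.pi_pos]
  have h2 : b * (5 * π ^ 2 / 16 * volS / 3) ≤ b * (5 * 10 / 16 * volS / 3) := by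
    have := volS_pos; gcongr
  have h3 : volS * A ≤ volS * (25 / 48 * b) := by linarith
  have h4 := le_of_mul_le_mul_left h3 volS_pos
  linarith

theorem IsC2.congr {F L F' L' : Sph → ℝ} {G : Fin 3 → Sph → ℝ} (h : IsC2 F G L)
    (h1 : ∀ x, F' x = F x) (h2 : ∀ x, L' x = L x) : IsC2 F' G L' := by
  rwa [show F' = F from funext h1, show L' = L from funext h2]

/-- The Paneitz energy in terms of the gradient and the Laplacian. -/
def energy (F : Sph → ℝ) (G : Fin 3 → Sph → ℝ) (L : Sph → ℝ) : ℝ :=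
  ∫ x, L x ^ 2 ∂nuS - 1 / 2 * ∫ x, ∑ a, G a x ^ 2 ∂nuS - 15 / 16 * ∫ x, F x ^ 2 ∂nuS

theorem IsC2.energy_nonneg {F L : Sph → ℝ} {G : Fin 3 → Sph → ℝ} (h : IsC2 F G L)
    (h0 : ∫ x, F x ∂nuS = 0) : 0 ≤ energy F G L := by
  have hF := h.cont
  have hL := h.contL
  have h1 := poincare hF h.contG h.grad h0
  have h2 := h.integral_lap_mul h
  simp only [← pow_two] at h2
  have h3 : 0 ≤ ∫ x, (L x ^ 2 + 5 / 2 * (L x * F x) + 25 / 16 * F x ^ 2) ∂nuS :=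
    integral_nonneg fun x => by
      change (0 : ℝ) ≤ L x ^ 2 + 5 / 2 * (L x * F x) + 25 / 16 * F x ^ 2
      nlinarith [sq_nonneg (L x + 5 / 4 * F x)]
  rw [integral_add_sph (by fun_prop) (by fun_prop), integral_add_sph (by fun_prop) (by fun_prop),
    integral_const_mul, integral_const_mul, h2] at h3
  unfold energy
  linarith

theorem energy_add_const_mul {F₁ F₂ L₁ L₂ : Sph → ℝ} {G₁ G₂ : Fin 3 → Sph → ℝ}
    (h₁ : IsC2 F₁ G₁ L₁) (h₂ : IsC2 F₂ G₂ L₂) (c : ℝ) :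
    energy (fun x => F₁ x + c * F₂ x) (fun a x => G₁ a x + c * G₂ a x)
      (fun x => L₁ x + c * L₂ x) = energy F₁ G₁ L₁ + 2 * c * (∫ x, L₁ x * L₂ x ∂nuS -
        1 / 2 * ∫ x, ∑ a, G₁ a x * G₂ a x ∂nuS - 15 / 16 * ∫ x, F₁ x * F₂ x ∂nuS) +
        c ^ 2 * energy F₂ G₂ L₂ := by
  have key : ∀ u v : Sph → ℝ, Continuous u → Continuous v →
      ∫ x, (u x + c * v x) ^ 2 ∂nuS = ∫ x, u x ^ 2 ∂nuS + 2 * c * ∫ x, u x * v x ∂nuS +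
        c ^ 2 * ∫ x, v x ^ 2 ∂nuS := by
    intro u v hu hv
    rw [← integral_const_mul, ← integral_const_mul, ← integral_add_sph (by fun_prop) (by fun_prop),
      ← integral_add_sph (by fun_prop) (by fun_prop)]
    exact integral_congr_ae (Filter.Eventually.of_forall fun x => by ring)
  have hG₁ := h₁.contG
  have hG₂ := h₂.contG
  unfold energy
  rw [key _ _ h₁.cont h₂.cont, key _ _ h₁.contL h₂.contL,
    integral_sum_sph _ fun a _ => by have := hG₁ a; have := hG₂ a; fun_prop,
    integral_sum_sph _ fun a _ => by have := hG₁ a; fun_prop,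
    integral_sum_sph _ fun a _ => by have := hG₂ a; fun_prop,
    integral_sum_sph _ fun a _ => by have := hG₁ a; have := hG₂ a; fun_prop]
  simp only [key _ _ (hG₁ _) (hG₂ _), Finset.sum_add_distrib, ← Finset.mul_sum]
  ring

theorem IsC2.bilin_eq {F L u M W : Sph → ℝ} {G Gu GM : Fin 3 → Sph → ℝ} (h : IsC2 F G L)
    (hu : IsC2 u Gu M) (hM : IsC2 M GM W) :
    ∫ x, L x * M x ∂nuS - 1 / 2 * ∫ x, ∑ a, G a x * Gu a x ∂nuS - 15 / 16 * ∫ x, F x * u x ∂nuS =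
      ∫ x, F x * (W x + 1 / 2 * M x - 15 / 16 * u x) ∂nuS := by
  have h1 := h.integral_lap_mul_comm hM
  have h2 := h.integral_lap_mul hu
  have h3 := h.integral_lap_mul_comm hu
  have hF := h.cont
  have hW := hM.contL
  have hMc := hM.cont
  have huc := hu.cont
  have e : ∫ x, F x * (W x + 1 / 2 * M x - 15 / 16 * u x) ∂nuS =
      ∫ x, (F x * W x + 1 / 2 * (F x * M x) - 15 / 16 * (F x * u x)) ∂nuS :=
    integral_congr_ae (Filter.Eventually.of_forall fun x => by ring)
  rw [e, integral_sub_sph (by fun_prop) (by fun_prop), integral_add_sph (by fun_prop) (by fun_prop),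
    integral_const_mul, integral_const_mul, h1]
  linarith

/-- The fundamental identity: the Paneitz operator applied to `(T - 2t)^(1/2)` is a multiple of
`(T - 2t)^(-7/2)`. -/
theorem exists_isC2_psi_half {T : ℝ} (hT : 2 < T) {f : Sph → ℝ} (hf : Continuous f) :
    ∃ (G GM : Fin 3 → Sph → ℝ) (M W : Sph → ℝ), IsC2 (psi T (1 / 2) f) G M ∧ IsC2 M GM W ∧
      ∀ x, W x + 1 / 2 * M x - 15 / 16 * psi T (1 / 2) f x =
        -(15 / 16) * (T ^ 2 - 4) ^ 2 * psi T (-7 / 2) f x := by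
  have h1 := isC2_psi hT (1 / 2) hf
  have h2 := isC2_psi hT (-1 / 2) hf
  have h3 := isC2_psi hT (-3 / 2) hf
  rw [show (1 / 2 : ℝ) - 1 = -1 / 2 by norm_num, show (1 / 2 : ℝ) - 2 = -3 / 2 by norm_num] at h1
  rw [show (-1 / 2 : ℝ) - 1 = -3 / 2 by norm_num, show (-1 / 2 : ℝ) - 2 = -5 / 2 by norm_num] at h2
  rw [show (-3 / 2 : ℝ) - 1 = -5 / 2 by norm_num, show (-3 / 2 : ℝ) - 2 = -7 / 2 by norm_num] at h3
  have h4 := ((h1.const_mul (-5 / 4)).add (h2.const_mul T)).add (h3.const_mul ((T ^ 2 - 4) / 4))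
  exact ⟨_, _, _, _, h1, h4.congr (fun x => by ring) fun x => rfl, fun x => by ring⟩

/-- Lower bound for the energy obtained from the test function `psi T (1 / 2) f`. -/
theorem IsC2.energy_ge {F L : Sph → ℝ} {G : Fin 3 → Sph → ℝ} (h : IsC2 F G L) {T : ℝ} (hT : 2 < T)
    {f : Sph → ℝ} (hf : Continuous f) {s : ℝ}
    (hs : ∫ x, F x ∂nuS = s * ∫ x, psi T (1 / 2) f x ∂nuS) :
    -(15 / 16) * (2 * s * ((T ^ 2 - 4) ^ 2 * ∫ x, F x * psi T (-7 / 2) f x ∂nuS) -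
      s ^ 2 * ((T ^ 2 - 4) ^ 2 * ∫ x, psi T (1 / 2) f x * psi T (-7 / 2) f x ∂nuS)) ≤
      energy F G L := by
  obtain ⟨Gp, GM, M, W, h1, h2, h3⟩ := exists_isC2_psi_half hT hf
  have h4 := (h.add (h1.const_mul (-s))).energy_nonneg (by
    have := h.cont; have := h1.cont
    rw [integral_add_sph (by fun_prop) (by fun_prop), integral_const_mul, hs]; ring)
  rw [energy_add_const_mul h h1, h.bilin_eq h1 h2] at h4
  have h5 := h1.bilin_eq h1 h2
  simp only [h3] at h4 h5
  have e : ∀ u : Sph → ℝ, ∫ x, u x * (-(15 / 16) * (T ^ 2 - 4) ^ 2 * psi T (-7 / 2) f x) ∂nuS =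
      -(15 / 16) * ((T ^ 2 - 4) ^ 2 * ∫ x, u x * psi T (-7 / 2) f x ∂nuS) := by
    intro u
    rw [← integral_const_mul, ← integral_const_mul]
    exact integral_congr_ae (Filter.Eventually.of_forall fun x => by ring)
  rw [e] at h4 h5
  simp only [← pow_two] at h5
  change energy _ _ _ = _ at h5
  rw [h5] at h4
  linarith

/-- The bilinear form `∫∫ k(x, y) f(x) g(y)`. -/
def form (k : Sph × Sph → ℝ) (f g : Sph → ℝ) : ℝ := ∫ p, k p * (f p.1 * g p.2) ∂(nuS.prod nuS)

theorem form_eq {k : Sph × Sph → ℝ} (hk : Continuous k) {f g : Sph → ℝ} (hf : Continuous f)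
    (hg : Continuous g) : form k f g = ∫ x, f x * ∫ y, k (x, y) * g y ∂nuS ∂nuS := by
  rw [form, integral_prod _ (integrable_prod_sph (by fun_prop))]
  refine integral_congr_ae (Filter.Eventually.of_forall fun x => ?_)
  dsimp only
  rw [← integral_const_mul]
  exact integral_congr_ae (Filter.Eventually.of_forall fun y => by ring)

theorem form_comm {k : Sph × Sph → ℝ} (hs : ∀ x y, k (x, y) = k (y, x)) (f g : Sph → ℝ) :
    form k f g = form k g f := by
  rw [form, ← integral_prod_swap]
  refine integral_congr_ae (Filter.Eventually.of_forall fun p => ?_)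
  simp only [Prod.fst_swap, Prod.snd_swap]
  rw [show p.swap = (p.2, p.1) from rfl, hs, mul_comm (f p.2)]

theorem form_add_const_mul {k : Sph × Sph → ℝ} (hk : Continuous k) {f g h : Sph → ℝ}
    (hf : Continuous f) (hg : Continuous g) (hh : Continuous h) (c : ℝ) :
    form k (fun x => f x + c * g x) h = form k f h + c * form k g h := by
  rw [form, form, form, ← integral_const_mul, ← integral_add (integrable_prod_sph (by fun_prop))
    (integrable_prod_sph (by fun_prop))]
  exact integral_congr_ae (Filter.Eventually.of_forall fun p => by ring)

theorem form_quadratic {k : Sph × Sph → ℝ} (hk : Continuous k) (hs : ∀ x y, k (x, y) = k (y, x))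
    {f g : Sph → ℝ} (hf : Continuous f) (hg : Continuous g) (c : ℝ) :
    form k (fun x => f x + c * g x) (fun x => f x + c * g x) =
      form k f f + 2 * c * form k f g + c ^ 2 * form k g g := by
  rw [form_add_const_mul hk hf hg (by fun_prop), form_comm hs f, form_comm hs g,
    form_add_const_mul hk hf hg hf, form_add_const_mul hk hf hg hg, form_comm hs g f]
  ring

theorem form_add_kernel {k l : Sph × Sph → ℝ} (hk : Continuous k) (hl : Continuous l)
    {f g : Sph → ℝ} (hf : Continuous f) (hg : Continuous g) :
    form (fun p => k p + l p) f g = form k f g + form l f g := by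
  rw [form, form, form, ← integral_add (integrable_prod_sph (by fun_prop))
    (integrable_prod_sph (by fun_prop))]
  exact integral_congr_ae (Filter.Eventually.of_forall fun p => by ring)

theorem form_const_kernel (c : ℝ) (f g : Sph → ℝ) :
    form (fun _ => c) f g = c * ((∫ x, f x ∂nuS) * ∫ x, g x ∂nuS) := by
  rw [form, integral_const_mul, integral_prod_mul]

/-- Kernels of the form `∑ φᵢ(x) φᵢ(y)`. -/
def FinPSD (k : Sph × Sph → ℝ) : Prop :=
  ∃ (ι : Type) (_ : Fintype ι) (φ : ι → Sph → ℝ), (∀ i, Continuous (φ i)) ∧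
    ∀ p, k p = ∑ i, φ i p.1 * φ i p.2

theorem FinPSD.continuous {k : Sph × Sph → ℝ} (h : FinPSD k) : Continuous k := by
  obtain ⟨ι, _, φ, hφ, h⟩ := h
  rw [show k = _ from funext h]
  fun_prop

theorem FinPSD.add {k l : Sph × Sph → ℝ} (hk : FinPSD k) (hl : FinPSD l) :
    FinPSD fun p => k p + l p := by
  obtain ⟨ι, _, φ, hφ, h⟩ := hk
  obtain ⟨κ, _, χ, hχ, h'⟩ := hl
  exact ⟨ι ⊕ κ, inferInstance, Sum.elim φ χ, by rintro (i | i); exacts [hφ i, hχ i],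
    fun p => by simp [h, h']⟩

theorem FinPSD.mul {k l : Sph × Sph → ℝ} (hk : FinPSD k) (hl : FinPSD l) :
    FinPSD fun p => k p * l p := by
  obtain ⟨ι, _, φ, hφ, h⟩ := hk
  obtain ⟨κ, _, χ, hχ, h'⟩ := hl
  refine ⟨ι × κ, inferInstance, fun i x => φ i.1 x * χ i.2 x,
    fun i => (hφ i.1).mul (hχ i.2), fun p => ?_⟩
  dsimp only
  rw [h, h', Finset.sum_mul_sum, Fintype.sum_prod_type]
  exact Finset.sum_congr rfl fun i _ => Finset.sum_congr rfl fun j _ => by ring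

theorem FinPSD.const {c : ℝ} (hc : 0 ≤ c) : FinPSD fun _ => c :=
  ⟨Unit, inferInstance, fun _ _ => sqrt c, fun _ => continuous_const,
    fun p => by simp [Real.mul_self_sqrt hc]⟩

theorem finPSD_dot : FinPSD fun p => dot p.1 p.2 :=
  ⟨Fin 4, inferInstance, fun i x => x.1 i, continuous_coord, fun p => by
    simp [Fin.sum_univ_four, dot]⟩

theorem form_eq_sum {ι : Type} [Fintype ι] {φ : ι → Sph → ℝ} (hφ : ∀ i, Continuous (φ i))
    {g : Sph → ℝ} (hg : Continuous g) :
    form (fun p => ∑ i, φ i p.1 * φ i p.2) g g = ∑ i, (∫ x, φ i x * g x ∂nuS) ^ 2 := by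
  have : ∀ p : Sph × Sph, (∑ i, φ i p.1 * φ i p.2) * (g p.1 * g p.2) =
      ∑ i, (φ i p.1 * g p.1) * (φ i p.2 * g p.2) := fun p => by
    rw [Finset.sum_mul]
    exact Finset.sum_congr rfl fun i _ => by ring
  simp only [form, this]
  rw [integral_finsetSum _ fun i _ => integrable_prod_sph (by have := hφ i; fun_prop)]
  refine Finset.sum_congr rfl fun i _ => ?_
  rw [integral_prod_mul (fun x => φ i x * g x) fun x => φ i x * g x, sq]

theorem FinPSD.form_nonneg {k : Sph × Sph → ℝ} (h : FinPSD k) {g : Sph → ℝ} (hg : Continuous g) :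
    0 ≤ form k g g := by
  obtain ⟨ι, _, φ, hφ, h⟩ := h
  rw [show k = _ from funext h, form_eq_sum hφ hg]
  exact Finset.sum_nonneg fun i _ => sq_nonneg _

/-- Iterates converging to `1 - √(1 - t)`. -/
def sqrtIter (t : ℝ) : ℕ → ℝ
  | 0 => 0
  | n + 1 => 1 / 2 * (t + sqrtIter t n * sqrtIter t n)

theorem finPSD_sqrtIter (n : ℕ) : FinPSD fun p => sqrtIter (dot p.1 p.2) n := by
  induction n with
  | zero => exact FinPSD.const le_rfl
  | succ n ih => exact (FinPSD.const (by norm_num)).mul (finPSD_dot.add (ih.mul ih))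

theorem abs_sqrtIter_le {t : ℝ} (ht : |t| ≤ 1) (n : ℕ) : |sqrtIter t n| ≤ 1 := by
  induction n with
  | zero => simp [sqrtIter]
  | succ n ih =>
    rw [abs_le] at *
    simp only [sqrtIter]
    constructor <;> nlinarith

theorem tendsto_sqrtIter {t : ℝ} (ht : |t| ≤ 1) :
    Filter.Tendsto (sqrtIter t) Filter.atTop (nhds (1 - sqrt (1 - t))) := by
  set u := 1 - sqrt (1 - t) with hu
  have ht' := abs_le.1 ht
  have hsq : sqrt (1 - t) ^ 2 = 1 - t := Real.sq_sqrt (by linarith)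
  have hs0 : 0 ≤ sqrt (1 - t) := Real.sqrt_nonneg _
  have hfix : u = 1 / 2 * (t + u * u) := by rw [hu]; nlinarith
  have hrec : ∀ n, u - sqrtIter t (n + 1) = (u - sqrtIter t n) * ((u + sqrtIter t n) / 2) := by
    intro n
    simp only [sqrtIter]
    linear_combination hfix
  suffices h : Filter.Tendsto (fun n => u - sqrtIter t n) Filter.atTop (nhds 0) by
    simpa using h.const_sub u
  rcases le_total 0 t with h0 | h0
  · have hu0 : 0 ≤ u := by
      have : sqrt (1 - t) ≤ 1 := Real.sqrt_le_one.2 (by linarith)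
      linarith
    have hu1 : u ≤ 1 := by linarith
    have hn0 : ∀ n, 0 ≤ sqrtIter t n := fun n => by
      cases n with
      | zero => exact le_rfl
      | succ n => simp only [sqrtIter]; nlinarith [mul_self_nonneg (sqrtIter t n)]
    have hb : ∀ n : ℕ, 0 ≤ u - sqrtIter t n ∧ u - sqrtIter t n ≤ 2 / ((n : ℝ) + 2) := by
      intro n
      induction n with
      | zero => simpa [sqrtIter] using ⟨hu0, hu1⟩
      | succ n ih =>
        obtain ⟨ih1, ih2⟩ := ih
        rw [hrec]
        refine ⟨mul_nonneg ih1 (by linarith [hn0 n]), ?_⟩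
        set e := u - sqrtIter t n
        have hle : (u + sqrtIter t n) / 2 ≤ 1 - e / 2 := by simp only [e]; linarith
        have hn : (0 : ℝ) ≤ n := Nat.cast_nonneg n
        have he1 : 2 / ((n : ℝ) + 2) ≤ 1 := by rw [div_le_one (by positivity)]; linarith
        calc e * ((u + sqrtIter t n) / 2) ≤ e * (1 - e / 2) := by gcongr
          _ ≤ 2 / ((n : ℝ) + 2) * (1 - 2 / ((n : ℝ) + 2) / 2) := by nlinarith
          _ ≤ 2 / (((n + 1 : ℕ) : ℝ) + 2) := by
            have : 2 / ((n : ℝ) + 2) * (1 - 2 / ((n : ℝ) + 2) / 2) =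
                2 * (n + 1) / ((n : ℝ) + 2) ^ 2 := by field_simp; ring
            rw [this, div_le_div_iff₀ (by positivity) (by positivity)]
            push_cast
            nlinarith
    refine squeeze_zero (fun n => (hb n).1) (fun n => (hb n).2) ?_
    have := (tendsto_const_div_atTop_nhds_zero_nat (2 : ℝ)).comp (Filter.tendsto_add_atTop_nat 2)
    refine this.congr fun n => by simp
  · have hul : -(1 / 2) ≤ u := by
      have : sqrt (1 - t) ≤ 3 / 2 := Real.sqrt_le_iff.2 ⟨by norm_num, by linarith⟩
      linarith
    have hu0 : u ≤ 0 := by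
      have : 1 ≤ sqrt (1 - t) := Real.one_le_sqrt.2 (by linarith)
      linarith
    have hb : ∀ n : ℕ, |u - sqrtIter t n| ≤ (3 / 4 : ℝ) ^ n := by
      intro n
      induction n with
      | zero => simp [sqrtIter, abs_le]; constructor <;> linarith
      | succ n ih =>
        rw [hrec, abs_mul, pow_succ]
        have h2 := abs_le.1 (abs_sqrtIter_le ht n)
        have : |(u + sqrtIter t n) / 2| ≤ 3 / 4 := by
          rw [abs_le]; constructor <;> linarith
        gcongr
    exact squeeze_zero_norm hb (tendsto_pow_atTop_nhds_zero_of_lt_one (by norm_num) (by norm_num))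

theorem abs_dot_le_one (x y : Sph) : |dot x y| ≤ 1 :=
  abs_le.2 ⟨neg_one_le_dot x y, dot_le_one x y⟩

theorem dist_eq_sqrt (x y : Sph) : dist x y = sqrt 2 * sqrt (1 - dot x y) := by
  rw [← Real.sqrt_mul (by norm_num), ← Real.sqrt_sq (dist_nonneg (x := x) (y := y)), dist_sq]
  ring_nf

/-- Conditional negative definiteness of `a(x, y) |x - y|` for positive semidefinite `a`. -/
theorem FinPSD.form_mul_dist_le {a : Sph × Sph → ℝ} (ha : FinPSD a) {g : Sph → ℝ}
    (hg : Continuous g) :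
    form (fun p => a p * dist p.1 p.2) g g ≤ sqrt 2 * form a g g := by
  have hac := ha.continuous
  obtain ⟨C, hC⟩ := isCompact_univ.exists_bound_of_continuousOn
    (show Continuous fun p : Sph × Sph => a p * (g p.1 * g p.2) by fun_prop).continuousOn
  have h1 : Filter.Tendsto
      (fun n => form (fun p => a p * sqrtIter (dot p.1 p.2) n) g g) Filter.atTop
      (nhds (form (fun p => a p * (1 - sqrt (1 - dot p.1 p.2))) g g)) := by
    refine tendsto_integral_of_dominated_convergence (fun _ => C)
      (fun n => ?_) (integrable_const _) (fun n => ?_) ?_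
    · have := (finPSD_sqrtIter n).continuous
      exact (show Continuous fun p : Sph × Sph => a p * sqrtIter (dot p.1 p.2) n *
        (g p.1 * g p.2) by fun_prop).aestronglyMeasurable
    · refine Filter.Eventually.of_forall fun p => ?_
      rw [mul_right_comm, norm_mul]
      have h2 := abs_sqrtIter_le (abs_dot_le_one p.1 p.2) n
      calc _ ≤ C * 1 := mul_le_mul (hC p (mem_univ p)) h2 (abs_nonneg _)
            ((norm_nonneg _).trans (hC p (mem_univ p)))
        _ = C := mul_one C
    · exact Filter.Eventually.of_forall fun p =>
        ((tendsto_sqrtIter (abs_dot_le_one p.1 p.2)).const_mul _).mul_const _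
  have h2 : 0 ≤ form (fun p => a p * (1 - sqrt (1 - dot p.1 p.2))) g g :=
    ge_of_tendsto' h1 fun n => (ha.mul (finPSD_sqrtIter n)).form_nonneg hg
  have h3 : form (fun p => a p * dist p.1 p.2) g g = sqrt 2 * form a g g -
      sqrt 2 * form (fun p => a p * (1 - sqrt (1 - dot p.1 p.2))) g g := by
    rw [form, form, form, ← integral_const_mul, ← integral_const_mul,
      ← integral_sub (integrable_prod_sph (by fun_prop)) (integrable_prod_sph (by fun_prop))]
    refine integral_congr_ae (Filter.Eventually.of_forall fun p => ?_)
    dsimp only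
    rw [dist_eq_sqrt]; ring
  rw [h3]
  have := mul_nonneg (Real.sqrt_nonneg 2) h2
  linarith

theorem form_dist_nonpos {g : Sph → ℝ} (hg : Continuous g) (h0 : ∫ x, g x ∂nuS = 0) :
    form (fun p => dist p.1 p.2) g g ≤ 0 := by
  have := (FinPSD.const zero_le_one).form_mul_dist_le hg
  simpa [form_const_kernel, h0] using this

theorem form_dot_dist_nonpos {g : Sph → ℝ} (hg : Continuous g)
    (h0 : ∀ i, ∫ x : Sph, x.1 i * g x ∂nuS = 0) :
    form (fun p => dot p.1 p.2 * dist p.1 p.2) g g ≤ 0 := by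
  have h1 := finPSD_dot.form_mul_dist_le hg
  have h2 : (fun p : Sph × Sph => dot p.1 p.2) = fun p => ∑ i : Fin 4, p.1.1 i * p.2.1 i := by
    ext p; simp [Fin.sum_univ_four, dot]
  have h3 : form (fun p => dot p.1 p.2) g g = 0 := by
    rw [h2, form_eq_sum continuous_coord hg]
    simp [h0]
  simpa [h3] using h1

theorem integral_pos_sph {f : Sph → ℝ} (hf : Continuous f) (hp : ∀ x, 0 < f x) :
    0 < ∫ x, f x ∂nuS := by
  obtain ⟨x₀, -, h0⟩ := isCompact_univ.exists_isMinOn ⟨qmk 1 0 0 0 (by norm_num), mem_univ _⟩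
    hf.continuousOn
  calc 0 < volS * f x₀ := mul_pos volS_pos (hp _)
    _ = ∫ _ : Sph, f x₀ ∂nuS := (integral_const_nuS _).symm
    _ ≤ _ := integral_mono_sph continuous_const hf fun x => h0 (mem_univ x)

/-- Hölder's inequality in multiplicative form. -/
theorem integral_pow_le_sph (n : ℕ) {P Q W : Sph → ℝ} (hP : Continuous P) (hQ : Continuous Q)
    (hW : Continuous W) (hP0 : ∀ x, 0 < P x) (hQ0 : ∀ x, 0 < Q x) (hW0 : ∀ x, 0 < W x)
    (h : ∀ x, W x ^ (n + 1) = P x ^ n * Q x) :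
    (∫ x, W x ∂nuS) ^ (n + 1) ≤ (∫ x, P x ∂nuS) ^ n * ∫ x, Q x ∂nuS := by
  set p := ∫ x, P x ∂nuS
  set q := ∫ x, Q x ∂nuS
  have hp : 0 < p := integral_pos_sph hP hP0
  have hq : 0 < q := integral_pos_sph hQ hQ0
  have hn : (0 : ℝ) < n + 1 := by positivity
  set M := (p ^ n * q) ^ (1 / ((n : ℝ) + 1)) with hM
  have hM0 : 0 < M := by positivity
  have hMp : M ^ (n + 1) = p ^ n * q := by
    rw [hM, ← Real.rpow_natCast, ← Real.rpow_mul (by positivity)]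
    push_cast
    rw [one_div_mul_cancel hn.ne', Real.rpow_one]
  have hpt : ∀ x, W x ≤ M * (n / (n + 1) / p) * P x + M * (1 / (n + 1) / q) * Q x := by
    intro x
    have h1 := Real.geom_mean_le_arith_mean2_weighted (w₁ := (n : ℝ) / (n + 1))
      (w₂ := 1 / ((n : ℝ) + 1)) (p₁ := P x / p) (p₂ := Q x / q) (by positivity) (by positivity)
      (by have := hP0 x; positivity) (by have := hQ0 x; positivity) (by field_simp)
    have h2 : (P x / p) ^ ((n : ℝ) / (n + 1)) * (Q x / q) ^ (1 / ((n : ℝ) + 1)) = W x / M := by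
      have hPx := hP0 x
      have hQx := hQ0 x
      have hWx := hW0 x
      refine (pow_left_inj₀ (by positivity) (by positivity) (Nat.succ_ne_zero n)).1 ?_
      rw [mul_pow, ← Real.rpow_natCast, ← Real.rpow_natCast, ← Real.rpow_mul (by positivity),
        ← Real.rpow_mul (by positivity), div_pow, hMp, h x]
      push_cast
      rw [one_div_mul_cancel hn.ne', Real.rpow_one, div_mul_cancel₀ _ hn.ne', Real.rpow_natCast,
        div_pow]
      field_simp
    rw [h2, div_le_iff₀ hM0] at h1
    refine h1.trans (le_of_eq ?_)
    ring
  have hInt := integral_mono_sph hW (by fun_prop) hpt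
  rw [integral_add_sph (by fun_prop) (by fun_prop), integral_const_mul, integral_const_mul] at hInt
  have : M * (n / (n + 1) / p) * p + M * (1 / (n + 1) / q) * q = M := by field_simp
  calc _ ≤ M ^ (n + 1) := by
        gcongr
        · exact (integral_pos_sph hW hW0).le
        · exact hInt.trans this.le
    _ = _ := hMp

theorem dist_le_two (x y : Sph) : dist x y ≤ 2 := by
  have h1 := dist_sq x y
  have h2 := neg_one_le_dot x y
  nlinarith [dist_nonneg (x := x) (y := y)]

/-- The kernel `|x - y| + ε`. -/
def kern (ε : ℝ) (p : Sph × Sph) : ℝ := dist p.1 p.2 + ε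

@[fun_prop]
theorem continuous_kern (ε : ℝ) : Continuous (kern ε) := by unfold kern; fun_prop

theorem kern_comm (ε : ℝ) (x y : Sph) : kern ε (x, y) = kern ε (y, x) := by
  simp [kern, dist_comm]

theorem form_kern_pos {ε : ℝ} (hε : 0 < ε) {f g : Sph → ℝ} (hf : Continuous f) (hg : Continuous g)
    (hf0 : ∀ x, 0 < f x) (hg0 : ∀ x, 0 < g x) : 0 < form (kern ε) f g := by
  rw [form_eq (by fun_prop) hf hg]
  refine integral_pos_sph (hf.mul (continuous_integral_kernel (k := fun x y => kern ε (x, y) * g y)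
    (by fun_prop))) fun x => mul_pos (hf0 x) (integral_pos_sph (by fun_prop) fun y => ?_)
  have : 0 < kern ε (x, y) := add_pos_of_nonneg_of_pos dist_nonneg hε
  exact mul_pos this (hg0 y)

/-- Reverse Cauchy–Schwarz inequality for the kernel `|x - y| + ε`. -/
theorem form_kern_mul_le {ε : ℝ} (hε : 0 < ε) {f g : Sph → ℝ} (hf : Continuous f)
    (hg : Continuous g) (hf0 : ∀ x, 0 < f x) (hg0 : ∀ x, 0 < g x) :
    form (kern ε) f f * form (kern ε) g g ≤ form (kern ε) f g ^ 2 := by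
  set t := (∫ x, f x ∂nuS) / ∫ x, g x ∂nuS with ht
  have hgp := integral_pos_sph hg hg0
  have ht0 : 0 < t := div_pos (integral_pos_sph hf hf0) hgp
  have hz : ∫ x, (f x + -t * g x) ∂nuS = 0 := by
    rw [integral_add_sph hf (by fun_prop), integral_const_mul, ht]
    field_simp
    ring
  have hc : Continuous fun x => f x + -t * g x := by fun_prop
  have h1 : form (kern ε) (fun x => f x + -t * g x) (fun x => f x + -t * g x) ≤ 0 := by
    have : kern ε = fun p => (fun p : Sph × Sph => dist p.1 p.2) p + (fun _ => ε) p := rfl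
    rw [this, form_add_kernel (by fun_prop) (by fun_prop) hc hc, form_const_kernel, hz]
    simpa using form_dist_nonpos hc hz
  rw [form_quadratic (by fun_prop) (kern_comm ε) hf hg] at h1
  have hI := form_kern_pos hε hf hf hf0 hf0
  have hJ := form_kern_pos hε hg hg hg0 hg0
  have hK := form_kern_pos hε hf hg hf0 hg0
  set I := form (kern ε) f f
  set J := form (kern ε) g g
  set K := form (kern ε) f g
  have h2 : I + t ^ 2 * J ≤ 2 * t * K := by linarith
  have h3 : 4 * t ^ 2 * (I * J) ≤ 4 * t ^ 2 * K ^ 2 := by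
    calc 4 * t ^ 2 * (I * J) ≤ (I + t ^ 2 * J) ^ 2 := by nlinarith [sq_nonneg (I - t ^ 2 * J)]
      _ ≤ (2 * t * K) ^ 2 := by gcongr
      _ = _ := by ring
  exact le_of_mul_le_mul_left h3 (by positivity)

/-- The scale-invariant quotient of the reverse Hardy–Littlewood–Sobolev inequality. -/
def quot (ε : ℝ) (v : Sph → ℝ) : ℝ :=
  form (kern ε) (fun x => v x ^ 7) (fun x => v x ^ 7) ^ 3 / (∫ x, v x ^ 6 ∂nuS) ^ 7

/-- The potential of `v ^ 7`. -/
def pot (ε : ℝ) (v : Sph → ℝ) (x : Sph) : ℝ := ∫ y, kern ε (x, y) * v y ^ 7 ∂nuS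

theorem continuous_pot (ε : ℝ) {v : Sph → ℝ} (hv : Continuous v) : Continuous (pot ε v) :=
  continuous_integral_kernel (k := fun x y => kern ε (x, y) * v y ^ 7) (by fun_prop)

theorem pot_pos {ε : ℝ} (hε : 0 < ε) {v : Sph → ℝ} (hv : Continuous v) (hv0 : ∀ x, 0 < v x)
    (x : Sph) : 0 < pot ε v x :=
  integral_pos_sph (by fun_prop) fun y =>
    mul_pos (add_pos_of_nonneg_of_pos dist_nonneg hε) (pow_pos (hv0 y) 7)

theorem form_eq_integral_pot (ε : ℝ) {v f : Sph → ℝ} (hv : Continuous v) (hf : Continuous f) :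
    form (kern ε) f (fun x => v x ^ 7) = ∫ x, f x * pot ε v x ∂nuS :=
  form_eq (by fun_prop) hf (by fun_prop)

theorem quot_improve {ε : ℝ} (hε : 0 < ε) {v : Sph → ℝ} (hv : Continuous v)
    (hv0 : ∀ x, 0 < v x) {c : ℝ} (hc : 0 < c) :
    quot ε (fun x => (c * pot ε v x)⁻¹) ≤ quot ε v := by
  have hφ : Continuous fun x => c * pot ε v x := (continuous_pot ε hv).const_mul c
  have hφ0 : ∀ x, 0 < c * pot ε v x := fun x => mul_pos hc (pot_pos hε hv hv0 x)
  set φ := fun x => c * pot ε v x with hφd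
  have hφi : Continuous fun x => (φ x)⁻¹ := hφ.inv₀ fun x => (hφ0 x).ne'
  have hf0 : ∀ x, 0 < v x ^ 7 := fun x => pow_pos (hv0 x) 7
  have hg0 : ∀ x, 0 < (φ x)⁻¹ ^ 7 := fun x => pow_pos (inv_pos.2 (hφ0 x)) 7
  have h1 := form_kern_mul_le hε (f := fun x => (φ x)⁻¹ ^ 7) (g := fun x => v x ^ 7)
    (by fun_prop) (by fun_prop) hg0 hf0
  have h2 : form (kern ε) (fun x => (φ x)⁻¹ ^ 7) (fun x => v x ^ 7) =
      (∫ x, (φ x)⁻¹ ^ 6 ∂nuS) / c := by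
    rw [form_eq_integral_pot ε hv (by fun_prop), ← integral_div]
    refine integral_congr_ae (Filter.Eventually.of_forall fun x => ?_)
    have := (hφ0 x).ne'
    have h3 : pot ε v x = φ x / c := by simp only [hφd]; field_simp
    dsimp only
    rw [h3]
    field_simp
  have h3 : form (kern ε) (fun x => v x ^ 7) (fun x => v x ^ 7) =
      (∫ x, v x ^ 7 * φ x ∂nuS) / c := by
    rw [form_eq_integral_pot ε hv (by fun_prop), ← integral_div]
    refine integral_congr_ae (Filter.Eventually.of_forall fun x => ?_)
    simp only [hφd]
    field_simp
  have h4 := integral_pow_le_sph 6 (P := fun x => v x ^ 7 * φ x) (Q := fun x => (φ x)⁻¹ ^ 6)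
    (W := fun x => v x ^ 6) (by fun_prop) (by fun_prop) (by fun_prop)
    (fun x => mul_pos (hf0 x) (hφ0 x)) (fun x => pow_pos (inv_pos.2 (hφ0 x)) 6)
    (fun x => pow_pos (hv0 x) 6) (fun x => by
      have : φ x ≠ 0 := (hφ0 x).ne'
      field_simp
      ring)
  have hI := form_kern_pos hε (f := fun x => v x ^ 7) (g := fun x => v x ^ 7) (by fun_prop)
    (by fun_prop) hf0 hf0
  have hJ := form_kern_pos hε (f := fun x => (φ x)⁻¹ ^ 7) (g := fun x => (φ x)⁻¹ ^ 7) (by fun_prop)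
    (by fun_prop) hg0 hg0
  have hN := integral_pos_sph (f := fun x => v x ^ 6) (by fun_prop) fun x => pow_pos (hv0 x) 6
  have hM := integral_pos_sph (f := fun x => (φ x)⁻¹ ^ 6) (by fun_prop)
    fun x => pow_pos (inv_pos.2 (hφ0 x)) 6
  rw [h2] at h1
  rw [show ∫ x, v x ^ 7 * φ x ∂nuS = c * form (kern ε) (fun x => v x ^ 7) (fun x => v x ^ 7) by
    rw [h3]; field_simp] at h4
  simp only [quot]
  set I := form (kern ε) (fun x => v x ^ 7) (fun x => v x ^ 7)
  set J := form (kern ε) (fun x => (φ x)⁻¹ ^ 7) (fun x => (φ x)⁻¹ ^ 7)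
  set N := ∫ x, v x ^ 6 ∂nuS
  set M := ∫ x, (φ x)⁻¹ ^ 6 ∂nuS
  rw [div_le_div_iff₀ (by positivity) (by positivity)]
  norm_num at h4
  calc J ^ 3 * N ^ 7 ≤ J ^ 3 * ((c * I) ^ 6 * M) := by gcongr
    _ = (J * I) ^ 3 * (I ^ 3 * c ^ 6 * M) := by ring
    _ ≤ ((M / c) ^ 2) ^ 3 * (I ^ 3 * c ^ 6 * M) := by gcongr
    _ = I ^ 3 * M ^ 7 := by field_simp

open BoundedContinuousFunction in
theorem exists_quot_minimizer {ε : ℝ} (hε : 0 < ε) :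
    ∃ v : Sph → ℝ, Continuous v ∧ (∀ x, 0 < v x) ∧
      ∀ w : Sph → ℝ, Continuous w → (∀ x, 0 < w x) → quot ε v ≤ quot ε w := by
  let A : Set (Sph →ᵇ ℝ) := {φ | (∀ x, φ x ∈ Icc ε (2 + ε)) ∧ ∀ x y, |φ x - φ y| ≤ dist x y}
  have hev : ∀ x, Continuous fun φ : Sph →ᵇ ℝ => φ x := fun x => continuous_eval_const x
  have hclosed : IsClosed A := by
    have : A = (⋂ x, (fun φ : Sph →ᵇ ℝ => φ x) ⁻¹' Icc ε (2 + ε)) ∩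
        ⋂ x, ⋂ y, {φ : Sph →ᵇ ℝ | |φ x - φ y| ≤ dist x y} := by
      ext φ; simp [A]
    rw [this]
    exact (isClosed_iInter fun x => isClosed_Icc.preimage (hev x)).inter
      (isClosed_iInter fun x => isClosed_iInter fun y =>
        isClosed_le ((hev x).sub (hev y)).abs continuous_const)
  have hcomp : IsCompact A := by
    refine arzela_ascoli₂ (Icc ε (2 + ε)) isCompact_Icc A hclosed (fun f x hf => hf.1 x) ?_
    exact Metric.equicontinuous_of_continuity_modulus id Filter.tendsto_id _
      fun x y φ => by simpa [Real.dist_eq] using φ.2.2 x y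
  have hne : A.Nonempty := ⟨BoundedContinuousFunction.const _ ε, fun x => by
    constructor <;> simp, fun x y => by simp⟩
  have hpos : ∀ φ ∈ A, ∀ x, 0 < φ x := fun φ hφ x => hε.trans_le (hφ.1 x).1
  have hinv : ∀ φ ∈ A, Continuous fun x => (φ x)⁻¹ := fun φ hφ =>
    φ.continuous.inv₀ fun x => (hpos φ hφ x).ne'
  have hinvle : ∀ φ ∈ A, ∀ x, |(φ x)⁻¹| ≤ ε⁻¹ := fun φ hφ x => by
    rw [abs_of_pos (inv_pos.2 (hpos φ hφ x))]
    exact inv_anti₀ hε (hφ.1 x).1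
  have hinvc : ∀ x, ContinuousOn (fun φ : Sph →ᵇ ℝ => (φ x)⁻¹) A := fun x =>
    (hev x).continuousOn.inv₀ fun φ hφ => (hpos φ hφ x).ne'
  have hN : ContinuousOn (fun φ : Sph →ᵇ ℝ => ∫ x, (φ x)⁻¹ ^ 6 ∂nuS) A := by
    refine continuousOn_of_dominated (bound := fun _ => ε⁻¹ ^ 6)
      (fun φ hφ => ((hinv φ hφ).pow 6).aestronglyMeasurable)
      (fun φ hφ => Filter.Eventually.of_forall fun x => ?_) (integrable_const _)
      (Filter.Eventually.of_forall fun x => (hinvc x).pow 6)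
    rw [Real.norm_eq_abs, abs_pow]
    exact pow_le_pow_left₀ (abs_nonneg _) (hinvle φ hφ x) 6
  have hI : ContinuousOn (fun φ : Sph →ᵇ ℝ =>
      form (kern ε) (fun x => (φ x)⁻¹ ^ 7) fun x => (φ x)⁻¹ ^ 7) A := by
    refine continuousOn_of_dominated (bound := fun _ => (2 + ε) * (ε⁻¹ ^ 7 * ε⁻¹ ^ 7))
      (fun φ hφ => ?_) (fun φ hφ => Filter.Eventually.of_forall fun p => ?_) (integrable_const _)
      (Filter.Eventually.of_forall fun p =>
        continuousOn_const.mul (((hinvc p.1).pow 7).mul ((hinvc p.2).pow 7)))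
    · have h1 : Continuous fun x => (φ x)⁻¹ ^ 7 := (hinv φ hφ).pow 7
      exact ((continuous_kern ε).mul ((h1.comp continuous_fst).mul
        (h1.comp continuous_snd))).aestronglyMeasurable
    · have h1 := hinvle φ hφ
      have h2 : |kern ε p| ≤ 2 + ε := by
        rw [kern, abs_of_nonneg (by positivity)]
        linarith [dist_le_two p.1 p.2]
      rw [Real.norm_eq_abs, abs_mul, abs_mul, abs_pow, abs_pow]
      gcongr <;> exact h1 _
  obtain ⟨φ, hφ, hmin⟩ := hcomp.exists_isMinOn hne
    (f := fun φ : Sph →ᵇ ℝ => quot ε fun x => (φ x)⁻¹) ((hI.pow 3).div (hN.pow 7) fun φ hφ =>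
      (pow_pos (integral_pos_sph ((hinv φ hφ).pow 6)
        fun x => pow_pos (inv_pos.2 (hpos φ hφ x)) 6) 7).ne')
  refine ⟨fun x => (φ x)⁻¹, hinv φ hφ, fun x => inv_pos.2 (hpos φ hφ x), fun w hw hw0 => ?_⟩
  set c := (∫ y, w y ^ 7 ∂nuS)⁻¹ with hc
  have hw7 : Continuous fun y => w y ^ 7 := hw.pow 7
  have hF0 : 0 < ∫ y, w y ^ 7 ∂nuS := integral_pos_sph hw7 fun y => pow_pos (hw0 y) 7
  have hc0 : 0 < c := inv_pos.2 hF0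
  have hbd : ∀ {k l : Sph → ℝ}, Continuous k → Continuous l → (∀ y, k y ≤ l y) →
      ∫ y, k y * w y ^ 7 ∂nuS ≤ ∫ y, l y * w y ^ 7 ∂nuS := fun hk hl h =>
    integral_mono_sph (by fun_prop) (by fun_prop)
      fun y => mul_le_mul_of_nonneg_right (h y) (pow_pos (hw0 y) 7).le
  let χ : Sph →ᵇ ℝ := mkOfCompact ⟨fun x => c * pot ε w x, (continuous_pot ε hw).const_mul c⟩
  have hχ : χ ∈ A := by
    have hlow : ∀ x, ε * (∫ y, w y ^ 7 ∂nuS) ≤ pot ε w x := fun x => by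
      rw [← integral_const_mul]
      exact hbd (k := fun _ => ε) (l := fun y => kern ε (x, y)) (by fun_prop) (by fun_prop)
        fun y => by simp [kern]
    have hup : ∀ x, pot ε w x ≤ (2 + ε) * (∫ y, w y ^ 7 ∂nuS) := fun x => by
      rw [← integral_const_mul]
      exact hbd (k := fun y => kern ε (x, y)) (l := fun _ => 2 + ε) (by fun_prop) (by fun_prop)
        fun y => by simp [kern, dist_le_two]
    have hlip : ∀ x z, pot ε w x ≤ pot ε w z + dist x z * ∫ y, w y ^ 7 ∂nuS := fun x z => by
      rw [← integral_const_mul, pot, pot, ← integral_add_sph (by fun_prop) (by fun_prop)]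
      simp only [← add_mul]
      exact hbd (k := fun y => kern ε (x, y)) (l := fun y => kern ε (z, y) + dist x z)
        (by fun_prop) (by fun_prop) fun y => by
          have := dist_triangle x z y
          simp only [kern]; linarith
    have hcF : c * (∫ y, w y ^ 7 ∂nuS) = 1 := inv_mul_cancel₀ hF0.ne'
    have hl : ∀ x z, c * pot ε w x - c * pot ε w z ≤ dist x z := fun x z => by
      have := mul_le_mul_of_nonneg_left (hlip x z) hc0.le
      linear_combination this + dist x z * hcF
    refine ⟨fun x => ⟨?_, ?_⟩, fun x z => abs_le.2 ⟨?_, ?_⟩⟩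
    · have := mul_le_mul_of_nonneg_left (hlow x) hc0.le
      change ε ≤ c * pot ε w x
      linear_combination this - ε * hcF
    · have := mul_le_mul_of_nonneg_left (hup x) hc0.le
      change c * pot ε w x ≤ 2 + ε
      linear_combination this + (2 + ε) * hcF
    · change -dist x z ≤ c * pot ε w x - c * pot ε w z
      have := hl z x
      rw [dist_comm] at this
      linarith
    · exact hl x z
  exact (hmin hχ).trans (quot_improve hε hw hw0 hc0)

/-- Second-order lower Taylor bound for `(1 + z) ^ (6 / 7)`, written with seventh roots. -/
theorem exists_taylor_bound : ∃ C : ℝ, 0 ≤ C ∧ ∀ y z : ℝ, 0 ≤ y → y ≤ 2 → y ^ 7 = 1 + z →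
    1 + 6 / 7 * z - 3 / 49 * z ^ 2 - C * |z| ^ 3 ≤ y ^ 6 := by
  obtain ⟨C, hC⟩ := (isCompact_Icc (a := (-1 : ℝ)) (b := 1)).exists_bound_of_continuousOn
    (f := fun u : ℝ => 8 + 42 * u + 108 * u ^ 2 + 178 * u ^ 3 + 1464 / 7 * u ^ 4 +
      1287 / 7 * u ^ 5 + 858 / 7 * u ^ 6 + 429 / 7 * u ^ 7 + 156 / 7 * u ^ 8 + 39 / 7 * u ^ 9 +
      6 / 7 * u ^ 10 + 3 / 49 * u ^ 11) (by fun_prop)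
  have hC0 : 0 ≤ C := (norm_nonneg _).trans (hC 0 (by norm_num))
  refine ⟨C, hC0, fun y z hy hy2 hz => ?_⟩
  have hq := hC (y - 1) ⟨by linarith, by linarith⟩
  rw [Real.norm_eq_abs] at hq
  set q := 8 + 42 * (y - 1) + 108 * (y - 1) ^ 2 + 178 * (y - 1) ^ 3 + 1464 / 7 * (y - 1) ^ 4 +
      1287 / 7 * (y - 1) ^ 5 + 858 / 7 * (y - 1) ^ 6 + 429 / 7 * (y - 1) ^ 7 +
      156 / 7 * (y - 1) ^ 8 + 39 / 7 * (y - 1) ^ 9 +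
      6 / 7 * (y - 1) ^ 10 + 3 / 49 * (y - 1) ^ 11 with hqd
  have hzy : z = (y - 1) * (1 + y + y ^ 2 + y ^ 3 + y ^ 4 + y ^ 5 + y ^ 6) := by
    linear_combination -hz
  have h1 : |y - 1| ≤ |z| := by
    rw [hzy, abs_mul]
    refine le_mul_of_one_le_right (abs_nonneg _) ?_
    rw [abs_of_nonneg (by positivity)]
    nlinarith [pow_nonneg hy 2, pow_nonneg hy 3, pow_nonneg hy 4, pow_nonneg hy 5, pow_nonneg hy 6]
  have h2 : y ^ 6 - (1 + 6 / 7 * z - 3 / 49 * z ^ 2) = (y - 1) ^ 3 * q := by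
    rw [hqd, show z = y ^ 7 - 1 by linarith]
    ring
  have h3 : |(y - 1) ^ 3 * q| ≤ C * |z| ^ 3 := by
    rw [abs_mul, abs_pow, mul_comm]
    gcongr
  have h4 := (abs_le.1 h3).1
  linarith

theorem coeffs_of_nonneg {α β C s₀ : ℝ} (hs₀ : 0 < s₀)
    (h : ∀ s, |s| ≤ s₀ → 0 ≤ α * s + β * s ^ 2 + C * |s| ^ 3) : α = 0 ∧ 0 ≤ β := by
  have hI : Ioc 0 s₀ ∈ nhdsWithin (0 : ℝ) (Ioi 0) := Ioc_mem_nhdsGT hs₀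
  have hz : Filter.Tendsto (fun s : ℝ => s) (nhdsWithin 0 (Ioi 0)) (nhds 0) :=
    nhdsWithin_le_nhds
  have h1 : 0 ≤ α := by
    have hl : Filter.Tendsto (fun s => α + β * s + C * s ^ 2) (nhdsWithin 0 (Ioi 0)) (nhds α) := by
      simpa using ((hz.const_mul β).const_add α).add ((hz.pow 2).const_mul C)
    refine ge_of_tendsto hl (Filter.mem_of_superset hI fun s hs => ?_)
    have := h s (by rw [abs_of_pos hs.1]; exact hs.2)
    rw [abs_of_pos hs.1] at this
    exact nonneg_of_mul_nonneg_right (by linear_combination this) hs.1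
  have h2 : 0 ≤ -α := by
    have hl : Filter.Tendsto (fun s => -α + β * s + C * s ^ 2) (nhdsWithin 0 (Ioi 0))
        (nhds (-α)) := by
      simpa using ((hz.const_mul β).const_add (-α)).add ((hz.pow 2).const_mul C)
    refine ge_of_tendsto hl (Filter.mem_of_superset hI fun s hs => ?_)
    have := h (-s) (by rw [abs_neg, abs_of_pos hs.1]; exact hs.2)
    rw [abs_neg, abs_of_pos hs.1] at this
    exact nonneg_of_mul_nonneg_right (by linear_combination this) hs.1
  have h0 : α = 0 := by linarith
  refine ⟨h0, ?_⟩
  have hl : Filter.Tendsto (fun s => β + C * s) (nhdsWithin 0 (Ioi 0)) (nhds β) := by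
    simpa using (hz.const_mul C).const_add β
  refine ge_of_tendsto hl (Filter.mem_of_superset hI fun s hs => ?_)
  have := h s (by rw [abs_of_pos hs.1]; exact hs.2)
  rw [abs_of_pos hs.1, h0] at this
  exact nonneg_of_mul_nonneg_right (by linear_combination this) (pow_pos hs.1 2)

theorem bernoulli_of_pow_le {x y : ℝ} (hx : 0 < x) (hy : 0 < y) (h : y ^ 7 ≤ x ^ 3) :
    1 + 7 / 3 * (y - 1) ≤ x := by
  have h1 := one_add_mul_self_le_rpow_one_add (s := y - 1) (p := 7 / 3) (by linarith) (by norm_num)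
  refine h1.trans ?_
  rw [add_sub_cancel]
  refine (pow_le_pow_iff_left₀ (by positivity) hx.le three_ne_zero).1 ?_
  rw [← Real.rpow_natCast, ← Real.rpow_mul hy.le]
  norm_num
  exact_mod_cast h

/-- First and second variation at a minimizer of `quot ε`. -/
theorem variation {ε : ℝ} (hε : 0 < ε) {v : Sph → ℝ} (hv : Continuous v) (hv0 : ∀ x, 0 < v x)
    (hmin : ∀ w : Sph → ℝ, Continuous w → (∀ x, 0 < w x) → quot ε v ≤ quot ε w)
    {η : Sph → ℝ} (hη : Continuous η) {I N : ℝ}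
    (hI : I = form (kern ε) (fun x => v x ^ 7) (fun x => v x ^ 7))
    (hN : N = ∫ x, v x ^ 6 ∂nuS) :
    form (kern ε) (fun x => v x ^ 7) (fun x => v x ^ 7 * η x) =
        I / N * ∫ x, v x ^ 6 * η x ∂nuS ∧
      -(1 / 7) * (I / N) * ∫ x, v x ^ 6 * η x ^ 2 ∂nuS ≤
        form (kern ε) (fun x => v x ^ 7 * η x) (fun x => v x ^ 7 * η x) := by
  obtain ⟨M, hM0, hM⟩ := exists_bound_sph hη
  obtain ⟨C, hC0, hC⟩ := exists_taylor_bound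
  have hI0 : 0 < I := hI ▸ form_kern_pos hε (by fun_prop) (by fun_prop)
    (fun x => pow_pos (hv0 x) 7) fun x => pow_pos (hv0 x) 7
  have hN0 : 0 < N := hN ▸ integral_pos_sph (by fun_prop) fun x => pow_pos (hv0 x) 6
  set a := form (kern ε) (fun x => v x ^ 7) (fun x => v x ^ 7 * η x) with ha
  set b := form (kern ε) (fun x => v x ^ 7 * η x) (fun x => v x ^ 7 * η x) with hb
  set n₁ := ∫ x, v x ^ 6 * η x ∂nuS with hn₁
  set n₂ := ∫ x, v x ^ 6 * η x ^ 2 ∂nuS with hn₂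
  have key : ∀ s, |s| ≤ 1 / (2 * (M + 1)) → 0 ≤ (2 * (a - I / N * n₁)) * s +
      (b + 1 / 7 * (I / N) * n₂) * s ^ 2 + (7 / 3 * I * C * M ^ 3) * |s| ^ 3 := by
    intro s hs
    have hsη : ∀ x, |s * η x| ≤ 1 / 2 := fun x => by
      rw [abs_mul]
      calc |s| * |η x| ≤ 1 / (2 * (M + 1)) * (M + 1) := by
            gcongr
            linarith [hM x]
        _ = 1 / 2 := by field_simp
    have hp : ∀ x, 0 < 1 + s * η x := fun x => by linarith [(abs_le.1 (hsη x)).1]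
    have hp2 : ∀ x, 1 + s * η x ≤ 2 := fun x => by linarith [(abs_le.1 (hsη x)).2]
    set y : Sph → ℝ := fun x => (1 + s * η x) ^ ((1 : ℝ) / 7) with hy
    have hy0 : ∀ x, 0 < y x := fun x => Real.rpow_pos_of_pos (hp x) _
    have hyc : Continuous y := Continuous.rpow_const (by fun_prop) fun x => Or.inl (hp x).ne'
    have hy7 : ∀ x, y x ^ 7 = 1 + s * η x := fun x => by
      simp only [hy]
      rw [← Real.rpow_natCast, ← Real.rpow_mul (hp x).le]
      norm_num
    have hy2 : ∀ x, y x ≤ 2 := fun x => by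
      by_contra! hc
      have : (2 : ℝ) ^ 7 < y x ^ 7 := by gcongr
      rw [hy7] at this
      linarith [hp2 x]
    have hw0 : ∀ x, 0 < v x * y x := fun x => mul_pos (hv0 x) (hy0 x)
    have h1 := hmin (fun x => v x * y x) (by fun_prop) hw0
    have h7 : (fun x => (v x * y x) ^ 7) = fun x => v x ^ 7 + s * (v x ^ 7 * η x) := by
      ext x; rw [mul_pow, hy7]; ring
    have hIs := form_kern_pos hε (f := fun x => (v x * y x) ^ 7) (g := fun x => (v x * y x) ^ 7)
      (by fun_prop) (by fun_prop) (fun x => pow_pos (hw0 x) 7) fun x => pow_pos (hw0 x) 7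
    have hNs := integral_pos_sph (f := fun x => (v x * y x) ^ 6) (by fun_prop)
      fun x => pow_pos (hw0 x) 6
    simp only [quot] at h1
    rw [h7, form_quadratic (by fun_prop) (kern_comm ε) (by fun_prop) (by fun_prop), ← hI, ← ha,
      ← hb] at hIs h1
    rw [← hN] at h1
    have hNge : N + 6 / 7 * s * n₁ - 3 / 49 * s ^ 2 * n₂ - C * M ^ 3 * |s| ^ 3 * N ≤
        ∫ x, (v x * y x) ^ 6 ∂nuS := by
      have h2 : N + 6 / 7 * s * n₁ - 3 / 49 * s ^ 2 * n₂ - C * M ^ 3 * |s| ^ 3 * N =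
          ∫ x, (v x ^ 6 + 6 / 7 * s * (v x ^ 6 * η x) - 3 / 49 * s ^ 2 * (v x ^ 6 * η x ^ 2) -
            C * M ^ 3 * |s| ^ 3 * v x ^ 6) ∂nuS := by
        rw [integral_sub_sph (by fun_prop) (by fun_prop), integral_sub_sph (by fun_prop)
          (by fun_prop), integral_add_sph (by fun_prop) (by fun_prop), integral_const_mul,
          integral_const_mul, integral_const_mul, ← hN]
      rw [h2]
      refine integral_mono_sph (by fun_prop) (by fun_prop) fun x => ?_
      have h3 := hC (y x) (s * η x) (hy0 x).le (hy2 x) (hy7 x)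
      have h4 : |s * η x| ^ 3 ≤ |s| ^ 3 * M ^ 3 := by
        rw [abs_mul, mul_pow]
        have := hM x
        gcongr
      have h5 : 1 + 6 / 7 * (s * η x) - 3 / 49 * (s * η x) ^ 2 - C * (|s| ^ 3 * M ^ 3) ≤
          y x ^ 6 := (by gcongr : _ ≤ _).trans h3
      have h6 := mul_le_mul_of_nonneg_left h5 (pow_pos (hv0 x) 6).le
      rw [mul_pow]
      linear_combination h6
    set Ns := ∫ x, (v x * y x) ^ 6 ∂nuS
    set Is := I + 2 * s * a + s ^ 2 * b with hIsd
    have h8 := bernoulli_of_pow_le (x := Is / I) (y := Ns / N) (by positivity) (by positivity) (by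
      rw [div_le_div_iff₀ (by positivity) (by positivity)] at h1
      rw [div_pow, div_pow, div_le_div_iff₀ (by positivity) (by positivity)]
      linarith)
    have h9 : Is = I * (Is / I) := by field_simp
    have h10 : I * (1 + 7 / 3 * (Ns / N - 1)) ≤ Is := by
      rw [h9]; gcongr
    have h11 : 7 / 3 * (I / N) * (6 / 7 * s * n₁ - 3 / 49 * s ^ 2 * n₂ -
        C * M ^ 3 * |s| ^ 3 * N) ≤ 7 / 3 * (I / N) * (Ns - N) :=
      mul_le_mul_of_nonneg_left (by linarith) (by positivity)
    have h12 : I * (1 + 7 / 3 * (Ns / N - 1)) = I + 7 / 3 * (I / N) * (Ns - N) := by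
      field_simp
    have h13 : I / N * N = I := by field_simp
    rw [h12, hIsd] at h10
    linear_combination h10 + h11 + 7 / 3 * C * M ^ 3 * |s| ^ 3 * h13
  obtain ⟨h1, h2⟩ := coeffs_of_nonneg (by positivity) key
  exact ⟨by linarith, by linarith⟩

/-- The Euler–Lagrange equation of a minimizer of `quot ε`. -/
theorem euler_lagrange {ε : ℝ} (hε : 0 < ε) {v : Sph → ℝ} (hv : Continuous v)
    (hv0 : ∀ x, 0 < v x)
    (hmin : ∀ w : Sph → ℝ, Continuous w → (∀ x, 0 < w x) → quot ε v ≤ quot ε w) :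
    ∃ c : ℝ, ∀ᵐ x ∂nuS, v x * pot ε v x = c := by
  have hp := continuous_pot ε hv
  refine ⟨form (kern ε) (fun x => v x ^ 7) (fun x => v x ^ 7) / ∫ x, v x ^ 6 ∂nuS, ?_⟩
  set c := form (kern ε) (fun x => v x ^ 7) (fun x => v x ^ 7) / ∫ x, v x ^ 6 ∂nuS with hc
  have h1 := (variation hε hv hv0 hmin (η := fun x => v x * pot ε v x - c) (by fun_prop) rfl rfl).1
  rw [form_comm (kern_comm ε), form_eq_integral_pot ε hv (by fun_prop), ← hc,
    ← integral_const_mul, ← sub_eq_zero, ← integral_sub_sph (by fun_prop) (by fun_prop),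
    integral_eq_zero_iff_of_nonneg (fun x => ?_) (Continuous.integrable_nuS (by fun_prop))] at h1
  · filter_upwards [h1] with x hx
    have h2 : v x ^ 6 * (v x * pot ε v x - c) ^ 2 = 0 := by
      simp only [Pi.zero_apply] at hx
      linear_combination hx
    have h3 := pow_eq_zero_iff two_ne_zero |>.1
      ((mul_eq_zero.1 h2).resolve_left (pow_pos (hv0 x) 6).ne')
    linarith
  · have := mul_nonneg (pow_pos (hv0 x) 6).le (sq_nonneg (v x * pot ε v x - c))
    simp only [Pi.zero_apply]
    linear_combination this

theorem sum_dj_mul (x y z : Sph) : ∑ a, dj a x y * dj a x z = dot y z - dot x y * dot x z := by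
  have h1 := x.sum_sq
  simp only [Fin.sum_univ_three, dj, dot]
  simp
  linear_combination (y.1 0 * z.1 0 + y.1 1 * z.1 1 + y.1 2 * z.1 2 + y.1 3 * z.1 3) * h1

theorem sq_dot_sub_le (x y z : Sph) :
    (dot y z - dot x y * dot x z) ^ 2 ≤ 1 - dot x z ^ 2 := by
  have h := Finset.sum_mul_sq_le_sq_mul_sq Finset.univ (fun a => dj a x y) fun a => dj a x z
  rw [sum_dj_mul, sum_dj_sq, sum_dj_sq] at h
  refine h.trans (mul_le_of_le_one_left ?_ (by nlinarith))
  nlinarith [dot_le_one x z, neg_one_le_dot x z]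

/-- Integration by parts along the gradient of a linear function. -/
theorem FlowDeriv.integral_conformal {F : Sph → ℝ} {G : Fin 3 → Sph → ℝ} (hF : Continuous F)
    (hG : ∀ a, Continuous (G a)) (h : ∀ a, FlowDeriv (ub a) F (G a)) (e : Sph) :
    ∫ x, ∑ a, dj a x e * G a x ∂nuS = 3 * ∫ x, dot x e * F x ∂nuS := by
  have hd : ∀ a, Continuous fun x => dj a x e := fun a =>
    (continuous_dj a).comp (by fun_prop : Continuous fun x : Sph => (x, e))
  rw [integral_sum_sph _ fun a _ => (hd a).fun_mul (hG a)]
  have h1 : ∀ a, ∫ x, dj a x e * G a x ∂nuS = ∫ x, dot x e * F x ∂nuS := fun a => by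
    have := (h a).integral_mul_add (flowDeriv_dj a e) hF (hG a) (hd a) (by fun_prop)
    simp only [mul_neg, integral_neg, neg_neg] at this
    simpa only [mul_comm] using this
  simp [h1]

/-- A sequence decreasing to `2`. -/
def tk (n : ℕ) : ℝ := 2 + 1 / ((n : ℝ) + 1)

theorem two_lt_tk (n : ℕ) : 2 < tk n := lt_add_of_pos_right _ (by positivity)

theorem tk_le_three (n : ℕ) : tk n ≤ 3 := by
  have : 1 / ((n : ℝ) + 1) ≤ 1 := by
    rw [div_le_one (by positivity)]; linarith [(Nat.cast_nonneg n : (0 : ℝ) ≤ n)]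
  simp only [tk]; linarith

theorem tendsto_tk : Filter.Tendsto tk Filter.atTop (nhds 2) := by
  have := (tendsto_one_div_add_atTop_nhds_zero_nat (𝕜 := ℝ)).const_add 2
  rwa [add_zero] at this

/-- The regularized squared distance. -/
def rr (n : ℕ) (p : Sph × Sph) : ℝ := tk n - 2 * dot p.1 p.2

theorem rr_pos (n : ℕ) (p : Sph × Sph) : 0 < rr n p := kernel_pos (two_lt_tk n) _ _

theorem sq_dist_le_rr (n : ℕ) (p : Sph × Sph) : 2 - 2 * dot p.1 p.2 ≤ rr n p := by
  simp only [rr]; linarith [two_lt_tk n]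

theorem rr_le (n : ℕ) (p : Sph × Sph) : rr n p ≤ 5 := by
  simp only [rr]; linarith [tk_le_three n, neg_one_le_dot p.1 p.2]

theorem continuous_rr_rpow (n : ℕ) (a : ℝ) : Continuous fun p => rr n p ^ a :=
  continuous_kernel (two_lt_tk n) a

theorem tendsto_rr (p : Sph × Sph) :
    Filter.Tendsto (fun n => rr n p) Filter.atTop (nhds (dist p.1 p.2 ^ 2)) := by
  rw [dist_sq]
  exact tendsto_tk.sub_const _

theorem tendsto_rr_rpow (p : Sph × Sph) {a : ℝ} (h : p.1 ≠ p.2 ∨ 0 < a) :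
    Filter.Tendsto (fun n => rr n p ^ a) Filter.atTop (nhds ((dist p.1 p.2 ^ 2) ^ a)) :=
  (tendsto_rr p).rpow_const (h.imp (fun h => pow_ne_zero 2 (dist_ne_zero.2 h)) le_of_lt)

theorem sq_dist_rpow_half (x y : Sph) : (dist x y ^ 2) ^ (1 / 2 : ℝ) = dist x y := by
  rw [← Real.sqrt_eq_rpow, Real.sqrt_sq dist_nonneg]

theorem tendsto_form {kn : ℕ → Sph × Sph → ℝ} {k : Sph × Sph → ℝ} {C : ℝ}
    (hc : ∀ n, Continuous (kn n)) (hb : ∀ n p, |kn n p| ≤ C)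
    (hl : ∀ p, Filter.Tendsto (fun n => kn n p) Filter.atTop (nhds (k p))) {f g : Sph → ℝ}
    (hf : Continuous f) (hg : Continuous g) :
    Filter.Tendsto (fun n => form (kn n) f g) Filter.atTop (nhds (form k f g)) := by
  refine tendsto_integral_of_dominated_convergence (fun p => C * |f p.1 * g p.2|)
    (fun n => ?_) (integrable_prod_sph (by fun_prop)) (fun n => ?_) ?_
  · have := hc n
    exact Continuous.aestronglyMeasurable (by fun_prop)
  · refine Filter.Eventually.of_forall fun p => ?_
    rw [Real.norm_eq_abs, abs_mul]
    exact mul_le_mul_of_nonneg_right (hb n p) (abs_nonneg _)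
  · exact Filter.Eventually.of_forall fun p => (hl p).mul_const _

theorem form_swap (k : Sph × Sph → ℝ) (f : Sph → ℝ) :
    form k f f = form (fun p => k (p.2, p.1)) f f := by
  rw [form, ← integral_prod_swap]
  refine integral_congr_ae (Filter.Eventually.of_forall fun p => ?_)
  simp only [Prod.fst_swap, Prod.snd_swap]
  rw [show p.swap = (p.2, p.1) from rfl, mul_comm (f p.2)]

theorem form_const_mul (c : ℝ) (k : Sph × Sph → ℝ) (f g : Sph → ℝ) :
    form (fun p => c * k p) f g = c * form k f g := by
  rw [form, form, ← integral_const_mul]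
  exact integral_congr_ae (Filter.Eventually.of_forall fun p => by ring)

/-- The kernel of the derivative of the regularized potential along `∇⟨·, e⟩`. -/
def pk (e : Sph) (n : ℕ) (p : Sph × Sph) : ℝ :=
  -(rr n p ^ (1 / 2 - 1 : ℝ) * (dot e p.2 - dot p.1 e * dot p.1 p.2))

theorem continuous_pk (e : Sph) (n : ℕ) : Continuous (pk e n) := by
  have := continuous_rr_rpow n (1 / 2 - 1)
  unfold pk
  fun_prop

theorem rr_rpow_half_mul (n : ℕ) (p : Sph × Sph) :
    rr n p ^ (1 / 2 - 1 : ℝ) * sqrt (rr n p) = 1 := by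
  rw [Real.sqrt_eq_rpow, ← Real.rpow_add (rr_pos n p)]
  norm_num

theorem abs_pk_le (e : Sph) (n : ℕ) (p : Sph × Sph) : |pk e n p| ≤ 1 := by
  have h1 := sq_dot_sub_le p.1 e p.2
  have h2 : |dot e p.2 - dot p.1 e * dot p.1 p.2| ≤ sqrt (rr n p) := by
    refine Real.abs_le_sqrt (h1.trans ?_)
    have := sq_dist_le_rr n p
    nlinarith [dot_le_one p.1 p.2]
  have h3 : 0 < rr n p ^ (1 / 2 - 1 : ℝ) := Real.rpow_pos_of_pos (rr_pos n p) _
  rw [pk, abs_neg, abs_mul, abs_of_pos h3]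
  exact (mul_le_mul_of_nonneg_left h2 h3.le).trans_eq (rr_rpow_half_mul n p)

theorem exists_tendsto_pk (e : Sph) : ∃ k : Sph × Sph → ℝ, ∀ p,
    Filter.Tendsto (fun n => pk e n p) Filter.atTop (nhds (k p)) := by
  refine ⟨fun p => -((dist p.1 p.2 ^ 2) ^ (1 / 2 - 1 : ℝ) *
    (dot e p.2 - dot p.1 e * dot p.1 p.2)), fun p => ?_⟩
  by_cases h : p.1 = p.2
  · have : dot e p.2 - dot p.1 e * dot p.1 p.2 = 0 := by
      rw [h, dot_self, dot_comm e]; ring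
    simp [pk, this]
  · exact ((tendsto_rr_rpow p (Or.inl h)).mul_const _).neg

theorem form_pk (e : Sph) (n : ℕ) {f : Sph → ℝ} (hf : Continuous f) :
    form (pk e n) f f =
      -form (fun p => rr n p ^ (1 / 2 - 1 : ℝ) * (1 - dot p.1 p.2) * dot p.1 e) f f := by
  have hr := continuous_rr_rpow n (1 / 2 - 1)
  have h1 := form_swap (pk e n) f
  have h2 := form_swap (fun p => rr n p ^ (1 / 2 - 1 : ℝ) * (1 - dot p.1 p.2) * dot p.1 e) f
  have hr' : Continuous fun p : Sph × Sph => rr n (p.2, p.1) ^ (1 / 2 - 1 : ℝ) :=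
    hr.comp continuous_swap
  have hp := continuous_pk e n
  have h3 := form_add_kernel hp (l := fun p => pk e n (p.2, p.1))
    (hp.comp continuous_swap) hf hf
  have h4 := form_add_kernel
    (k := fun p => rr n p ^ (1 / 2 - 1 : ℝ) * (1 - dot p.1 p.2) * dot p.1 e)
    (l := fun p => rr n (p.2, p.1) ^ (1 / 2 - 1 : ℝ) * (1 - dot p.2 p.1) * dot p.2 e)
    (by fun_prop) (by fun_prop) hf hf
  have h5 : form (fun p => pk e n p + pk e n (p.2, p.1)) f f =
      -form (fun p => rr n p ^ (1 / 2 - 1 : ℝ) * (1 - dot p.1 p.2) * dot p.1 e +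
        rr n (p.2, p.1) ^ (1 / 2 - 1 : ℝ) * (1 - dot p.2 p.1) * dot p.2 e) f f := by
    rw [← neg_one_mul, ← form_const_mul]
    congr 1
    ext p
    have h6 : rr n (p.2, p.1) = rr n p := by simp [rr, dot_comm]
    simp only [pk]
    rw [h6, dot_comm p.2 p.1, dot_comm e, dot_comm e]
    ring
  linarith

theorem tendsto_form_pk (e : Sph) {f : Sph → ℝ} (hf : Continuous f) :
    Filter.Tendsto (fun n => form (pk e n) f f) Filter.atTop
      (nhds (-(1 / 2) * form (fun p => dist p.1 p.2 * dot p.1 e) f f)) := by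
  simp only [form_pk e _ hf]
  rw [neg_mul, ← form_const_mul]
  refine (tendsto_form (C := 5) (fun n => ?_) (fun n p => ?_) (fun p => ?_) hf hf).neg
  · have := continuous_rr_rpow n (1 / 2 - 1)
    fun_prop
  · have h1 := dot_le_one p.1 p.2
    have h2 := sq_dist_le_rr n p
    have h3 : 0 < rr n p ^ (1 / 2 - 1 : ℝ) := Real.rpow_pos_of_pos (rr_pos n p) _
    have h4 : sqrt (rr n p) ≤ 5 := Real.sqrt_le_iff.2 ⟨by norm_num, by linarith [rr_le n p]⟩
    rw [abs_mul, abs_mul, abs_of_pos h3, abs_of_nonneg (by linarith : 0 ≤ 1 - dot p.1 p.2)]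
    calc _ ≤ rr n p ^ (1 / 2 - 1 : ℝ) * (sqrt (rr n p) * sqrt (rr n p)) * 1 := by
          rw [Real.mul_self_sqrt (rr_pos n p).le]
          exact mul_le_mul (mul_le_mul_of_nonneg_left (by linarith) h3.le) (abs_dot_le_one p.1 e)
            (abs_nonneg _) (mul_nonneg h3.le (rr_pos n p).le)
      _ = sqrt (rr n p) := by rw [← mul_assoc, rr_rpow_half_mul]; ring
      _ ≤ 5 := h4
  · by_cases h : p.1 = p.2
    · simp [h, dot_self]
    · have h1 := ((tendsto_rr_rpow p (a := 1 / 2 - 1) (Or.inl h)).mul_const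
        (1 - dot p.1 p.2)).mul_const (dot p.1 e)
      convert h1 using 2
      have hd : 0 < dist p.1 p.2 := dist_pos.2 h
      rw [Real.rpow_sub_one (by positivity), sq_dist_rpow_half,
        show 1 - dot p.1 p.2 = dist p.1 p.2 ^ 2 / 2 by rw [dist_sq]; ring]
      field_simp

/-- A minimizer of `quot ε` is centered. -/
theorem centered {ε : ℝ} (hε : 0 < ε) {v : Sph → ℝ} (hv : Continuous v) (hv0 : ∀ x, 0 < v x)
    {c : ℝ} (hc : ∀ᵐ x ∂nuS, v x * pot ε v x = c) (e : Sph) :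
    ∫ x, dot x e * v x ^ 7 ∂nuS = 0 := by
  have hf : Continuous fun x => v x ^ 7 := by fun_prop
  have hf0 : ∀ x, 0 < v x ^ 7 := fun x => pow_pos (hv0 x) 7
  set m := ∫ x, v x ^ 7 ∂nuS with hm
  have hm0 : 0 < m := integral_pos_sph hf hf0
  set φ : ℕ → Sph → ℝ := fun n x => psi (tk n) (1 / 2) (fun y => v y ^ 7) x + ε * m with hφ
  have hφc : ∀ n, Continuous (φ n) := fun n =>
    (continuous_psi (two_lt_tk n) _ hf).add continuous_const
  have hφge : ∀ n x, ε * m ≤ φ n x := fun n x => le_add_of_nonneg_left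
    (integral_nonneg fun y => mul_nonneg
      (Real.rpow_nonneg (kernel_pos (two_lt_tk n) x y).le _) (hf0 y).le)
  have hφ0 : ∀ n x, 0 < φ n x := fun n x => (mul_pos hε hm0).trans_le (hφge n x)
  have hφi : ∀ n, Continuous fun x => (φ n x)⁻¹ := fun n =>
    (hφc n).inv₀ fun x => (hφ0 n x).ne'
  have hφil : ∀ n x, |(φ n x)⁻¹| ≤ (ε * m)⁻¹ := fun n x => by
    rw [abs_of_pos (inv_pos.2 (hφ0 n x))]
    exact inv_anti₀ (mul_pos hε hm0) (hφge n x)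
  have hpot : ∀ x, pot ε v x = ∫ y, dist x y * v y ^ 7 ∂nuS + ε * m := fun x => by
    simp only [pot, kern, add_mul]
    rw [integral_add_sph (by fun_prop) (by fun_prop), integral_const_mul]
  have hφlim : ∀ x, Filter.Tendsto (fun n => φ n x) Filter.atTop (nhds (pot ε v x)) := by
    intro x
    rw [hpot]
    refine Filter.Tendsto.add_const _ (tendsto_integral_of_dominated_convergence
      (fun y => 5 * v y ^ 7) (fun n => ?_) (Continuous.integrable_nuS (by fun_prop))
      (fun n => Filter.Eventually.of_forall fun y => ?_) (Filter.Eventually.of_forall fun y => ?_))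
    · exact ((continuous_slice (k := fun x y => (tk n - 2 * dot x y) ^ (1 / 2 : ℝ))
        (continuous_kernel (two_lt_tk n) _) x).mul hf).aestronglyMeasurable
    · have h1 : 0 ≤ (tk n - 2 * dot x y) ^ (1 / 2 : ℝ) :=
        Real.rpow_nonneg (kernel_pos (two_lt_tk n) x y).le _
      have h2 : (tk n - 2 * dot x y) ^ (1 / 2 : ℝ) ≤ 5 := by
        rw [← Real.sqrt_eq_rpow]
        exact Real.sqrt_le_iff.2 ⟨by norm_num, by linarith [tk_le_three n, neg_one_le_dot x y]⟩
      rw [Real.norm_eq_abs, abs_of_nonneg (mul_nonneg h1 (hf0 y).le)]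
      exact mul_le_mul_of_nonneg_right h2 (hf0 y).le
    · have := tendsto_rr_rpow (x, y) (a := 1 / 2) (Or.inr (by norm_num))
      rw [sq_dist_rpow_half] at this
      exact this.mul_const _
  obtain ⟨k, hk⟩ := exists_tendsto_pk e
  set P : ℕ → Sph → ℝ := fun n x => ∫ y, pk e n (x, y) * v y ^ 7 ∂nuS with hP
  set P₀ : Sph → ℝ := fun x => ∫ y, k (x, y) * v y ^ 7 ∂nuS with hP₀
  have hpkc : ∀ n, Continuous fun p : Sph × Sph => pk e n (p.1, p.2) * v p.2 ^ 7 := fun n => by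
    have := continuous_pk e n
    fun_prop
  have hPc : ∀ n, Continuous (P n) := fun n => continuous_integral_kernel (hpkc n)
  have hPle : ∀ n x, |P n x| ≤ m := fun n x => by
    refine (abs_integral_le_integral_abs).trans (integral_mono_sph
      (continuous_slice (k := fun x y => pk e n (x, y) * v y ^ 7) (hpkc n) x).abs hf fun y => ?_)
    rw [abs_mul, abs_of_pos (hf0 y)]
    exact mul_le_of_le_one_left (hf0 y).le (abs_pk_le e n _)
  have hPlim : ∀ x, Filter.Tendsto (fun n => P n x) Filter.atTop (nhds (P₀ x)) := fun x => by
    refine tendsto_integral_of_dominated_convergence (fun y => v y ^ 7) (fun n => ?_)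
      hf.integrable_nuS (fun n => Filter.Eventually.of_forall fun y => ?_)
      (Filter.Eventually.of_forall fun y => (hk _).mul_const _)
    · exact (continuous_slice (k := fun x y => pk e n (x, y) * v y ^ 7)
        (hpkc n) x).aestronglyMeasurable
    · rw [Real.norm_eq_abs, abs_mul, abs_of_pos (hf0 y)]
      exact mul_le_of_le_one_left (hf0 y).le (abs_pk_le e n _)
  have hparts : ∀ n, ∫ x, (φ n x)⁻¹ ^ 7 * P n x ∂nuS =
      -(1 / 2) * ∫ x, dot x e * (φ n x)⁻¹ ^ 6 ∂nuS := fun n => by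
    have hC := isC2_psi (two_lt_tk n) (1 / 2) hf
    have hGc := hC.contG
    set G := fun (b : Fin 3) (x : Sph) =>
      ∫ y, -2 * (1 / 2) * (tk n - 2 * dot x y) ^ (1 / 2 - 1 : ℝ) * dj b x y * v y ^ 7 ∂nuS with hG
    have hd : ∀ a, FlowDeriv (ub a) (fun x => (φ n x)⁻¹ ^ 6)
        fun x => -6 * (φ n x)⁻¹ ^ 7 * G a x := fun a => by
      have h1 : FlowDeriv (ub a) (φ n) (G a) := fun x =>
        (flowDeriv_ub (hC.grad (ub a)) x).add_const _
      refine h1.comp (g := fun t => t⁻¹ ^ 6) (g' := fun t => -6 * t⁻¹ ^ 7) fun x => ?_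
      have h2 := (hasDerivAt_inv (hφ0 n x).ne').pow 6
      refine h2.congr_deriv ?_
      have := (hφ0 n x).ne'
      norm_num
      field_simp
    have h1 := FlowDeriv.integral_conformal (by have := hφi n; fun_prop)
      (G := fun a x => -6 * (φ n x)⁻¹ ^ 7 * G a x)
      (fun a => ((((hφi n).pow 7).const_mul (-6)).fun_mul (hGc a))) hd e
    have h2 : ∀ x, ∑ a, dj a x e * (-6 * (φ n x)⁻¹ ^ 7 * G a x) =
        -6 * ((φ n x)⁻¹ ^ 7 * P n x) := fun x => by
      have h3 : P n x = ∑ a, dj a x e * G a x := by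
        have hs : ∀ a, Continuous fun y => dj a x e * (-2 * (1 / 2) *
            (tk n - 2 * dot x y) ^ (1 / 2 - 1 : ℝ) * dj a x y * v y ^ 7) := fun a => by
          have h4 := continuous_slice (k := fun x y => (tk n - 2 * dot x y) ^ (1 / 2 - 1 : ℝ))
            (continuous_kernel (two_lt_tk n) _) x
          have h5 := continuous_slice (k := fun x y => dj a x y) (continuous_dj a) x
          fun_prop
        simp only [hG, ← integral_const_mul]
        rw [← integral_sum_sph _ fun a _ => hs a]
        refine integral_congr_ae (Filter.Eventually.of_forall fun y => ?_)
        simp only [pk, rr]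
        rw [← sum_dj_mul, Fin.sum_univ_three, Fin.sum_univ_three]
        ring
      rw [h3, Finset.mul_sum, Finset.mul_sum]
      exact Finset.sum_congr rfl fun a _ => by ring
    simp only [h2] at h1
    rw [integral_const_mul] at h1
    linarith
  have hpos : ∀ x, 0 < pot ε v x := pot_pos hε hv hv0
  have hinv : ∀ x, Filter.Tendsto (fun n => (φ n x)⁻¹) Filter.atTop (nhds (pot ε v x)⁻¹) :=
    fun x => (hφlim x).inv₀ (hpos x).ne'
  have hpow : ∀ (j n : ℕ) (x : Sph), |(φ n x)⁻¹ ^ j| ≤ (ε * m)⁻¹ ^ j := fun j n x => by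
    rw [abs_pow]
    exact pow_le_pow_left₀ (abs_nonneg _) (hφil n x) j
  have hb0 : 0 < (ε * m)⁻¹ := inv_pos.2 (mul_pos hε hm0)
  have hl1 : Filter.Tendsto (fun n => ∫ x, (φ n x)⁻¹ ^ 7 * P n x ∂nuS) Filter.atTop
      (nhds (∫ x, (pot ε v x)⁻¹ ^ 7 * P₀ x ∂nuS)) := by
    refine tendsto_integral_of_dominated_convergence (fun _ => (ε * m)⁻¹ ^ 7 * m) (fun n => ?_)
      (integrable_const _) (fun n => Filter.Eventually.of_forall fun x => ?_)
      (Filter.Eventually.of_forall fun x => ((hinv x).pow 7).mul (hPlim x))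
    · exact (((hφi n).pow 7).mul (hPc n)).aestronglyMeasurable
    · rw [Real.norm_eq_abs, abs_mul]
      exact mul_le_mul (hpow 7 n x) (hPle n x) (abs_nonneg _) (by positivity)
  have hl2 : Filter.Tendsto (fun n => ∫ x, dot x e * (φ n x)⁻¹ ^ 6 ∂nuS) Filter.atTop
      (nhds (∫ x, dot x e * (pot ε v x)⁻¹ ^ 6 ∂nuS)) := by
    refine tendsto_integral_of_dominated_convergence (fun _ => 1 * (ε * m)⁻¹ ^ 6) (fun n => ?_)
      (integrable_const _) (fun n => Filter.Eventually.of_forall fun x => ?_)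
      (Filter.Eventually.of_forall fun x => ((hinv x).pow 6).const_mul _)
    · have := hφi n
      exact Continuous.aestronglyMeasurable (by fun_prop)
    · rw [Real.norm_eq_abs, abs_mul]
      exact mul_le_mul (abs_dot_le_one x e) (hpow 6 n x) (abs_nonneg _) zero_le_one
  have hl3 : Filter.Tendsto (fun n => ∫ x, v x ^ 7 * P n x ∂nuS) Filter.atTop
      (nhds (∫ x, v x ^ 7 * P₀ x ∂nuS)) := by
    refine tendsto_integral_of_dominated_convergence (fun x => v x ^ 7 * m) (fun n => ?_)
      (Continuous.integrable_nuS (by fun_prop)) (fun n => Filter.Eventually.of_forall fun x => ?_)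
      (Filter.Eventually.of_forall fun x => (hPlim x).const_mul _)
    · exact (hf.mul (hPc n)).aestronglyMeasurable
    · rw [Real.norm_eq_abs, abs_mul, abs_of_pos (hf0 x)]
      exact mul_le_mul_of_nonneg_left (hPle n x) (hf0 x).le
  have h1 := tendsto_nhds_unique hl1 ((hl2.const_mul (-(1 / 2))).congr fun n => (hparts n).symm)
  have h2 : ∫ x, v x ^ 7 * P₀ x ∂nuS =
      -(1 / 2) * form (fun p => dist p.1 p.2 * dot p.1 e) (fun x => v x ^ 7) fun x => v x ^ 7 :=
    tendsto_nhds_unique hl3 ((tendsto_form_pk e hf).congr fun n =>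
      form_eq (continuous_pk e n) hf hf)
  have h3 : ∫ x, v x ^ 7 * P₀ x ∂nuS = c ^ 7 * ∫ x, (pot ε v x)⁻¹ ^ 7 * P₀ x ∂nuS := by
    rw [← integral_const_mul]
    refine integral_congr_ae (hc.mono fun x hx => ?_)
    have := (hpos x).ne'
    simp only [← hx]
    field_simp
  have h4 : ∫ x, dot x e * (v x ^ 7 * pot ε v x) ∂nuS =
      c ^ 7 * ∫ x, dot x e * (pot ε v x)⁻¹ ^ 6 ∂nuS := by
    rw [← integral_const_mul]
    refine integral_congr_ae (hc.mono fun x hx => ?_)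
    have := (hpos x).ne'
    simp only [← hx]
    field_simp
  have h5 : form (fun p => dist p.1 p.2 * dot p.1 e) (fun x => v x ^ 7) (fun x => v x ^ 7) =
      ∫ x, dot x e * (v x ^ 7 * pot ε v x) ∂nuS - ε * m * ∫ x, dot x e * v x ^ 7 ∂nuS := by
    have := continuous_pot ε hv
    rw [form_eq (by fun_prop) hf hf, ← integral_const_mul,
      ← integral_sub_sph (by fun_prop) (by fun_prop)]
    refine integral_congr_ae (Filter.Eventually.of_forall fun x => ?_)
    simp only [hpot, mul_right_comm _ (dot x e), integral_mul_const]
    ring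
  have h6 : ε * m * ∫ x, dot x e * v x ^ 7 ∂nuS = 0 := by
    rw [h1] at h3
    linarith
  exact (mul_eq_zero.1 h6).resolve_left (mul_pos hε hm0).ne'

theorem integral_zonal (κ : ℝ → ℝ) (x z : Sph) :
    ∫ y, κ (dot x y) ∂nuS = ∫ y, κ (dot z y) ∂nuS := by
  set e : Sph := qmk 1 0 0 0 (by norm_num)
  have h : ∀ w, ∫ y, κ (dot w y) ∂nuS = ∫ y, κ (dot e y) ∂nuS := fun w => by
    rw [← integral_qm_left w]
    refine integral_congr_ae (Filter.Eventually.of_forall fun q => ?_)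
    have h1 := w.sum_sq
    have h2 : dot w (qm w q) = dot e q := by
      simp only [dot, qm_val, qmul_zero', qmul_one', qmul_two', qmul_three', e, qmk_val]
      simp
      linear_combination q.1 0 * h1
    simp only [h2]
  rw [h, h z]

theorem form_zonal {k : Sph × Sph → ℝ} (hk : Continuous k) (κ : ℝ → ℝ)
    (h : ∀ x y, k (x, y) = κ (dot x y)) {g : Sph → ℝ} (hg : Continuous g) :
    volS * form k g (fun _ => 1) = form k (fun _ => 1) (fun _ => 1) * ∫ x, g x ∂nuS := by
  set e : Sph := qmk 1 0 0 0 (by norm_num)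
  have h1 : ∀ x, ∫ y, k (x, y) * 1 ∂nuS = ∫ y, κ (dot e y) ∂nuS := fun x => by
    simp only [h, mul_one]
    exact integral_zonal κ x e
  rw [form_eq hk hg continuous_const, form_eq hk continuous_const continuous_const]
  simp only [h1, integral_mul_const, integral_const_nuS]
  ring

theorem integral_dot (e : Sph) : ∫ x, dot x e ∂nuS = 0 := by
  have := (flowDeriv_dj 0 e).integral_eq_zero
    ((continuous_dj 0).comp (by fun_prop : Continuous fun x : Sph => (x, e))) (by fun_prop)
  rwa [integral_neg, neg_eq_zero] at this

theorem IsC2.integral_lap {F L : Sph → ℝ} {G : Fin 3 → Sph → ℝ} (h : IsC2 F G L) :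
    ∫ x, L x ∂nuS = 0 := by
  obtain ⟨H, hH, hd, hs⟩ := h.lap
  simp only [hs]
  rw [integral_sum_sph _ fun a _ => hH a]
  exact Finset.sum_eq_zero fun a _ => (hd a).integral_eq_zero (h.contG a) (hH a)

theorem sqrt_rr_le (n : ℕ) (p : Sph × Sph) : rr n p ^ (1 / 2 : ℝ) ≤ 5 := by
  rw [← Real.sqrt_eq_rpow]
  exact Real.sqrt_le_iff.2 ⟨by norm_num, by linarith [rr_le n p]⟩

theorem tk_sq_sub_mul_le (n : ℕ) (p : Sph × Sph) :
    (tk n ^ 2 - 4) * rr n p ^ (-1 / 2 : ℝ) ≤ 5 * sqrt (tk n - 2) := by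
  have h0 := two_lt_tk n
  have h1 : tk n - 2 ≤ rr n p := by simp only [rr]; linarith [dot_le_one p.1 p.2]
  have h2 := rr_rpow_half_mul n p
  rw [show (1 / 2 - 1 : ℝ) = -1 / 2 by norm_num] at h2
  have h3 : 0 < rr n p ^ (-1 / 2 : ℝ) := Real.rpow_pos_of_pos (rr_pos n p) _
  have h4 := Real.sqrt_le_sqrt h1
  have h5 := Real.mul_self_sqrt (by linarith : 0 ≤ tk n - 2)
  have h6 := Real.sqrt_nonneg (tk n - 2)
  have h7 : rr n p ^ (-1 / 2 : ℝ) * sqrt (tk n - 2) ≤ 1 :=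
    (mul_le_mul_of_nonneg_left h4 h3.le).trans_eq h2
  calc (tk n ^ 2 - 4) * rr n p ^ (-1 / 2 : ℝ) =
        (tk n + 2) * sqrt (tk n - 2) * (rr n p ^ (-1 / 2 : ℝ) * sqrt (tk n - 2)) := by
        linear_combination -(tk n + 2) * rr n p ^ (-1 / 2 : ℝ) * h5
    _ ≤ (tk n + 2) * sqrt (tk n - 2) * 1 :=
        mul_le_mul_of_nonneg_left h7 (mul_nonneg (by linarith) h6)
    _ ≤ 5 * sqrt (tk n - 2) := by
        rw [mul_one]
        exact mul_le_mul_of_nonneg_right (by linarith [tk_le_three n]) h6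

theorem tendsto_tk_sq_sub_mul (p : Sph × Sph) :
    Filter.Tendsto (fun n => (tk n ^ 2 - 4) * rr n p ^ (-1 / 2 : ℝ)) Filter.atTop (nhds 0) := by
  refine squeeze_zero (fun n => ?_) (fun n => tk_sq_sub_mul_le n p) ?_
  · exact mul_nonneg (by nlinarith [two_lt_tk n]) (Real.rpow_nonneg (rr_pos n p).le _)
  · have := ((tendsto_tk.sub_const 2).sqrt).const_mul 5
    simpa using this

theorem integral_psi_one (n : ℕ) (a : ℝ) :
    ∫ x, psi (tk n) a (fun _ => 1) x ∂nuS =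
      form (fun p => rr n p ^ a) (fun _ => 1) (fun _ => 1) := by
  rw [form_eq (continuous_rr_rpow n a) continuous_const continuous_const]
  simp only [one_mul, psi, rr]

/-- The first moment of the distance on the sphere. -/
theorem form_dot_mul_dist :
    7 * form (fun p => dot p.1 p.2 * dist p.1 p.2) (fun _ => 1) (fun _ => 1) =
    -form (fun p => dist p.1 p.2) (fun _ => 1) (fun _ => 1) := by
  have hz : ∀ n, form (fun p => -(21 / 4) * (rr n p * rr n p ^ (1 / 2 : ℝ)) +
      6 * tk n * rr n p ^ (1 / 2 : ℝ) + -(3 / 4) * ((tk n ^ 2 - 4) * rr n p ^ (-1 / 2 : ℝ)))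
      (fun _ => 1) (fun _ => 1) = 0 := fun n => by
    have hc := fun a => continuous_rr_rpow n a
    have h1 := (isC2_psi (two_lt_tk n) (3 / 2) (f := fun _ => 1) continuous_const).integral_lap
    have hp := fun a => continuous_psi (two_lt_tk n) a (f := fun _ => 1) continuous_const
    rw [integral_sub_sph (by fun_prop) (by fun_prop), integral_add_sph (by fun_prop) (by fun_prop),
      integral_const_mul, integral_const_mul, integral_const_mul, integral_psi_one,
      integral_psi_one, integral_psi_one] at h1
    have h2 : ∀ p, rr n p * rr n p ^ (1 / 2 : ℝ) = rr n p ^ (3 / 2 : ℝ) := fun p => by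
      rw [← Real.rpow_one_add' (rr_pos n p).le (by norm_num)]
      norm_num
    simp only [h2]
    rw [form_add_kernel (by fun_prop) (by fun_prop) continuous_const continuous_const,
      form_add_kernel (by fun_prop) (by fun_prop) continuous_const continuous_const,
      form_const_mul, form_const_mul, form_const_mul, form_const_mul]
    norm_num at h1 ⊢
    linarith
  have hl := tendsto_form (C := 400) (kn := fun n p => -(21 / 4) * (rr n p * rr n p ^ (1 / 2 : ℝ)) +
      6 * tk n * rr n p ^ (1 / 2 : ℝ) + -(3 / 4) * ((tk n ^ 2 - 4) * rr n p ^ (-1 / 2 : ℝ)))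
      (k := fun p => -(21 / 4) * (dist p.1 p.2 ^ 2 * dist p.1 p.2) + 6 * 2 * dist p.1 p.2
        + -(3 / 4) * 0)
      (fun n => ?_) (fun n p => ?_) (fun p => ?_) (f := fun _ => 1) (g := fun _ => 1)
      continuous_const continuous_const
  · have h1 := tendsto_nhds_unique (hl.congr hz) tendsto_const_nhds
    have h2 : (fun p : Sph × Sph => -(21 / 4) * (dist p.1 p.2 ^ 2 * dist p.1 p.2) +
        6 * 2 * dist p.1 p.2 + -(3 / 4) * 0) = fun p => (3 / 2) * dist p.1 p.2 +
        (21 / 2) * (dot p.1 p.2 * dist p.1 p.2) := by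
      ext p
      rw [dist_sq]
      ring
    rw [h2, form_add_kernel (by fun_prop) (by fun_prop) continuous_const continuous_const,
      form_const_mul, form_const_mul] at h1
    linarith
  · have hc := fun a => continuous_rr_rpow n a
    have : Continuous (rr n) := by unfold rr; fun_prop
    fun_prop
  · have h1 := sqrt_rr_le n p
    have h2 := rr_le n p
    have h3 := rr_pos n p
    have h4 : 0 ≤ rr n p ^ (1 / 2 : ℝ) := Real.rpow_nonneg h3.le _
    have h5 := tk_sq_sub_mul_le n p
    have h6 : 0 ≤ (tk n ^ 2 - 4) * rr n p ^ (-1 / 2 : ℝ) :=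
      mul_nonneg (by nlinarith [two_lt_tk n]) (Real.rpow_nonneg h3.le _)
    have h7 : sqrt (tk n - 2) ≤ 1 := Real.sqrt_le_one.2 (by linarith [tk_le_three n])
    have h8 := two_lt_tk n
    have h9 := tk_le_three n
    have h10 : rr n p * rr n p ^ (1 / 2 : ℝ) ≤ 5 * 5 := by gcongr
    have h11 : tk n * rr n p ^ (1 / 2 : ℝ) ≤ 3 * 5 := by gcongr
    have h12 : 0 ≤ tk n * rr n p ^ (1 / 2 : ℝ) := by positivity
    have h13 : 0 ≤ rr n p * rr n p ^ (1 / 2 : ℝ) := by positivity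
    rw [abs_le]
    constructor <;> nlinarith
  · have h1 := tendsto_rr_rpow p (a := 1 / 2) (Or.inr (by norm_num))
    rw [sq_dist_rpow_half] at h1
    exact ((((tendsto_rr p).mul h1).const_mul _).add ((tendsto_tk.const_mul 6).mul h1)).add
      ((tendsto_tk_sq_sub_mul p).const_mul _)

theorem Sph.sum_coord_sq (x : Sph) : ∑ i, x.1 i ^ 2 = 1 := by
  rw [Fin.sum_univ_four, x.sum_sq]

theorem exists_dot_eq_coord (i : Fin 4) : ∃ e : Sph, ∀ x, dot x e = x.1 i := by
  refine ⟨⟨EuclideanSpace.single i 1, by simp⟩, fun x => ?_⟩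
  simp only [dot]
  fin_cases i <;> simp

/-- The sharp lower bound for the regularized quotient. -/
theorem quot_ge {ε : ℝ} (hε : 0 < ε) {w : Sph → ℝ} (hw : Continuous w) (hw0 : ∀ x, 0 < w x) :
    form (fun p => dist p.1 p.2) (fun _ => 1) (fun _ => 1) ^ 3 / volS ^ 7 ≤ quot ε w := by
  obtain ⟨v, hv, hv0, hmin⟩ := exists_quot_minimizer hε
  refine le_trans ?_ (hmin w hw hw0)
  obtain ⟨c, hc⟩ := euler_lagrange hε hv hv0 hmin
  have hf : Continuous fun x => v x ^ 7 := by fun_prop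
  have hf0 : ∀ x, 0 < v x ^ 7 := fun x => pow_pos (hv0 x) 7
  have hV := volS_pos
  set 𝒜 := form (fun p => dist p.1 p.2) (fun _ => 1) (fun _ => 1) with hA
  have hA0 : 0 ≤ 𝒜 := integral_nonneg fun p => by simp
  set I := form (kern ε) (fun x => v x ^ 7) (fun x => v x ^ 7) with hI
  set N := ∫ x, v x ^ 6 ∂nuS with hN
  set m := (∫ x, v x ^ 7 ∂nuS) / volS with hm
  have hm0 : 0 < m := div_pos (integral_pos_sph hf hf0) hV
  have hN0 : 0 < N := integral_pos_sph (by fun_prop) fun x => pow_pos (hv0 x) 6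
  have hcen : ∀ i : Fin 4, ∫ x : Sph, x.1 i * v x ^ 7 ∂nuS = 0 := fun i => by
    obtain ⟨e, he⟩ := exists_dot_eq_coord i
    simpa only [he] using centered hε hv hv0 hc e
  have hzero : ∀ i : Fin 4, ∫ x : Sph, x.1 i ∂nuS = 0 := fun i => by
    obtain ⟨e, he⟩ := exists_dot_eq_coord i
    simpa only [he] using integral_dot e
  have hdot : (fun p : Sph × Sph => dot p.1 p.2) = fun p => ∑ i : Fin 4, p.1.1 i * p.2.1 i := by
    ext p; simp [Fin.sum_univ_four, dot]
  have hdf : form (fun p => dot p.1 p.2) (fun x => v x ^ 7) (fun x => v x ^ 7) = 0 := by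
    rw [hdot, form_eq_sum continuous_coord hf]
    simp [hcen]
  have h1 : -(1 / 7) * I ≤ form (fun p => dot p.1 p.2 * dist p.1 p.2) (fun x => v x ^ 7)
      fun x => v x ^ 7 := by
    have h2 := Finset.sum_le_sum fun (i : Fin 4) (_ : i ∈ Finset.univ) =>
      (variation hε hv hv0 hmin (continuous_coord i) hI hN).2
    have hcc := continuous_coord
    rw [← Finset.mul_sum, ← integral_sum_sph _ fun i _ => by have := hcc i; fun_prop] at h2
    simp only [← Finset.mul_sum, Sph.sum_coord_sq, mul_one, ← hN] at h2
    have h3 : ∑ i : Fin 4, form (kern ε) (fun x => v x ^ 7 * x.1 i) (fun x => v x ^ 7 * x.1 i) =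
        form (fun p => dot p.1 p.2 * dist p.1 p.2 + ε * dot p.1 p.2) (fun x => v x ^ 7)
          fun x => v x ^ 7 := by
      unfold form
      rw [← integral_finsetSum _ fun i _ => integrable_prod_sph (by have := hcc i; fun_prop)]
      refine integral_congr_ae (Filter.Eventually.of_forall fun p => ?_)
      simp only [Fin.sum_univ_four, kern, dot]
      ring
    rw [h3, form_add_kernel (by fun_prop) (by fun_prop) hf hf, form_const_mul, hdf] at h2
    field_simp at h2 ⊢
    linarith
  set g : Sph → ℝ := fun x => v x ^ 7 + -m * 1 with hg
  have hgc : Continuous g := by fun_prop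
  have hg0 : ∫ x, g x ∂nuS = 0 := by
    rw [integral_add_sph (by fun_prop) (by fun_prop), integral_const_nuS, hm]
    field_simp
    ring
  have hgi : ∀ i : Fin 4, ∫ x : Sph, x.1 i * g x ∂nuS = 0 := fun i => by
    have hcc := continuous_coord i
    simp only [hg, mul_add]
    rw [integral_add_sph (by fun_prop) (by fun_prop), integral_mul_const, hcen, hzero]
    simp
  have h2 := form_dot_dist_nonpos hgc hgi
  have hfg : (fun x => v x ^ 7) = fun x => g x + m * 1 := by ext x; simp [hg]
  have h3 := form_quadratic (k := fun p => dot p.1 p.2 * dist p.1 p.2) (by fun_prop)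
    (fun x y => by simp only [dot_comm x, dist_comm x]) hgc (g := fun _ => 1) continuous_const m
  have h4 := form_zonal (k := fun p => dot p.1 p.2 * dist p.1 p.2) (by fun_prop)
    (fun t => t * (sqrt 2 * sqrt (1 - t))) (fun x y => by simp only [dist_eq_sqrt]) hgc
  rw [hg0, mul_zero, mul_eq_zero, or_iff_right hV.ne'] at h4
  rw [← hfg, h4] at h3
  have h5 := form_dot_mul_dist
  have h6 : m ^ 2 * 𝒜 ≤ I := by nlinarith
  have h7 := integral_pow_le_sph 6 (P := fun x => v x ^ 7) (Q := fun _ => 1)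
    (W := fun x => v x ^ 6) hf continuous_const (by fun_prop) hf0 (fun _ => one_pos)
    (fun x => pow_pos (hv0 x) 6) (fun x => by ring)
  rw [integral_const_nuS, ← hN, show ∫ x, v x ^ 7 ∂nuS = m * volS by rw [hm]; field_simp] at h7
  rw [quot, ← hI, ← hN, div_le_div_iff₀ (by positivity) (by positivity)]
  calc 𝒜 ^ 3 * N ^ 7 ≤ 𝒜 ^ 3 * ((m * volS) ^ 6 * (volS * 1)) := by
        rw [mul_comm volS 1, one_mul] at h7 ⊢
        exact mul_le_mul_of_nonneg_left (by simpa using h7) (by positivity)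
    _ = (m ^ 2 * 𝒜) ^ 3 * volS ^ 7 := by ring
    _ ≤ I ^ 3 * volS ^ 7 := by gcongr

/-- The reverse Hardy-Littlewood-Sobolev inequality on the three-sphere. -/
theorem reverse_hls {w : Sph → ℝ} (hw : Continuous w) (hw0 : ∀ x, 0 < w x) :
    form (fun p => dist p.1 p.2) (fun _ => 1) (fun _ => 1) ^ 3 / volS ^ 7 *
      (∫ x, w x ^ 6 ∂nuS) ^ 7 ≤
      form (fun p => dist p.1 p.2) (fun x => w x ^ 7) (fun x => w x ^ 7) ^ 3 := by
  have hN0 : 0 < ∫ x, w x ^ 6 ∂nuS := integral_pos_sph (by fun_prop) fun x => pow_pos (hw0 x) 6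
  have h : ∀ ε > 0, form (fun p => dist p.1 p.2) (fun _ => 1) (fun _ => 1) ^ 3 / volS ^ 7 *
      (∫ x, w x ^ 6 ∂nuS) ^ 7 ≤ (form (fun p => dist p.1 p.2) (fun x => w x ^ 7)
        (fun x => w x ^ 7) + ε * ((∫ x, w x ^ 7 ∂nuS) * ∫ x, w x ^ 7 ∂nuS)) ^ 3 := fun ε hε => by
    rw [← form_const_kernel, ← form_add_kernel (by fun_prop) (by fun_prop) (by fun_prop)
      (by fun_prop), ← le_div_iff₀ (by positivity)]
    exact quot_ge hε hw hw0
  have hl : Filter.Tendsto (fun ε : ℝ => (form (fun p => dist p.1 p.2) (fun x => w x ^ 7)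
      (fun x => w x ^ 7) + ε * ((∫ x, w x ^ 7 ∂nuS) * ∫ x, w x ^ 7 ∂nuS)) ^ 3)
      (nhdsWithin 0 (Ioi 0)) (nhds ((form (fun p => dist p.1 p.2) (fun x => w x ^ 7)
      (fun x => w x ^ 7) + 0 * ((∫ x, w x ^ 7 ∂nuS) * ∫ x, w x ^ 7 ∂nuS)) ^ 3)) :=
    Filter.Tendsto.mono_left (Continuous.tendsto (by fun_prop) 0) nhdsWithin_le_nhds
  rw [zero_mul, add_zero] at hl
  exact ge_of_tendsto hl (eventually_mem_nhdsWithin.mono h)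

/-- The approximate identity obtained from the Paneitz operator. -/
def ak (n : ℕ) (p : Sph × Sph) : ℝ := (tk n ^ 2 - 4) ^ 2 * rr n p ^ (-7 / 2 : ℝ)

theorem ak_nonneg (n : ℕ) (p : Sph × Sph) : 0 ≤ ak n p :=
  mul_nonneg (sq_nonneg _) (Real.rpow_nonneg (rr_pos n p).le _)

@[fun_prop]
theorem continuous_ak (n : ℕ) : Continuous (ak n) := (continuous_rr_rpow n _).const_mul _

theorem form_ak (n : ℕ) {f g : Sph → ℝ} (hf : Continuous f) (hg : Continuous g) :
    form (ak n) f g = (tk n ^ 2 - 4) ^ 2 * ∫ x, f x * psi (tk n) (-7 / 2) g x ∂nuS := by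
  have := form_eq (k := fun p => rr n p ^ (-7 / 2 : ℝ)) (continuous_rr_rpow n _) hf hg
  simp only [rr] at this
  simp only [psi]
  rw [← this, ← form_const_mul]
  rfl

theorem form_ak_one (n : ℕ) : form (ak n) (fun _ => 1) (fun _ => 1) =
    form (fun p => rr n p ^ (1 / 2 : ℝ)) (fun _ => 1) (fun _ => 1) := by
  obtain ⟨G, GM, M, W, h1, h2, h3⟩ :=
    exists_isC2_psi_half (two_lt_tk n) (f := fun _ => 1) continuous_const
  have hM := h2.cont
  have hW := h2.contL
  have hψ := h1.cont
  have h4 := congrArg (fun F : Sph → ℝ => ∫ x, F x ∂nuS) (funext h3)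
  rw [integral_sub_sph (by fun_prop) (by fun_prop), integral_add_sph (by fun_prop) (by fun_prop),
    integral_const_mul, integral_const_mul, integral_const_mul, h1.integral_lap, h2.integral_lap,
    integral_psi_one] at h4
  rw [form_ak n continuous_const continuous_const]
  simp only [one_mul]
  linarith

theorem tendsto_form_half {f g : Sph → ℝ} (hf : Continuous f) (hg : Continuous g) :
    Filter.Tendsto (fun n => form (fun p => rr n p ^ (1 / 2 : ℝ)) f g) Filter.atTop
      (nhds (form (fun p => dist p.1 p.2) f g)) := by
  refine tendsto_form (C := 5) (fun n => continuous_rr_rpow n _) (fun n p => ?_) (fun p => ?_) hf hg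
  · rw [abs_of_nonneg (Real.rpow_nonneg (rr_pos n p).le _)]
    exact sqrt_rr_le n p
  · have := tendsto_rr_rpow p (a := 1 / 2) (Or.inr (by norm_num))
    rwa [sq_dist_rpow_half] at this

theorem abs_form_le {k l : Sph × Sph → ℝ} {f g : Sph → ℝ} (hl : Continuous l)
    (h : ∀ p, |k p * (f p.1 * g p.2)| ≤ l p) :
    |form k f g| ≤ form l (fun _ => 1) fun _ => 1 := by
  simp only [form, mul_one]
  exact norm_integral_le_of_norm_le (f := fun p => k p * (f p.1 * g p.2)) (integrable_prod_sph hl)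
    (Filter.Eventually.of_forall h)

theorem form_sub_left {k : Sph × Sph → ℝ} (hk : Continuous k) {f g h : Sph → ℝ}
    (hf : Continuous f) (hg : Continuous g) (hh : Continuous h) :
    form k f h - form k g h = form (fun p => k p * (f p.1 - g p.1)) (fun _ => 1) h := by
  rw [form, form, form, ← integral_sub (integrable_prod_sph (by fun_prop))
    (integrable_prod_sph (by fun_prop))]
  exact integral_congr_ae (Filter.Eventually.of_forall fun p => by ring)

theorem exists_modulus {h : Sph → ℝ} (hh : Continuous h) {τ : ℝ} (hτ : 0 < τ) :
    ∃ C, 0 ≤ C ∧ ∀ x y, |h x - h y| ≤ τ + C * dist x y ^ 7 := by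
  obtain ⟨B, hB0, hB⟩ := exists_bound_sph hh
  obtain ⟨δ, hδ, hu⟩ :=
    Metric.uniformContinuous_iff.1 (CompactSpace.uniformContinuous_of_continuous hh) τ hτ
  refine ⟨2 * B / δ ^ 7, by positivity, fun x y => ?_⟩
  rcases lt_or_ge (dist x y) δ with hd | hd
  · exact (hu hd).le.trans (le_add_of_nonneg_right (by positivity))
  · have h1 : |h x - h y| ≤ 2 * B := (abs_sub _ _).trans (by linarith [hB x, hB y])
    have h2 : 1 ≤ dist x y ^ 7 / δ ^ 7 := by
      rw [one_le_div (by positivity)]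
      gcongr
    calc |h x - h y| ≤ 2 * B * 1 := by linarith
      _ ≤ 2 * B * (dist x y ^ 7 / δ ^ 7) := by gcongr
      _ = 2 * B / δ ^ 7 * dist x y ^ 7 := by ring
      _ ≤ _ := by linarith

theorem ak_mul_dist_le (n : ℕ) (p : Sph × Sph) :
    ak n p * dist p.1 p.2 ^ 7 ≤ (tk n ^ 2 - 4) ^ 2 := by
  have h1 := sq_dist_le_rr n p
  rw [← dist_sq] at h1
  have h2 : dist p.1 p.2 ^ 7 ≤ rr n p ^ (7 / 2 : ℝ) := by
    calc dist p.1 p.2 ^ 7 = (dist p.1 p.2 ^ 2) ^ (7 / 2 : ℝ) := by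
          rw [← Real.rpow_natCast_mul dist_nonneg, ← Real.rpow_natCast]
          norm_num
      _ ≤ _ := Real.rpow_le_rpow (sq_nonneg _) h1 (by norm_num)
  have h3 : rr n p ^ (-7 / 2 : ℝ) * rr n p ^ (7 / 2 : ℝ) = 1 := by
    rw [← Real.rpow_add (rr_pos n p)]
    norm_num
  have h4 : rr n p ^ (-7 / 2 : ℝ) * dist p.1 p.2 ^ 7 ≤ 1 :=
    (mul_le_mul_of_nonneg_left h2 (Real.rpow_nonneg (rr_pos n p).le _)).trans_eq h3
  rw [ak, mul_assoc]
  exact mul_le_of_le_one_right (sq_nonneg _) h4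

theorem tendsto_form_ak_one : Filter.Tendsto (fun n => form (ak n) (fun _ => 1) (fun _ => 1))
    Filter.atTop (nhds (form (fun p => dist p.1 p.2) (fun _ => 1) fun _ => 1)) := by
  simp only [form_ak_one]
  exact tendsto_form_half continuous_const continuous_const

theorem tendsto_form_ak {h f : Sph → ℝ} (hh : Continuous h) (hf : Continuous f) :
    Filter.Tendsto (fun n => form (ak n) h f) Filter.atTop
      (nhds (form (fun p => dist p.1 p.2) (fun _ => 1) (fun _ => 1) / volS *
        ∫ x, h x * f x ∂nuS)) := by
  set 𝒜 := form (fun p => dist p.1 p.2) (fun _ => 1) (fun _ => 1) with hA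
  have hA0 : 0 ≤ 𝒜 := integral_nonneg fun p => by simp
  obtain ⟨M, hM0, hM⟩ := exists_bound_sph hf
  have h1 : ∀ n, form (ak n) (fun _ => 1) (fun x => h x * f x) =
      form (ak n) (fun _ => 1) (fun _ => 1) / volS * ∫ x, h x * f x ∂nuS := fun n => by
    have h2 := form_zonal (continuous_ak n)
      (fun t => (tk n ^ 2 - 4) ^ 2 * (tk n - 2 * t) ^ (-7 / 2 : ℝ)) (fun x y => rfl)
      (g := fun x => h x * f x) (by fun_prop)
    have h3 := volS_pos.ne'
    rw [form_comm (fun x y => by simp only [ak, rr, dot_comm x]), div_mul_eq_mul_div,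
      eq_div_iff h3, mul_comm, h2]
  have h2 : Filter.Tendsto (fun n => form (ak n) (fun _ => 1) (fun x => h x * f x)) Filter.atTop
      (nhds (𝒜 / volS * ∫ x, h x * f x ∂nuS)) := by
    simp only [h1]
    exact (tendsto_form_ak_one.div_const _).mul_const _
  have h3 : Filter.Tendsto (fun n => form (ak n) h f - form (ak n) (fun _ => 1)
      (fun x => h x * f x)) Filter.atTop (nhds 0) := by
    rw [Metric.tendsto_nhds]
    intro ε hε
    obtain ⟨C, hC0, hC⟩ := exists_modulus hh (τ := ε / (2 * (M * 𝒜 + 1))) (by positivity)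
    set τ := ε / (2 * (M * 𝒜 + 1)) with hτ
    have h4 : Filter.Tendsto (fun n => M * τ * form (ak n) (fun _ => 1) (fun _ => 1) +
        M * C * (tk n ^ 2 - 4) ^ 2 * (volS * volS)) Filter.atTop
        (nhds (M * τ * 𝒜 + M * C * (2 ^ 2 - 4) ^ 2 * (volS * volS))) :=
      (tendsto_form_ak_one.const_mul _).add
        (((((tendsto_tk.pow 2).sub_const 4).pow 2).const_mul _).mul_const _)
    have h5 : M * τ * 𝒜 + M * C * (2 ^ 2 - 4) ^ 2 * (volS * volS) < ε := by
      have h6 : (M * 𝒜 + 1) * τ = ε / 2 := by rw [hτ]; field_simp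
      have h7 : 0 < τ := by positivity
      norm_num
      nlinarith
    filter_upwards [h4.eventually_lt_const h5] with n hn
    rw [Real.dist_eq, sub_zero]
    refine lt_of_le_of_lt ?_ hn
    have h6 : form (ak n) h f - form (ak n) (fun _ => 1) (fun x => h x * f x) =
        form (fun p => ak n p * (h p.1 - h p.2)) (fun _ => 1) f := by
      rw [form, form, form, ← integral_sub (integrable_prod_sph (by fun_prop))
        (integrable_prod_sph (by fun_prop))]
      exact integral_congr_ae (Filter.Eventually.of_forall fun p => by ring)
    have h7 := abs_form_le (k := fun p => ak n p * (h p.1 - h p.2)) (f := fun _ => 1) (g := f)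
      (l := fun p => M * τ * ak n p + M * C * (tk n ^ 2 - 4) ^ 2) (by fun_prop) fun p => by
        rw [one_mul, abs_mul, abs_mul, abs_of_nonneg (ak_nonneg n p)]
        have h8 := ak_mul_dist_le n p
        calc ak n p * |h p.1 - h p.2| * |f p.2| ≤
              ak n p * (τ + C * dist p.1 p.2 ^ 7) * M := by
              have := ak_nonneg n p
              have := hC p.1 p.2
              have := hM p.2
              gcongr
          _ = M * τ * ak n p + M * C * (ak n p * dist p.1 p.2 ^ 7) := by ring
          _ ≤ _ := by gcongr
    rw [h6]
    refine h7.trans_eq ?_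
    rw [form_add_kernel (by fun_prop) (by fun_prop) continuous_const continuous_const,
      form_const_mul, form_const_kernel, integral_const_nuS]
    ring
  simpa using h3.add h2

theorem abs_psi_sub_le (n : ℕ) {f : Sph → ℝ} (hf : Continuous f) (x : Sph) :
    |psi (tk n) (1 / 2) f x - ∫ y, dist x y * f y ∂nuS| ≤
      sqrt (tk n - 2) * ∫ y, |f y| ∂nuS := by
  have h1 := continuous_slice (k := fun x y => (tk n - 2 * dot x y) ^ (1 / 2 : ℝ))
    (continuous_kernel (two_lt_tk n) _) x
  rw [psi, ← integral_sub_sph (by fun_prop) (by fun_prop), ← integral_const_mul]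
  refine abs_integral_le_integral_abs.trans (integral_mono_sph (by fun_prop) (by fun_prop)
    fun y => ?_)
  rw [← sub_mul, abs_mul]
  refine mul_le_mul_of_nonneg_right ?_ (abs_nonneg _)
  have h2 := two_lt_tk n
  have h3 := kernel_pos h2 x y
  have h4 : dist x y ≤ sqrt (tk n - 2 * dot x y) :=
    Real.le_sqrt_of_sq_le (by rw [dist_sq]; linarith)
  rw [← Real.sqrt_eq_rpow, abs_of_nonneg (sub_nonneg.2 h4), sub_le_iff_le_add]
  refine Real.sqrt_le_iff.2 ⟨by positivity, ?_⟩
  have h5 := Real.sq_sqrt (by linarith : 0 ≤ tk n - 2)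
  have h6 := Real.sqrt_nonneg (tk n - 2)
  have h7 := dist_sq x y
  nlinarith [mul_nonneg h6 (dist_nonneg (x := x) (y := y))]

theorem tendsto_form_ak_psi {f : Sph → ℝ} (hf : Continuous f) :
    Filter.Tendsto (fun n => form (ak n) (psi (tk n) (1 / 2) f) f) Filter.atTop
      (nhds (form (fun p => dist p.1 p.2) (fun _ => 1) (fun _ => 1) / volS *
        form (fun p => dist p.1 p.2) f f)) := by
  have hK : Continuous fun x => ∫ y, dist x y * f y ∂nuS :=
    continuous_integral_kernel (k := fun x y => dist x y * f y) (by fun_prop)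
  obtain ⟨M, hM0, hM⟩ := exists_bound_sph hf
  have h1 := tendsto_form_ak hK hf
  rw [show ∫ x, (∫ y, dist x y * f y ∂nuS) * f x ∂nuS = form (fun p => dist p.1 p.2) f f by
    rw [form_eq (by fun_prop) hf hf]; simp only [mul_comm (f _)]] at h1
  have h2 : Filter.Tendsto (fun n => form (ak n) (psi (tk n) (1 / 2) f) f -
      form (ak n) (fun x => ∫ y, dist x y * f y ∂nuS) f) Filter.atTop (nhds 0) := by
    refine squeeze_zero_norm (a := fun n => sqrt (tk n - 2) * (∫ y, |f y| ∂nuS) * M *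
      form (ak n) (fun _ => 1) (fun _ => 1)) (fun n => ?_) ?_
    · have hψ := continuous_psi (two_lt_tk n) (1 / 2) hf
      rw [form_sub_left (by fun_prop) (by fun_prop) hK hf, ← form_const_mul, Real.norm_eq_abs]
      refine abs_form_le (by fun_prop) fun p => ?_
      rw [one_mul, abs_mul, abs_mul, abs_of_nonneg (ak_nonneg n p), mul_assoc, mul_comm]
      have h3 := abs_psi_sub_le n hf p.1
      exact mul_le_mul_of_nonneg_right (mul_le_mul h3 (hM p.2) (abs_nonneg _)
        (h3.trans' (abs_nonneg _))) (ak_nonneg n p)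
    · have h3 := ((((tendsto_tk.sub_const 2).sqrt).mul_const (∫ y, |f y| ∂nuS)).mul_const M).mul
        tendsto_form_ak_one
      simpa using h3
  simpa using h2.add h1

theorem form_dist_one_pos : 0 < form (fun p => dist p.1 p.2) (fun _ => 1) fun _ => 1 := by
  have h1 : form (fun p => 1 + -1 * dot p.1 p.2) (fun _ => 1) (fun _ => 1) ≤
      form (fun p => dist p.1 p.2) (fun _ => 1) fun _ => 1 := by
    refine integral_mono (integrable_prod_sph (by fun_prop)) (integrable_prod_sph (by fun_prop))
      fun p => ?_
    have h2 := dist_sq p.1 p.2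
    have h3 := dist_le_two p.1 p.2
    have h4 : 0 ≤ dist p.1 p.2 := dist_nonneg
    simp only [mul_one]
    nlinarith
  refine lt_of_lt_of_le ?_ h1
  have h2 : form (fun p => dot p.1 p.2) (fun _ => 1) (fun _ => 1) = 0 := by
    rw [form_eq (by fun_prop) continuous_const continuous_const]
    have h3 : ∀ x, ∫ y, dot x y ∂nuS = 0 := fun x => by
      simpa only [dot_comm x] using integral_dot x
    simp [h3]
  have h3 := volS_pos
  rw [form_add_kernel (by fun_prop) (by fun_prop) continuous_const continuous_const,
    form_const_kernel, form_const_mul, h2, integral_const_nuS]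
  simpa using h3.ne'

/-- The sharp inequality for the Paneitz operator. -/
theorem IsC2.integral_mul_neg_energy_le {F L : Sph → ℝ} {G : Fin 3 → Sph → ℝ} (h : IsC2 F G L)
    (h0 : ∀ x, 0 < F x) :
    (∫ x, (F x)⁻¹ ^ 6 ∂nuS) * (-energy F G L) ^ 3 ≤ (15 / 16) ^ 3 * volS ^ 4 := by
  have hF := h.cont
  have hV := volS_pos
  have hFi : Continuous fun x => (F x)⁻¹ := hF.inv₀ fun x => (h0 x).ne'
  have hf : Continuous fun x => (F x)⁻¹ ^ 7 := by fun_prop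
  have hi0 : ∀ x, 0 < (F x)⁻¹ := fun x => inv_pos.2 (h0 x)
  have hf0 : ∀ x, 0 < (F x)⁻¹ ^ 7 := fun x => pow_pos (hi0 x) 7
  have hR := reverse_hls hFi hi0
  set 𝒜 := form (fun p => dist p.1 p.2) (fun _ => 1) (fun _ => 1) with hA
  set N := ∫ x, (F x)⁻¹ ^ 6 ∂nuS with hN
  set Q := form (fun p => dist p.1 p.2) (fun x => (F x)⁻¹ ^ 7) (fun x => (F x)⁻¹ ^ 7) with hQ
  have hN0 : 0 < N := integral_pos_sph (by fun_prop) fun x => pow_pos (hi0 x) 6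
  rcases le_or_gt 0 (energy F G L) with hE | hE
  · have : (-energy F G L) ^ 3 ≤ 0 := by
      have := pow_nonneg hE 3
      rw [Odd.neg_pow (by decide)]
      linarith
    nlinarith [mul_nonneg hN0.le (neg_nonneg.2 this), pow_pos hV 4]
  have hA0 : 0 < 𝒜 := form_dist_one_pos
  have hm0 : 0 < ∫ x, (F x)⁻¹ ^ 7 ∂nuS := integral_pos_sph hf hf0
  have hl : 0 < form (fun p => dist p.1 p.2) (fun x => (F x)⁻¹ ^ 7) (fun _ => 1) := by
    have h1 := form_zonal (k := fun p => dist p.1 p.2) (by fun_prop)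
      (fun t => sqrt 2 * sqrt (1 - t)) dist_eq_sqrt hf
    exact pos_of_mul_pos_right (h1 ▸ mul_pos hA0 hm0) hV.le
  have hψ : ∀ n, ∫ x, psi (tk n) (1 / 2) (fun x => (F x)⁻¹ ^ 7) x ∂nuS =
      form (fun p => rr n p ^ (1 / 2 : ℝ)) (fun x => (F x)⁻¹ ^ 7) (fun _ => 1) := fun n => by
    rw [form_comm (fun x y => by simp only [rr, dot_comm x]),
      form_eq (continuous_rr_rpow n _) continuous_const hf]
    simp only [one_mul, psi, rr]
  have hψ0 : ∀ n, 0 < ∫ x, psi (tk n) (1 / 2) (fun x => (F x)⁻¹ ^ 7) x ∂nuS := fun n =>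
    integral_pos_sph (continuous_psi (two_lt_tk n) _ hf) fun x => integral_pos_sph
      ((continuous_slice (k := fun x y => (tk n - 2 * dot x y) ^ (1 / 2 : ℝ))
        (continuous_kernel (two_lt_tk n) _) x).fun_mul hf) fun y =>
      mul_pos (Real.rpow_pos_of_pos (kernel_pos (two_lt_tk n) x y) _) (hf0 y)
  obtain ⟨s, hs⟩ : ∃ s, Filter.Tendsto (fun n => (∫ x, F x ∂nuS) /
      ∫ x, psi (tk n) (1 / 2) (fun x => (F x)⁻¹ ^ 7) x ∂nuS) Filter.atTop (nhds s) := by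
    simp only [hψ]
    exact ⟨_, tendsto_const_nhds.div (tendsto_form_half hf continuous_const) hl.ne'⟩
  have hB := tendsto_form_ak hF hf
  have hC := tendsto_form_ak_psi hf
  rw [show ∫ x, F x * (F x)⁻¹ ^ 7 ∂nuS = N from integral_congr_ae
    (Filter.Eventually.of_forall fun x => by have := (h0 x).ne'; field_simp)] at hB
  have hlow : -(15 / 16) * (2 * s * (𝒜 / volS * N) - s ^ 2 * (𝒜 / volS * Q)) ≤ energy F G L := by
    refine le_of_tendsto
      ((((hs.const_mul 2).mul hB).sub ((hs.pow 2).mul hC)).const_mul (-(15 / 16)))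
      (Filter.Eventually.of_forall fun n => ?_)
    rw [form_ak n hF hf, form_ak n (continuous_psi (two_lt_tk n) _ hf) hf]
    exact h.energy_ge (two_lt_tk n) hf (div_mul_cancel₀ _ (hψ0 n).ne').symm
  have hQ0 : 0 < Q := by
    refine (Odd.pow_pos_iff (by decide : Odd 3)).1 (lt_of_lt_of_le ?_ hR)
    positivity
  have h1 : -energy F G L * Q ≤ 15 / 16 * (𝒜 / volS) * N ^ 2 := by
    have h2 : 0 ≤ 15 / 16 * (𝒜 / volS) := by positivity
    have h3 := mul_le_mul_of_nonneg_right hlow hQ0.le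
    nlinarith [mul_nonneg h2 (sq_nonneg (N - s * Q))]
  have h2 := pow_le_pow_left₀ (mul_nonneg (by linarith) hQ0.le) h1 3
  have h3 : (N * (-energy F G L) ^ 3) * (𝒜 ^ 3 / volS ^ 7 * N ^ 6) ≤
      (15 / 16) ^ 3 * volS ^ 4 * (𝒜 ^ 3 / volS ^ 7 * N ^ 6) := by
    calc (N * (-energy F G L) ^ 3) * (𝒜 ^ 3 / volS ^ 7 * N ^ 6) =
          (-energy F G L) ^ 3 * (𝒜 ^ 3 / volS ^ 7 * N ^ 7) := by ring
      _ ≤ (-energy F G L) ^ 3 * Q ^ 3 :=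
          mul_le_mul_of_nonneg_left hR (pow_nonneg (by linarith) 3)
      _ = (-energy F G L * Q) ^ 3 := by ring
      _ ≤ (15 / 16 * (𝒜 / volS) * N ^ 2) ^ 3 := h2
      _ = _ := by field_simp
  exact le_of_mul_le_mul_right h3 (by positivity)

/-- Right multiplication by the three imaginary units. -/
def rj (a : Fin 3) (x : E4) : E4 :=
  ![!₂[-x 1, x 0, x 3, -x 2], !₂[-x 2, -x 3, x 0, x 1], !₂[-x 3, x 2, -x 1, x 0]] a

theorem continuous_rj (a : Fin 3) : Continuous (rj a) := by
  have h : ∀ i : Fin 4, Continuous fun x : E4 => x i := fun i => by fun_prop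
  fin_cases a <;>
    refine (PiLp.continuous_toLp 2 _).comp (continuous_pi fun i => ?_) <;>
    fin_cases i <;> simp <;> fun_prop

theorem qm_qexp_val (n : U2) (x : Sph) (s : ℝ) :
    (qm x (qexp n s)).1 = cos s • x.1 + sin s • ∑ a, n.1 a • rj a x.1 := by
  apply E4.ext <;> simp [qexp_val, Fin.sum_univ_three, rj] <;> ring

theorem hasDerivAt_flow (n : U2) (x : Sph) :
    HasDerivAt (fun s => (qm x (qexp n s)).1) (∑ a, n.1 a • rj a x.1) 0 := by
  simp only [qm_qexp_val]
  have := ((hasDerivAt_cos 0).smul_const x.1).fun_add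
    ((hasDerivAt_sin 0).smul_const (∑ a, n.1 a • rj a x.1))
  simpa using this

theorem hasDerivAt_rj_flow (a : Fin 3) (x : Sph) :
    HasDerivAt (fun s => rj a (qm x (qexp (ub a) s)).1) (-x.1) 0 := by
  have h : ∀ s, rj a (qm x (qexp (ub a) s)).1 = cos s • rj a x.1 + sin s • -x.1 := fun s => by
    fin_cases a <;> apply E4.ext <;> simp [qexp_val, rj, ub] <;> ring
  simp only [h]
  have := ((hasDerivAt_cos 0).smul_const (rj a x.1)).fun_add
    ((hasDerivAt_sin 0).smul_const (-x.1))
  simpa using this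

theorem E4.eq_sum_single (x : E4) : x = x 0 • EuclideanSpace.single 0 1 +
    x 1 • EuclideanSpace.single 1 1 + x 2 • EuclideanSpace.single 2 1 +
    x 3 • (EuclideanSpace.single 3 1 : E4) := by
  apply E4.ext <;> simp

/-- The trace of a bilinear form in the frame `x, rj 0 x, rj 1 x, rj 2 x`. -/
theorem trace_frame (B : E4 →L[ℝ] E4 →L[ℝ] ℝ) (x : Sph) :
    ∑ i, B (EuclideanSpace.single i 1) (EuclideanSpace.single i 1) =
      B x.1 x.1 + ∑ a, B (rj a x.1) (rj a x.1) := by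
  have key : ∀ v : E4, B v v = ∑ i, ∑ j, v i * v j *
      B (EuclideanSpace.single i 1) (EuclideanSpace.single j 1) := fun v => by
    conv_lhs => rw [E4.eq_sum_single v]
    simp only [map_add, map_smul, add_apply, smul_apply,
      smul_eq_mul, Fin.sum_univ_four]
    ring
  have h := x.sum_sq
  rw [key, Fin.sum_univ_three, key, key, key]
  simp only [Fin.sum_univ_four, rj]
  simp
  linear_combination -(B (EuclideanSpace.single 0 1) (EuclideanSpace.single 0 1) +
    B (EuclideanSpace.single 1 1) (EuclideanSpace.single 1 1) +
    B (EuclideanSpace.single 2 1) (EuclideanSpace.single 2 1) +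
    B (EuclideanSpace.single 3 1) (EuclideanSpace.single 3 1)) * h

theorem Sph.ne_zero (x : Sph) : x.1 ≠ 0 := ne_zero_of_mem_unit_sphere x

theorem ext0_coe (f : E4 → ℝ) (x : Sph) : ext0 f x.1 = f x.1 := by
  simp [ext0]

theorem ext0_smul (f : E4 → ℝ) {t : ℝ} (ht : 0 < t) (y : E4) : ext0 f (t • y) = ext0 f y := by
  unfold ext0
  rw [norm_smul, Real.norm_of_nonneg ht.le, smul_smul, mul_inv, mul_right_comm,
    inv_mul_cancel₀ ht.ne', one_mul]

theorem H2S3.contDiffOn_fderiv {φ : E4 → ℝ} (h : H2S3 φ) :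
    ContDiffOn ℝ 1 (fderiv ℝ (ext0 φ)) {0}ᶜ :=
  ContDiffOn.fderiv_of_isOpen h isOpen_compl_singleton (by norm_num)

theorem H2S3.hasFDerivAt {φ : E4 → ℝ} (h : H2S3 φ) {y : E4} (hy : y ≠ 0) :
    HasFDerivAt (ext0 φ) (fderiv ℝ (ext0 φ) y) y :=
  ((ContDiffOn.differentiableOn h (by norm_num)).differentiableAt
    (isOpen_compl_singleton.mem_nhds hy)).hasFDerivAt

theorem H2S3.hasFDerivAt_fderiv {φ : E4 → ℝ} (h : H2S3 φ) {y : E4} (hy : y ≠ 0) :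
    HasFDerivAt (fderiv ℝ (ext0 φ)) (fderiv ℝ (fderiv ℝ (ext0 φ)) y) y :=
  ((h.contDiffOn_fderiv.differentiableOn (by norm_num)).differentiableAt
    (isOpen_compl_singleton.mem_nhds hy)).hasFDerivAt

theorem H2S3.continuous_fderiv {φ : E4 → ℝ} (h : H2S3 φ) :
    Continuous fun x : Sph => fderiv ℝ (ext0 φ) x.1 :=
  h.contDiffOn_fderiv.continuousOn.comp_continuous continuous_subtype_val fun x => x.ne_zero

theorem H2S3.continuous_fderiv_fderiv {φ : E4 → ℝ} (h : H2S3 φ) :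
    Continuous fun x : Sph => fderiv ℝ (fderiv ℝ (ext0 φ)) x.1 :=
  (h.contDiffOn_fderiv.continuousOn_fderiv_of_isOpen isOpen_compl_singleton
    le_rfl).comp_continuous continuous_subtype_val fun x => x.ne_zero

/-- Euler's identity for functions homogeneous of degree zero. -/
theorem H2S3.fderiv_self {φ : E4 → ℝ} (h : H2S3 φ) {y : E4} (hy : y ≠ 0) :
    fderiv ℝ (ext0 φ) y y = 0 := by
  have h1 : HasDerivAt (fun t : ℝ => t • y) y 1 := by
    simpa using (hasDerivAt_id (1 : ℝ)).smul_const y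
  have h2 : HasDerivAt (fun t : ℝ => ext0 φ (t • y)) (fderiv ℝ (ext0 φ) y y) 1 :=
    (h.hasFDerivAt hy).comp_hasDerivAt_of_eq 1 h1 (one_smul ℝ y).symm
  have h3 : HasDerivAt (fun t : ℝ => ext0 φ (t • y)) 0 1 := by
    refine (hasDerivAt_const (1 : ℝ) (ext0 φ y)).congr_of_eventuallyEq ?_
    filter_upwards [lt_mem_nhds one_pos] with t ht
    exact ext0_smul φ ht y
  exact h2.unique h3

theorem H2S3.fderiv_fderiv_self {φ : E4 → ℝ} (h : H2S3 φ) {y : E4} (hy : y ≠ 0) :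
    fderiv ℝ (fderiv ℝ (ext0 φ)) y y y = 0 := by
  have h1 := (h.hasFDerivAt_fderiv hy).clm_apply (hasFDerivAt_id y)
  have h2 : HasFDerivAt (fun z => fderiv ℝ (ext0 φ) z z) (0 : E4 →L[ℝ] ℝ) y := by
    refine (hasFDerivAt_const (0 : ℝ) y).congr_of_eventuallyEq ?_
    filter_upwards [isOpen_compl_singleton.mem_nhds hy] with z hz
    exact h.fderiv_self hz
  have h3 := congrArg (fun T : E4 →L[ℝ] ℝ => T y) (h1.unique h2)
  simpa [h.fderiv_self hy] using h3

theorem H2S3.sLap_eq {φ : E4 → ℝ} (h : H2S3 φ) (x : Sph) : sLap φ x.1 =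
    ∑ a, fderiv ℝ (fderiv ℝ (ext0 φ)) x.1 (rj a x.1) (rj a x.1) := by
  have h1 := trace_frame (fderiv ℝ (fderiv ℝ (ext0 φ)) x.1) x
  rw [h.fderiv_fderiv_self x.ne_zero, zero_add] at h1
  rw [← h1, sLap]
  refine Finset.sum_congr rfl fun i _ => ?_
  have := (h.hasFDerivAt_fderiv x.ne_zero).clm_apply
    (hasFDerivAt_const (EuclideanSpace.single i (1 : ℝ)) x.1)
  rw [this.fderiv]
  simp

theorem H2S3.norm_sGrad_sq {φ : E4 → ℝ} (h : H2S3 φ) (x : Sph) :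
    ‖sGrad φ x.1‖ ^ 2 = ∑ a, fderiv ℝ (ext0 φ) x.1 (rj a x.1) ^ 2 := by
  set l := fderiv ℝ (ext0 φ) x.1 with hl
  have h1 := trace_frame (l.smulRight l) x
  simp only [ContinuousLinearMap.smulRight_apply, smul_apply, smul_eq_mul] at h1
  rw [hl, h.fderiv_self x.ne_zero, zero_mul, zero_add, ← hl] at h1
  simp only [sq (l _), ← h1]
  rw [EuclideanSpace.real_norm_sq_eq]
  refine Finset.sum_congr rfl fun i _ => ?_
  have : sGrad φ x.1 i = l (EuclideanSpace.single i 1) := by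
    rw [hl, ← InnerProductSpace.toDual_symm_apply (𝕜 := ℝ), EuclideanSpace.inner_single_right]
    simp [sGrad, gradient]
  rw [this, sq]

theorem H2S3.isC2 {φ : E4 → ℝ} (h : H2S3 φ) : IsC2 (fun x : Sph => φ x.1)
    (fun a x => fderiv ℝ (ext0 φ) x.1 (rj a x.1)) (fun x => sLap φ x.1) := by
  have hrj : ∀ a, Continuous fun x : Sph => rj a x.1 := fun a =>
    (continuous_rj a).comp continuous_subtype_val
  have hH : ∀ a, Continuous fun x : Sph =>
      fderiv ℝ (fderiv ℝ (ext0 φ)) x.1 (rj a x.1) (rj a x.1) := fun a =>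
    (h.continuous_fderiv_fderiv.clm_apply (hrj a)).clm_apply (hrj a)
  refine ⟨?_, fun a => h.continuous_fderiv.clm_apply (hrj a), ?_, fun n x => ?_,
    _, hH, fun a x => ?_, fun x => h.sLap_eq x⟩
  · simp only [← ext0_coe φ]
    exact (ContDiffOn.continuousOn h).comp_continuous continuous_subtype_val fun x => x.ne_zero
  · simp only [h.sLap_eq]
    fun_prop
  · simp only [← ext0_coe φ]
    have := (h.hasFDerivAt x.ne_zero).comp_hasDerivAt_of_eq 0 (hasDerivAt_flow n x)
      (by rw [qm_qexp_zero])
    simpa only [Function.comp_def, map_sum, map_smul, smul_eq_mul] using this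
  · have h1 := hasDerivAt_flow (ub a) x
    have h2 : ∑ b, (ub a).1 b • rj b x.1 = rj a x.1 := by simp [ub, Pi.single_apply]
    rw [h2] at h1
    have h3 := ((h.hasFDerivAt_fderiv x.ne_zero).comp_hasDerivAt_of_eq 0 h1
      (by rw [qm_qexp_zero])).clm_apply (hasDerivAt_rj_flow a x)
    simpa only [Function.comp_def, qm_qexp_zero, map_neg, h.fderiv_self x.ne_zero, neg_zero,
      add_zero] using h3

theorem H2S3.Efun_eq {φ : E4 → ℝ} (h : H2S3 φ) : Efun φ = energy (fun x : Sph => φ x.1)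
    (fun a x => fderiv ℝ (ext0 φ) x.1 (rj a x.1)) (fun x => sLap φ x.1) := by
  have hc := h.isC2
  have h0 := hc.cont
  have h1 := hc.contG
  have h2 := hc.contL
  rw [Efun, integral_muS, energy]
  simp only [h.norm_sGrad_sq]
  rw [integral_sub_sph (by fun_prop) ((h0.fun_pow 2).const_mul _),
    integral_sub_sph (by fun_prop) (by fun_prop), integral_const_mul, integral_const_mul]

theorem sLap_const (c : ℝ) : sLap (fun _ => c) = fun _ => 0 := by
  have : ext0 (fun _ => c) = fun _ => c := rfl
  funext x
  simp [sLap, this]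

theorem Efun_const (c : ℝ) : Efun (fun _ => c) = -(15 / 16) * (volS * c ^ 2) := by
  have h1 : ext0 (fun _ => c) = fun _ => c := rfl
  have h2 : ∀ x, sGrad (fun _ => c) x = 0 := fun x => by simp [sGrad, gradient, h1]
  rw [Efun, sLap_const]
  simp only [h2]
  rw [integral_muS fun _ => (0 : ℝ) ^ 2 - 1 / 2 * ‖(0 : E4)‖ ^ 2 - 15 / 16 * c ^ 2,
    integral_const_nuS, norm_zero]
  ring

/-- The sharp lower bound for the perturbed functional; `c` is the constant with
`‖c⁻¹‖_{L⁶} = 1`. -/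
theorem H2S3.le_invL6sq_mul {φ : E4 → ℝ} (h : H2S3 φ) (h0 : ∀ x ∈ S3, 0 < φ x) {c ε : ℝ}
    (hc : c ^ 6 = volS) (hε : 0 ≤ ε) : (ε - 15 / 16) * (volS * c ^ 2) ≤
      invL6sq φ * (Efun φ + ε * ∫ x, (φ x) ^ 2 ∂muS) := by
  have hC := h.isC2
  have hF := hC.cont
  have hpos : ∀ x : Sph, 0 < φ x.1 := fun x => h0 x.1 x.2
  have hinv : Continuous fun x : Sph => (φ x.1)⁻¹ := hF.inv₀ fun x => (hpos x).ne'
  have h1 := hC.integral_mul_neg_energy_le hpos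
  rw [← h.Efun_eq] at h1
  have h2 := integral_pow_le_sph 3 (W := fun _ => 1) (hF.fun_pow 2) (hinv.fun_pow 6)
    continuous_const (fun x => pow_pos (hpos x) 2) (fun x => pow_pos (inv_pos.2 (hpos x)) 6)
    (fun _ => one_pos) (fun x => by have := (hpos x).ne'; field_simp; norm_num)
  rw [integral_const_nuS, mul_one] at h2
  rw [invL6sq, integral_muS fun x => (φ x)⁻¹ ^ 6, integral_muS fun x => φ x ^ 2]
  set N := ∫ x : Sph, (φ x.1)⁻¹ ^ 6 ∂nuS
  set q := ∫ x : Sph, φ x.1 ^ 2 ∂nuS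
  have hN : 0 ≤ N := integral_nonneg fun x => by positivity
  have hn : (N ^ ((1 : ℝ) / 3)) ^ 3 = N := by
    rw [← Real.rpow_natCast, ← Real.rpow_mul hN]; norm_num
  set n := N ^ ((1 : ℝ) / 3)
  have hodd : StrictMono fun t : ℝ => t ^ 3 := Odd.strictMono_pow (by decide)
  have hV : (volS * c ^ 2) ^ 3 = volS ^ 4 := by linear_combination volS ^ 3 * hc
  have h3 : n * -Efun φ ≤ 15 / 16 * (volS * c ^ 2) := hodd.le_iff_le.1 <| by
    rwa [mul_pow, mul_pow, hn, hV]
  have h4 : volS * c ^ 2 ≤ n * q := hodd.le_iff_le.1 <| by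
    rw [hV, mul_pow n, hn, mul_comm]
    exact h2
  nlinarith [mul_le_mul_of_nonneg_left h4 hε]
/-- For every small `ε > 0`, the perturbed variational problem
`-s_ε = inf { ‖φ⁻¹‖_{L⁶}² (E(φ) + ε‖φ‖_{L²}²) : φ ∈ H²(S³), φ > 0 }` is attained by a
positive smooth `u`; normalizing `‖u⁻¹‖_{L⁶} = 1`, `u` satisfies
`Pu + εu = -s_ε u⁻⁷` on `S³` (here `s_ε = -(E(u) + ε‖u‖_{L²}²)`). -/
theorem stmt_15 : ∃ ε₀ > (0 : ℝ), ∀ ε : ℝ, 0 < ε → ε < ε₀ →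
    ∃ u : E4 → ℝ, SmoothS3 u ∧ (∀ x ∈ S3, 0 < u x) ∧
      (∫ x, ((u x)⁻¹) ^ 6 ∂muS) = 1 ∧
      (∀ φ : E4 → ℝ, H2S3 φ → (∀ x ∈ S3, 0 < φ x) →
        invL6sq u * (Efun u + ε * ∫ x, (u x) ^ 2 ∂muS) ≤
          invL6sq φ * (Efun φ + ε * ∫ x, (φ x) ^ 2 ∂muS)) ∧
      (∀ x ∈ S3, Pan u x + ε * u x =
        -(-(Efun u + ε * ∫ z, (u z) ^ 2 ∂muS)) * ((u x)⁻¹) ^ 7) := by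
  set c : ℝ := volS ^ ((1 : ℝ) / 6)
  have hc0 : 0 < c := Real.rpow_pos_of_pos volS_pos _
  have hc : c ^ 6 = volS := by
    rw [← Real.rpow_natCast, ← Real.rpow_mul volS_pos.le]; norm_num
  have hInt : ∫ _, (c⁻¹) ^ 6 ∂muS = 1 := by
    rw [integral_muS fun _ => c⁻¹ ^ 6, integral_const_nuS, ← hc]
    field_simp
  have hsq : ∫ _, c ^ 2 ∂muS = volS * c ^ 2 := by
    rw [integral_muS fun _ => c ^ 2, integral_const_nuS]
  refine ⟨1, one_pos, fun ε hε _ => ⟨fun _ => c, contDiffOn_const, fun _ _ => hc0, hInt,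
    fun φ hφ hφ0 => ?_, fun x _ => ?_⟩⟩
  · have hle := hφ.le_invL6sq_mul hφ0 hc hε.le
    rw [invL6sq, hInt, Real.one_rpow, one_mul, Efun_const, hsq]
    linarith
  · rw [Efun_const, hsq, Pan, sLap_const, sLap_const, ← hc]
    field_simp
    ring
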